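/- arXiv:1611.08260 — 7 statements merged into one kernel-verified Lean document; each statement's English description precedes it below -/
import Mathlib

section
/- Let M : ℝˢ ⇒ ℝᵈ be a multifunction with closed graph and (x̄,ȳ) ∈ gph M. Then M is metrically regular in direction (u,v) ∈ ℝˢ × ℝᵈ at (x̄,ȳ) if and only if 0 ∈ D*M((x̄,ȳ);(u,v))(v*) implies v* = 0. -/
open Filter Topology Metric Set
open scoped RealInnerProductSpace

noncomputable section

abbrev Es (k : ℕ) : Type := EuclideanSpace ℝ (Fin k)

/-- The tangent (contingent) cone to `A` at `x`. -/
def tcone {E : Type*} [NormedAddCommGroup E] [NormedSpace ℝ E] (A : Set E) (x : E) : Set E :=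
  {w | ∃ t : ℕ → ℝ, ∃ w' : ℕ → E,
    (∀ k, 0 < t k) ∧ Tendsto t atTop (𝓝 0) ∧ Tendsto w' atTop (𝓝 w) ∧
    ∀ k, x + t k • w' k ∈ A}

/-- Graph of a multifunction. -/
def gph {E F : Type*} (M : E → Set F) : Set (E × F) := {z | z.2 ∈ M z.1}

/-- The canonical pairing on a product of two real inner product spaces. -/
def pr2 {E F : Type*} [NormedAddCommGroup E] [InnerProductSpace ℝ E]
    [NormedAddCommGroup F] [InnerProductSpace ℝ F] (a b : E × F) : ℝ :=
  ⟪a.1, b.1⟫ + ⟪a.2, b.2⟫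

/-- The regular (Fréchet) normal cone to `A ⊆ E × F` at `z`; it is empty (by convention)
when `z ∉ A`. -/
def rnc2 {E F : Type*} [NormedAddCommGroup E] [InnerProductSpace ℝ E]
    [NormedAddCommGroup F] [InnerProductSpace ℝ F] (A : Set (E × F)) (z : E × F) :
    Set (E × F) :=
  {zs | z ∈ A ∧ ∀ w ∈ tcone A z, pr2 zs w ≤ 0}

/-- The directional limiting normal cone to `A ⊆ E × F` at `z` in direction `w`. -/
def dnc2 {E F : Type*} [NormedAddCommGroup E] [InnerProductSpace ℝ E]
    [NormedAddCommGroup F] [InnerProductSpace ℝ F] (A : Set (E × F)) (z w : E × F) :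
    Set (E × F) :=
  {zs | ∃ t : ℕ → ℝ, ∃ w' : ℕ → E × F, ∃ zs' : ℕ → E × F,
    (∀ k, 0 < t k) ∧ Tendsto t atTop (𝓝 0) ∧ Tendsto w' atTop (𝓝 w) ∧
    Tendsto zs' atTop (𝓝 zs) ∧ ∀ k, zs' k ∈ rnc2 A (z + t k • w' k)}

/-- The multifunction `M : X ⇒ Y` is metrically subregular at `(xb, yb) ∈ gph M`
(with the convention that the distance to the empty set is `+∞`). -/
def MetrSubregAt {X Y : Type*} [MetricSpace X] [MetricSpace Y] (M : X → Set Y) (xb : X)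
    (yb : Y) : Prop :=
  ∃ κ : ℝ, 0 ≤ κ ∧ ∃ ε : ℝ, 0 < ε ∧ ∀ x, dist x xb < ε →
    EMetric.infEdist x {x' | yb ∈ M x'} ≤ ENNReal.ofReal κ * EMetric.infEdist yb (M x)

/-- `M` is metrically regular in direction `(u, v)` at `(xb, yb)`. -/
def DirMetrRegAt {E F : Type*} [NormedAddCommGroup E] [NormedSpace ℝ E]
    [NormedAddCommGroup F] [NormedSpace ℝ F]
    (M : E → Set F) (xb : E) (yb : F) (u : E) (v : F) : Prop :=
  ∃ δ : ℝ, 0 < δ ∧ ∃ κ : ℝ, 0 < κ ∧ ∀ t ∈ Icc (0:ℝ) δ, ∀ (u' : E) (v' : F),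
    dist (u', v') (u, v) ≤ δ →
    EMetric.infEdist (xb + t • u', yb + t • v') (gph M) ≤ ENNReal.ofReal (δ * t) →
    EMetric.infEdist (xb + t • u') {x | yb + t • v' ∈ M x} ≤
      ENNReal.ofReal κ * EMetric.infEdist (yb + t • v') (M (xb + t • u'))

section DirectionalRegularity

variable {E F : Type*} [NormedAddCommGroup E] [InnerProductSpace ℝ E]
    [NormedAddCommGroup F] [InnerProductSpace ℝ F]

lemma infEdist_lt_ofReal_iff {X : Type*} [PseudoMetricSpace X] {x : X} {s : Set X} {r : ℝ} :
    EMetric.infEdist x s < ENNReal.ofReal r ↔ ∃ y ∈ s, dist x y < r := by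
  have h : EMetric.infEdist x s < ENNReal.ofReal r ↔
      ∃ y ∈ s, edist x y < ENNReal.ofReal r := Metric.infEDist_lt_iff
  simp only [h, edist_lt_ofReal]

lemma infEdist_le_ofReal_of_mem {X : Type*} [PseudoMetricSpace X] {x y : X} {s : Set X} {r : ℝ}
    (hy : y ∈ s) (h : dist x y ≤ r) : EMetric.infEdist x s ≤ ENNReal.ofReal r :=
  (Metric.infEDist_le_edist_of_mem hy).trans <| by
    rw [edist_dist]; exact ENNReal.ofReal_le_ofReal h

/-- The negative gradient of a separable quadratic at a minimizer over `A` is a regular normal. -/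
lemma neg_gradient_mem_rnc2 {A : Set (E × F)} {p : E × F} (hp : p ∈ A) (q : E × F) (α β : ℝ)
    (hmin : ∀ z ∈ A, α * ‖p.1 - q.1‖ ^ 2 + β * ‖p.2 - q.2‖ ^ 2 ≤
      α * ‖z.1 - q.1‖ ^ 2 + β * ‖z.2 - q.2‖ ^ 2) :
    (-(α • (p.1 - q.1)), -(β • (p.2 - q.2))) ∈ rnc2 A p := by
  refine ⟨hp, ?_⟩
  rintro w ⟨t, w', ht, ht0, hw', hA⟩
  have h1 : Tendsto (fun k => (w' k).1) atTop (𝓝 w.1) := (continuous_fst.tendsto w).comp hw'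
  have h2 : Tendsto (fun k => (w' k).2) atTop (𝓝 w.2) := (continuous_snd.tendsto w).comp hw'
  have key : ∀ k, 0 ≤ 2 * (α * ⟪p.1 - q.1, (w' k).1⟫ + β * ⟪p.2 - q.2, (w' k).2⟫) +
      t k * (α * ‖(w' k).1‖ ^ 2 + β * ‖(w' k).2‖ ^ 2) := by
    intro k
    have h := hmin _ (hA k)
    have e1 : (p + t k • w' k).1 - q.1 = (p.1 - q.1) + t k • (w' k).1 := by
      simp only [Prod.fst_add, Prod.smul_fst]; abel
    have e2 : (p + t k • w' k).2 - q.2 = (p.2 - q.2) + t k • (w' k).2 := by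
      simp only [Prod.snd_add, Prod.smul_snd]; abel
    rw [e1, e2, norm_add_sq_real, norm_add_sq_real, norm_smul, norm_smul, real_inner_smul_right,
      real_inner_smul_right, Real.norm_eq_abs, mul_pow, mul_pow, sq_abs] at h
    refine nonneg_of_mul_nonneg_right ?_ (ht k)
    linarith
  have lim := (((((tendsto_const_nhds (x := p.1 - q.1)).inner h1).const_mul α).add
    (((tendsto_const_nhds (x := p.2 - q.2)).inner h2).const_mul β)).const_mul 2).add
    (ht0.mul (((h1.norm.pow 2).const_mul α).add ((h2.norm.pow 2).const_mul β)))
  have := ge_of_tendsto' lim key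
  simp only [pr2, inner_neg_left, real_inner_smul_left]
  linarith

/-- If no regular normal `(x*, y*)` near `(a, b)` satisfies `‖x*‖ < c ‖y*‖`, then `(a, b)` can be
moved inside the closed set `A` to a point with second component `y`, at linear cost. -/
lemma exists_mem_of_rnc2_lower_bound [ProperSpace E] [ProperSpace F] {A : Set (E × F)}
    (hA : IsClosed A) {c : ℝ} (hc : 0 < c) {a : E} {b y : F} (hab : (a, b) ∈ A)
    (hN : ∀ p ∈ A, dist p.1 a ≤ 4 / c * dist y b → dist p.2 y ≤ dist y b →
      ∀ n ∈ rnc2 A p, c * ‖n.2‖ ≤ ‖n.1‖) :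
    ∃ x, (x, y) ∈ A ∧ dist x a ≤ 4 / c * dist y b := by
  rcases eq_or_ne y b with rfl | hyb
  · exact ⟨a, hab, by simp⟩
  set r := dist y b with hr
  have hr0 : 0 < r := dist_pos.2 hyb
  let m : ℝ := (c / 4) ^ 2 / r
  have hm : 0 < m := by positivity
  let f : E × F → ℝ := fun z => ‖z.2 - y‖ + m * ‖z.1 - a‖ ^ 2
  have hfab : f (a, b) = r := by simp [f, hr, dist_eq_norm, norm_sub_rev]
  have hbound : ∀ z, f z ≤ r → dist z.1 a ≤ 4 / c * r ∧ dist z.2 y ≤ r := by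
    intro z hz
    have h1 : m * ‖z.1 - a‖ ^ 2 ≤ r := by
      have := norm_nonneg (z.2 - y)
      simp only [f] at hz
      linarith
    have h2 : 0 ≤ m * ‖z.1 - a‖ ^ 2 := by positivity
    rw [dist_eq_norm, dist_eq_norm]
    refine ⟨?_, by simp only [f] at hz; linarith⟩
    refine abs_le_of_sq_le_sq' ?_ (by positivity) |>.2
    have h3 : (4 / c * r) ^ 2 = r / m := by simp only [m]; field_simp
    rw [h3, le_div_iff₀ hm]; linarith
  have hK : IsCompact (A ∩ (closedBall a (4 / c * r) ×ˢ closedBall y r)) :=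
    ((isCompact_closedBall a _).prod (isCompact_closedBall y _)).inter_left hA
  have hKab : (a, b) ∈ A ∩ (closedBall a (4 / c * r) ×ˢ closedBall y r) :=
    ⟨hab, mem_closedBall.2 (hbound _ hfab.le).1, mem_closedBall.2 (hbound _ hfab.le).2⟩
  have hfc : Continuous f := by fun_prop
  obtain ⟨p, ⟨hpA, -⟩, hpmin⟩ := hK.exists_isMinOn ⟨_, hKab⟩ hfc.continuousOn
  have hpr : f p ≤ r := hfab ▸ hpmin hKab
  have hmin : ∀ z ∈ A, f p ≤ f z := by
    intro z hz
    by_cases hzr : f z ≤ r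
    · exact hpmin ⟨hz, mem_closedBall.2 (hbound _ hzr).1, mem_closedBall.2 (hbound _ hzr).2⟩
    · linarith
  obtain ⟨hp1, hp2⟩ := hbound p hpr
  by_cases hpy : p.2 = y
  · exact ⟨p.1, hpy ▸ hpA, hp1⟩
  exfalso
  have hρ : 0 < ‖p.2 - y‖ := norm_pos_iff.2 (sub_ne_zero.2 hpy)
  have hn := neg_gradient_mem_rnc2 hpA (a, y) m (1 / (2 * ‖p.2 - y‖)) <| by
    intro z hz
    have h := hmin z hz
    simp only [f] at h
    have h1 : ‖z.2 - y‖ - ‖p.2 - y‖ ≤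
        1 / (2 * ‖p.2 - y‖) * ‖z.2 - y‖ ^ 2 - 1 / (2 * ‖p.2 - y‖) * ‖p.2 - y‖ ^ 2 := by
      rw [← mul_sub, div_mul_eq_mul_div, one_mul, le_div_iff₀ (by positivity)]
      nlinarith [sq_nonneg (‖z.2 - y‖ - ‖p.2 - y‖)]
    simp only
    linarith
  have h := hN p hpA hp1 hp2 _ hn
  simp only [norm_neg, norm_smul, Real.norm_eq_abs, abs_of_pos hm] at h
  rw [abs_of_pos (by positivity)] at h
  have e1 : c * (1 / (2 * ‖p.2 - y‖) * ‖p.2 - y‖) = c / 2 := by field_simp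
  have e2 : m * ‖p.1 - a‖ ≤ c / 4 := by
    rw [dist_eq_norm] at hp1
    calc m * ‖p.1 - a‖ ≤ m * (4 / c * r) := by gcongr
      _ = c / 4 := by simp only [m]; field_simp
  linarith

lemma smul_mem_rnc2 {A : Set (E × F)} {z n : E × F} (hn : n ∈ rnc2 A z) {c : ℝ} (hc : 0 ≤ c) :
    c • n ∈ rnc2 A z := by
  refine ⟨hn.1, fun w hw => ?_⟩
  have h : pr2 (c • n) w = c * pr2 n w := by
    simp only [pr2, Prod.smul_fst, Prod.smul_snd, real_inner_smul_left]; ring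
  rw [h]
  exact mul_nonpos_of_nonneg_of_nonpos hc (hn.2 w hw)

/-- The pointwise condition on directional limiting normals self-improves to a uniform bound on
regular normals at nearby points in nearby directions. -/
lemma exists_rnc2_lower_bound [ProperSpace F] {A : Set (E × F)} {z w : E × F}
    (h : ∀ ys : F, ((0 : E), ys) ∈ dnc2 A z w → ys = 0) :
    ∃ ρ > 0, ∃ c > 0, ∀ t : ℝ, 0 < t → t ≤ ρ → ∀ w', dist w' w ≤ ρ →
      ∀ n ∈ rnc2 A (z + t • w'), c * ‖n.2‖ ≤ ‖n.1‖ := by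
  by_contra! hcon
  have hpos : ∀ k : ℕ, (0 : ℝ) < 1 / ((k : ℝ) + 1) := fun k => by positivity
  choose t ht htk w' hw' n hn hlt using fun k : ℕ => hcon _ (hpos k) _ (hpos k)
  have hn2 : ∀ k, 0 < ‖(n k).2‖ := by
    intro k
    have := (norm_nonneg _).trans_lt (hlt k)
    exact pos_of_mul_pos_right this (hpos k).le
  let n' : ℕ → E × F := fun k => ‖(n k).2‖⁻¹ • n k
  have hn' : ∀ k, n' k ∈ rnc2 A (z + t k • w' k) := fun k => smul_mem_rnc2 (hn k) (by positivity)
  have hn'2 : ∀ k, (n' k).2 ∈ sphere (0 : F) 1 := by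
    intro k
    simp [n', norm_smul, (hn2 k).ne']
  have hn'1 : ∀ k, ‖(n' k).1‖ ≤ 1 / ((k : ℝ) + 1) := by
    intro k
    simp only [n', Prod.smul_fst, norm_smul, norm_inv, norm_norm]
    rw [inv_mul_le_iff₀ (hn2 k), mul_comm]
    exact (hlt k).le
  have hlim0 := tendsto_one_div_add_atTop_nhds_zero_nat (𝕜 := ℝ)
  obtain ⟨ys, hys, φ, hφ, hlim⟩ := (isCompact_sphere (0 : F) 1).tendsto_subseq hn'2
  have hφt := hφ.tendsto_atTop
  have h0 : ys = 0 := by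
    refine h ys ⟨t ∘ φ, w' ∘ φ, n' ∘ φ, fun k => ht _, ?_, ?_, ?_, fun k => hn' _⟩
    · exact (squeeze_zero (fun k => (ht k).le) htk hlim0).comp hφt
    · exact (tendsto_iff_dist_tendsto_zero.2
        (squeeze_zero (fun k => dist_nonneg) hw' hlim0)).comp hφt
    · exact (((squeeze_zero_norm hn'1 hlim0).comp hφt).prodMk_nhds hlim)
  simp [h0] at hys

lemma DirMetrRegAt.of_forall_dnc2 [ProperSpace E] [ProperSpace F] {M : E → Set F} {xb : E}
    {yb : F} {u : E} {v : F} (hcl : IsClosed (gph M)) (hbar : yb ∈ M xb)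
    (h : ∀ ys : F, ((0 : E), ys) ∈ dnc2 (gph M) (xb, yb) (u, v) → ys = 0) :
    DirMetrRegAt M xb yb u v := by
  obtain ⟨ρ, hρ, c, hc, hN⟩ := exists_rnc2_lower_bound h
  let κ : ℝ := 4 / c
  have hκ : 0 < κ := by positivity
  let δ : ℝ := ρ / (5 + 2 * κ)
  have hδ : 0 < δ := by positivity
  have hδρ : δ * (5 + 2 * κ) = ρ := div_mul_cancel₀ _ (by positivity)
  refine ⟨δ, hδ, κ + 1, by positivity, ?_⟩
  rintro t ⟨ht0, htδ⟩ u' v' hw' hgph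
  rcases ht0.eq_or_lt with rfl | ht
  · have : EMetric.infEdist (xb + (0 : ℝ) • u') {x | yb + (0 : ℝ) • v' ∈ M x} = 0 :=
      Metric.infEDist_zero_of_mem (by simpa using hbar)
    rw [this]
    exact zero_le
  set x := xb + t • u' with hx
  set y := yb + t • v' with hy
  have move : ∀ a b, (a, b) ∈ gph M → dist (a, b) (x, y) ≤ 2 * δ * t →
      ∃ x', y ∈ M x' ∧ dist x' a ≤ κ * dist y b := by
    intro a b hab hd
    refine exists_mem_of_rnc2_lower_bound hcl hc hab ?_
    intro p hp hp1 hp2 n hn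
    rw [Prod.dist_eq, max_le_iff] at hd
    have hyb : dist y b ≤ 2 * δ * t := dist_comm y b ▸ hd.2
    have hpd : dist p (x, y) ≤ 2 * δ * t * (1 + κ) := by
      rw [Prod.dist_eq, max_le_iff]
      have hk : κ * dist y b ≤ κ * (2 * δ * t) := by gcongr
      have hk' : 0 ≤ κ * (2 * δ * t) := by positivity
      constructor
      · have := dist_triangle p.1 a x
        change dist p.1 a ≤ κ * dist y b at hp1
        dsimp only at *
        linarith
      · dsimp only; linarith
    let w : E × F := t⁻¹ • (p - (xb, yb))
    have hpw : (xb, yb) + t • w = p := by simp [w, smul_smul, ht.ne']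
    have hxy : (xb, yb) + t • (u', v') = (x, y) := by simp [hx, hy]
    have hww : dist w (u', v') ≤ 2 * δ * (1 + κ) := by
      rw [← hpw, ← hxy, dist_add_left, dist_smul₀, Real.norm_eq_abs, abs_of_pos ht] at hpd
      refine le_of_mul_le_mul_left ?_ ht
      linarith
    refine hN t ht ?_ w ?_ n (hpw ▸ hn)
    · nlinarith [mul_pos hδ hκ]
    · have := dist_triangle w (u', v') (u, v)
      nlinarith [mul_pos hδ hκ]
  obtain ⟨⟨a, b⟩, hab, hd⟩ : ∃ p ∈ gph M, dist (x, y) p < 2 * δ * t := by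
    refine infEdist_lt_ofReal_iff.1 (hgph.trans_lt ?_)
    rw [ENNReal.ofReal_lt_ofReal_iff (by positivity)]
    nlinarith [mul_pos hδ ht]
  obtain ⟨x₀, hx₀, hx₀d⟩ := move a b hab (dist_comm (x, y) (a, b) ▸ hd.le)
  rw [Prod.dist_eq, max_lt_iff] at hd
  have hfar : dist x x₀ ≤ (κ + 1) * (2 * δ * t) := by
    have h1 := dist_triangle x a x₀
    have h2 : κ * dist y b ≤ κ * (2 * δ * t) := by gcongr; exact hd.2.le
    have h3 := hd.1
    rw [dist_comm a x₀] at h1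
    dsimp only at h3
    linarith
  have hκ1 : ENNReal.ofReal (κ + 1) ≠ 0 := (ENNReal.ofReal_pos.2 (by positivity)).ne'
  rw [mul_comm, ← ENNReal.div_le_iff hκ1 ENNReal.ofReal_ne_top]
  refine Metric.le_infEDist.2 fun b' hb' => ?_
  rw [ENNReal.div_le_iff hκ1 ENNReal.ofReal_ne_top, mul_comm, edist_dist,
    ← ENNReal.ofReal_mul (by positivity)]
  by_cases hclose : dist y b' ≤ 2 * δ * t
  · obtain ⟨x', hx', hx'd⟩ := move x b' hb' <| by
      rw [Prod.dist_eq, max_le_iff]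
      exact ⟨by simp only [dist_self]; positivity, dist_comm y b' ▸ hclose⟩
    refine infEdist_le_ofReal_of_mem hx' ?_
    rw [dist_comm]
    linarith [dist_nonneg (x := y) (y := b')]
  · refine infEdist_le_ofReal_of_mem hx₀ (hfar.trans ?_)
    gcongr
    exact (not_le.1 hclose).le

/-- A linear openness estimate along the ray `y + τ y*` bounds regular normals `(x*, y*)`. -/
lemma norm_snd_le_of_mem_rnc2 [ProperSpace E] {A : Set (E × F)} {p n : E × F} {κ ε : ℝ}
    (hκ : 0 ≤ κ) (hε : 0 < ε) (hn : n ∈ rnc2 A p)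
    (h : ∀ τ : ℝ, 0 < τ → τ ≤ ε → ∃ x, (x, p.2 + τ • n.2) ∈ A ∧ dist x p.1 ≤ κ * (τ * ‖n.2‖)) :
    ‖n.2‖ ≤ κ * ‖n.1‖ := by
  let t : ℕ → ℝ := fun k => ε / ((k : ℝ) + 1)
  have ht : ∀ k, 0 < t k := fun k => by positivity
  have htε : ∀ k, t k ≤ ε := fun k => div_le_self hε.le (by simp)
  have ht0 : Tendsto t atTop (𝓝 0) := by
    simpa [t, div_eq_mul_inv] using (tendsto_one_div_add_atTop_nhds_zero_nat (𝕜 := ℝ)).const_mul ε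
  choose x hxA hxd using fun k => h (t k) (ht k) (htε k)
  let ξ : ℕ → E := fun k => (t k)⁻¹ • (x k - p.1)
  have hξ : ∀ k, ξ k ∈ closedBall (0 : E) (κ * ‖n.2‖) := by
    intro k
    rw [mem_closedBall_zero_iff, norm_smul, norm_inv, Real.norm_eq_abs, abs_of_pos (ht k),
      inv_mul_le_iff₀ (ht k), ← dist_eq_norm]
    linarith [hxd k]
  obtain ⟨ξ₀, hξ₀, φ, hφ, hlim⟩ := (isCompact_closedBall (0 : E) (κ * ‖n.2‖)).tendsto_subseq hξ
  have hmem : (ξ₀, n.2) ∈ tcone A p := by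
    refine ⟨t ∘ φ, fun k => (ξ (φ k), n.2), fun k => ht _, ht0.comp hφ.tendsto_atTop,
      hlim.prodMk_nhds tendsto_const_nhds, fun k => ?_⟩
    have : p + t (φ k) • (ξ (φ k), n.2) = (x (φ k), p.2 + t (φ k) • n.2) := by
      ext1 <;> simp [ξ, smul_smul, (ht _).ne']
    simpa only [Function.comp, this] using hxA (φ k)
  have hle := hn.2 _ hmem
  simp only [pr2, real_inner_self_eq_norm_sq] at hle
  have h1 := neg_le_of_abs_le (abs_real_inner_le_norm n.1 ξ₀)
  have h2 : ‖n.1‖ * ‖ξ₀‖ ≤ ‖n.1‖ * (κ * ‖n.2‖) := by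
    gcongr; exact mem_closedBall_zero_iff.1 hξ₀
  rcases (norm_nonneg n.2).eq_or_lt with h0 | h0
  · rw [← h0]; positivity
  · refine le_of_mul_le_mul_right ?_ h0
    linarith

lemma DirMetrRegAt.eq_zero_of_mem_dnc2 [ProperSpace E] {M : E → Set F} {xb : E} {yb : F}
    {u : E} {v : F} (h : DirMetrRegAt M xb yb u v) {ys : F}
    (hys : ((0 : E), ys) ∈ dnc2 (gph M) (xb, yb) (u, v)) : ys = 0 := by
  obtain ⟨δ, hδ, κ, hκ, hreg⟩ := h
  obtain ⟨t, w, n, ht, ht0, hw, hnlim, hn⟩ := hys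
  have hev : ∀ᶠ k in atTop, ‖(n k).2‖ ≤ (κ + 1) * ‖(n k).1‖ := by
    filter_upwards [ht0.eventually_lt_const hδ, hw.eventually (ball_mem_nhds _ hδ)] with k htk hwk
    set T := t k
    have hT : 0 < T := ht k
    set η := δ - dist (w k) (u, v)
    have hη : 0 < η := sub_pos.2 hwk
    have hηδ : η ≤ δ := sub_le_self _ dist_nonneg
    set N := ‖(n k).2‖ with hN
    have hN0 : 0 ≤ N := norm_nonneg _
    refine norm_snd_le_of_mem_rnc2 (ε := T * η / (N + 1)) (by positivity) (by positivity) (hn k) ?_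
    intro τ hτ hτε
    have hτN : τ * N ≤ T * η := by
      rw [le_div_iff₀ (by positivity)] at hτε
      linarith
    rcases hN0.eq_or_lt with h0 | h0
    · have hn0 : (n k).2 = 0 := norm_eq_zero.1 h0.symm
      exact ⟨_, by rw [hn0, smul_zero, add_zero]; exact (hn k).1, by simp [hn0]⟩
    let v' : F := (w k).2 + (τ / T) • (n k).2
    have hy : yb + T • v' = ((xb, yb) + T • w k).2 + τ • (n k).2 := by
      simp [v', smul_smul, mul_div_cancel₀ _ hT.ne', add_assoc]
    have hx : xb + T • (w k).1 = ((xb, yb) + T • w k).1 := by simp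
    have hdir : dist ((w k).1, v') (u, v) ≤ δ := by
      have h1 : dist ((w k).1, v') (w k) ≤ η := by
        rw [Prod.dist_eq, max_le_iff]
        refine ⟨by simpa using hη.le, ?_⟩
        simp only [v', dist_self_add_left, norm_smul, Real.norm_eq_abs,
          abs_of_pos (div_pos hτ hT), ← hN]
        rw [div_mul_eq_mul_div, div_le_iff₀ hT]
        linarith
      have := dist_triangle ((w k).1, v') (w k) (u, v)
      simp only [η] at h1
      linarith
    have hyd : dist (yb + T • v') ((xb, yb) + T • w k).2 = τ * N := by
      rw [hy, dist_self_add_left, norm_smul, Real.norm_eq_abs, abs_of_pos hτ]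
    have hgph : EMetric.infEdist (xb + T • (w k).1, yb + T • v') (gph M) ≤
        ENNReal.ofReal (δ * T) := by
      refine infEdist_le_ofReal_of_mem (hn k).1 ?_
      rw [Prod.dist_eq, max_le_iff]
      refine ⟨by rw [hx, dist_self]; positivity, ?_⟩
      dsimp only at hyd ⊢
      rw [hyd]
      nlinarith
    have hle := hreg T ⟨hT.le, htk.le⟩ _ v' hdir hgph
    have hM : EMetric.infEdist (yb + T • v') (M (xb + T • (w k).1)) ≤ ENNReal.ofReal (τ * N) :=
      infEdist_le_ofReal_of_mem (y := ((xb, yb) + T • w k).2) (by rw [hx]; exact (hn k).1) hyd.le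
    have hlt : EMetric.infEdist (xb + T • (w k).1) {x | yb + T • v' ∈ M x} <
        ENNReal.ofReal ((κ + 1) * (τ * N)) := by
      refine (hle.trans (mul_le_mul_right hM _)).trans_lt ?_
      rw [← ENNReal.ofReal_mul hκ.le, ENNReal.ofReal_lt_ofReal_iff (by positivity)]
      linarith [mul_pos hτ h0]
    obtain ⟨x, hxM, hxd⟩ := infEdist_lt_ofReal_iff.1 hlt
    rw [dist_comm, hx] at hxd
    exact ⟨x, by rw [← hy]; exact hxM, hxd.le⟩
  have h1 : Tendsto (fun k => (n k).1) atTop (𝓝 (0 : E)) :=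
    (continuous_fst.tendsto ((0 : E), ys)).comp hnlim
  have h2 : Tendsto (fun k => (n k).2) atTop (𝓝 ys) :=
    (continuous_snd.tendsto ((0 : E), ys)).comp hnlim
  simpa using le_of_tendsto_of_tendsto h2.norm (h1.norm.const_mul (κ + 1)) hev

end DirectionalRegularity

/-- Directional extension of the Mordukhovich criterion (Theorem `ThExtMordCrit`):
metric regularity in direction `(u, v)` is characterized by the directional limiting
coderivative. -/
theorem stmt9 {s d : ℕ} (M : Es s → Set (Es d)) (xb : Es s) (yb : Es d)
    (hcl : IsClosed (gph M)) (hbar : yb ∈ M xb) (u : Es s) (v : Es d) :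
    DirMetrRegAt M xb yb u v ↔
      ∀ vs : Es d, ((0 : Es s), -vs) ∈ dnc2 (gph M) (xb, yb) (u, v) → vs = 0 := by
  refine ⟨fun h vs hvs => neg_eq_zero.1 (h.eq_zero_of_mem_dnc2 hvs), fun h => ?_⟩
  refine DirMetrRegAt.of_forall_dnc2 hcl hbar fun ys hys => ?_
  exact neg_eq_zero.1 (h (-ys) (by rwa [neg_neg]))
end
end

section
/- Let (x̄,ȳ) belong to the graph of M(x) = G(x) + Q(x), where G : ℝˢ → ℝᵈ is strictly differentiable at x̄ and Q : ℝˢ ⇒ ℝᵈ is a polyhedral multifunction (its graph is a union of finitely many convex polyhedra). Let u ≠ 0 and assume the limit G''(x̄;u) := lim_{t ↓ 0, u' → u} (G(x̄ + tu') − G(x̄) − t∇G(x̄)u') / (t²/2) exists. If ⟨v*, G''(x̄;u)⟩ < 0 holds for every nonzero v* ∈ ℝᵈ satisfying 0 ∈ ∇G(x̄)ᵀv* + D*Q((x̄, ȳ − G(x̄)); (u, −∇G(x̄)u))(v*), then M is metrically subregular in direction u at (x̄,ȳ). -/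
open Filter Topology Metric Set
open scoped RealInnerProductSpace

noncomputable section

/-- A convex polyhedron: a set defined by finitely many affine inequalities. -/
def IsPolyhedron {E : Type*} [NormedAddCommGroup E] [NormedSpace ℝ E] (C : Set E) : Prop :=
  ∃ (k : ℕ) (f : Fin k → (E →L[ℝ] ℝ)) (c : Fin k → ℝ), C = {z | ∀ i, f i z ≤ c i}

/-- `M` is metrically subregular in direction `u` at `(xb, yb)`. -/
def DirMetrSubregAt {E F : Type*} [NormedAddCommGroup E] [NormedSpace ℝ E]
    [NormedAddCommGroup F] [NormedSpace ℝ F]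
    (M : E → Set F) (xb : E) (yb : F) (u : E) : Prop :=
  ∃ δ : ℝ, 0 < δ ∧ ∃ κ : ℝ, 0 < κ ∧ ∀ t ∈ Icc (0:ℝ) δ, ∀ u' : E, dist u' u ≤ δ →
    EMetric.infEdist (xb + t • u') {x | yb ∈ M x} ≤
      ENNReal.ofReal κ * EMetric.infEdist yb (M (xb + t • u'))

lemma neg_mul_norm_le_inner_of_eventually {F : Type*} [NormedAddCommGroup F]
    [InnerProductSpace ℝ F] {r p : F} {a : ℝ} (hr : r ≠ 0)
    (h : ∀ᶠ τ in 𝓝[>] (0:ℝ), ‖r‖ ≤ ‖r + τ • p‖ + τ * a) :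
    -(a * ‖r‖) ≤ ⟪r, p⟫ := by
  have hpos : 0 < ‖r‖ := norm_pos_iff.2 hr
  have hsmall : ∀ᶠ τ in 𝓝[>] (0:ℝ), τ * a < ‖r‖ := by
    have : Tendsto (fun τ : ℝ => τ * a) (𝓝[>] 0) (𝓝 0) := by
      have : Tendsto (fun τ : ℝ => τ * a) (𝓝 0) (𝓝 (0 * a)) := tendsto_id.mul_const a
      rw [zero_mul] at this
      exact this.mono_left nhdsWithin_le_nhds
    exact this.eventually_lt_const hpos
  have hlim : Tendsto (fun τ : ℝ => 2 * ⟪r, p⟫ + τ * (‖p‖ ^ 2 - a ^ 2)) (𝓝[>] 0)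
      (𝓝 (2 * ⟪r, p⟫)) := by
    have : Tendsto (fun τ : ℝ => 2 * ⟪r, p⟫ + τ * (‖p‖ ^ 2 - a ^ 2)) (𝓝 0)
        (𝓝 (2 * ⟪r, p⟫ + 0 * (‖p‖ ^ 2 - a ^ 2))) :=
      tendsto_const_nhds.add (tendsto_id.mul_const _)
    rw [zero_mul, add_zero] at this
    exact this.mono_left nhdsWithin_le_nhds
  have hle : -(2 * (a * ‖r‖)) ≤ 2 * ⟪r, p⟫ := by
    refine ge_of_tendsto hlim ?_
    filter_upwards [h, hsmall, self_mem_nhdsWithin] with τ h1 h2 (h3 : 0 < τ)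
    have hsq : (‖r‖ - τ * a) ^ 2 ≤ ‖r + τ • p‖ ^ 2 :=
      pow_le_pow_left₀ (by linarith) (by linarith) 2
    rw [norm_add_sq_real, inner_smul_right, norm_smul, Real.norm_of_nonneg h3.le] at hsq
    refine le_of_mul_le_mul_left ?_ h3
    nlinarith
  linarith

/-- The pieces of a finite family of polyhedra containing `z`, with their active constraints. -/
def polySig {E : Type*} [NormedAddCommGroup E] [NormedSpace ℝ E] {N : ℕ} {m : Fin N → ℕ}
    (f : ∀ j, Fin (m j) → (E →L[ℝ] ℝ)) (c : ∀ j, Fin (m j) → ℝ) (z : E) (j : Fin N) :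
    Prop × (Fin (m j) → Prop) :=
  (∀ i, f j i z ≤ c j i, fun i => f j i z = c j i)

lemma isClosed_setOf_forall_clm_le {E : Type*} [NormedAddCommGroup E] [NormedSpace ℝ E] {m : ℕ}
    (f : Fin m → (E →L[ℝ] ℝ)) (c : Fin m → ℝ) : IsClosed {z | ∀ i, f i z ≤ c i} := by
  rw [Set.ofPred_forall]
  exact isClosed_iInter fun i => isClosed_le (f i).continuous continuous_const

lemma eventually_add_smul_mem_of_polySig_eq {E : Type*} [NormedAddCommGroup E] [NormedSpace ℝ E]
    {N : ℕ} {m : Fin N → ℕ} {f : ∀ j, Fin (m j) → (E →L[ℝ] ℝ)} {c : ∀ j, Fin (m j) → ℝ}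
    {z z' w : E} (hsig : polySig f c z = polySig f c z')
    (hw : w ∈ tcone (⋃ j, {z | ∀ i, f j i z ≤ c j i}) z) :
    ∀ᶠ τ in 𝓝[>] (0:ℝ), z' + τ • w ∈ ⋃ j, {z | ∀ i, f j i z ≤ c j i} := by
  obtain ⟨t, w', ht, ht0, hw', hmem⟩ := hw
  choose j hj using fun k => mem_iUnion.1 (hmem k)
  obtain ⟨j₀, hj₀⟩ := Finite.exists_infinite_fiber j
  have hfreq : ∃ᶠ k in atTop, j k = j₀ := by
    rw [Nat.frequently_atTop_iff_infinite]
    exact Set.infinite_coe_iff.1 hj₀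
  obtain ⟨φ, hφ, hjφ⟩ := extraction_of_frequently_atTop hfreq
  have hmem' : ∀ k i, f j₀ i (z + t (φ k) • w' (φ k)) ≤ c j₀ i := by
    intro k i
    have := hj (φ k)
    rw [hjφ k] at this
    exact this i
  have hwφ : Tendsto (fun k => w' (φ k)) atTop (𝓝 w) := hw'.comp hφ.tendsto_atTop
  have hz : ∀ i, f j₀ i z ≤ c j₀ i := by
    have hlim : Tendsto (fun k => z + t (φ k) • w' (φ k)) atTop (𝓝 (z + (0:ℝ) • w)) :=
      tendsto_const_nhds.add ((ht0.comp hφ.tendsto_atTop).smul hwφ)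
    rw [zero_smul, add_zero] at hlim
    exact (isClosed_setOf_forall_clm_le (f j₀) (c j₀)).mem_of_tendsto hlim
      (Eventually.of_forall hmem')
  have hsig₁ : (∀ i, f j₀ i z ≤ c j₀ i) = ∀ i, f j₀ i z' ≤ c j₀ i :=
    congrArg Prod.fst (congrFun hsig j₀)
  have hsig₂ : ∀ i, (f j₀ i z = c j₀ i) = (f j₀ i z' = c j₀ i) := fun i =>
    congrFun (congrArg Prod.snd (congrFun hsig j₀)) i
  have hz' : ∀ i, f j₀ i z' ≤ c j₀ i := hsig₁ ▸ hz
  have key : ∀ i, ∀ᶠ τ in 𝓝[>] (0:ℝ), f j₀ i (z' + τ • w) ≤ c j₀ i := by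
    intro i
    rcases (hz' i).lt_or_eq with hlt | heq
    · have : Tendsto (fun τ : ℝ => f j₀ i (z' + τ • w)) (𝓝 0) (𝓝 (f j₀ i (z' + (0:ℝ) • w))) :=
        Continuous.tendsto (by fun_prop) 0
      rw [zero_smul, add_zero] at this
      exact ((this.mono_left nhdsWithin_le_nhds).eventually_lt_const hlt).mono fun _ h => h.le
    · have hact : f j₀ i z = c j₀ i := (hsig₂ i).symm ▸ heq
      have hfw : f j₀ i w ≤ 0 := by
        refine le_of_tendsto (((f j₀ i).continuous.tendsto w).comp hwφ)
          (Eventually.of_forall fun k => ?_)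
        have h1 := hmem' k i
        rw [map_add, map_smul, hact, smul_eq_mul] at h1
        have h2 : t (φ k) * f j₀ i (w' (φ k)) ≤ 0 := by linarith
        exact nonpos_of_mul_nonpos_right h2 (ht (φ k))
      filter_upwards [self_mem_nhdsWithin] with τ (hτ : 0 < τ)
      rw [map_add, map_smul, heq, smul_eq_mul]
      linarith [mul_nonpos_of_nonneg_of_nonpos hτ.le hfw]
  filter_upwards [eventually_all.2 key] with τ hτ
  exact mem_iUnion.2 ⟨j₀, hτ⟩

lemma eventually_sub_mem_tcone {E : Type*} [NormedAddCommGroup E] [NormedSpace ℝ E]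
    {N : ℕ} {m : Fin N → ℕ} (f : ∀ j, Fin (m j) → (E →L[ℝ] ℝ)) (c : ∀ j, Fin (m j) → ℝ)
    (z₀ : E) :
    ∀ᶠ z in 𝓝 z₀, z ∈ (⋃ j, {z | ∀ i, f j i z ≤ c j i}) →
      z₀ - z ∈ tcone (⋃ j, {z | ∀ i, f j i z ≤ c j i}) z := by
  have hnear : ∀ j, ∀ᶠ z in 𝓝 z₀, (∀ i, f j i z ≤ c j i) → ∀ i, f j i z₀ ≤ c j i := by
    intro j
    by_cases h : ∀ i, f j i z₀ ≤ c j i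
    · exact Eventually.of_forall fun _ _ => h
    · filter_upwards [(isClosed_setOf_forall_clm_le (f j) (c j)).isOpen_compl.mem_nhds h]
        with z hz hz'
      exact absurd hz' hz
  filter_upwards [eventually_all.2 hnear] with z hz hzmem
  obtain ⟨j, hj⟩ := mem_iUnion.1 hzmem
  refine ⟨fun k => 1 / ((k:ℝ) + 1), fun _ => z₀ - z, fun k => by positivity,
    tendsto_one_div_add_atTop_nhds_zero_nat, tendsto_const_nhds, fun k =>
      mem_iUnion.2 ⟨j, fun i => ?_⟩⟩
  have h1 := hj i
  have h2 := hz j hj i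
  have h3 : 0 ≤ 1 / ((k:ℝ) + 1) := by positivity
  have h4 : 1 / ((k:ℝ) + 1) ≤ 1 := by
    rw [div_le_one (by positivity)]
    linarith [(Nat.cast_nonneg k : (0:ℝ) ≤ k)]
  rw [map_add, map_smul, map_sub, smul_eq_mul]
  nlinarith

lemma exists_almost_minimizer_of_not_dirMetrSubregAt {E F : Type*} [NormedAddCommGroup E]
    [NormedSpace ℝ E] [ProperSpace E] [NormedAddCommGroup F] [NormedSpace ℝ F] [ProperSpace F]
    {G : E → F} {Q : E → Set F} {xb : E} {yb : F} {u : E}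
    (hG : ∀ᶠ x in 𝓝 xb, ContinuousAt G x) (hQ : IsClosed (gph Q)) (hbar : yb - G xb ∈ Q xb)
    (hnot : ¬ DirMetrSubregAt (fun x => (fun y => G x + y) '' Q x) xb yb u)
    {ε : ℝ} (hε : 0 < ε) (hε1 : ε ≤ 1) :
    ∃ t : ℝ, 0 < t ∧ t ≤ ε ∧ ∃ z ∈ gph Q, G z.1 + z.2 - yb ≠ 0 ∧
      ‖G z.1 + z.2 - yb‖ ≤ ε * t ∧ ‖z.1 - (xb + t • u)‖ ≤ ε * t ∧
      ∀ᶠ z' in 𝓝 z, z' ∈ gph Q →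
        ‖G z.1 + z.2 - yb‖ ≤ ‖G z'.1 + z'.2 - yb‖ + ε * ‖z'.1 - z.1‖ := by
  set S : Set E := {x | yb ∈ (fun y => G x + y) '' Q x} with hS
  have hS' : ∀ x y, y ∈ Q x → G x + y - yb = 0 → x ∈ S := fun x y hy h =>
    ⟨y, hy, sub_eq_zero.1 h⟩
  have hxbS : xb ∈ S := hS' xb _ hbar (by abel)
  obtain ⟨ρ, hρ, hGρ⟩ := Metric.eventually_nhds_iff_ball.1 hG
  have hGxb : ContinuousAt G xb := hGρ xb (mem_ball_self hρ)
  set zb : E × F := (xb, yb - G xb) with hzb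
  set K : Set (E × F) := closedBall zb (ρ / 2) ∩ gph Q with hK
  have hKc : IsCompact K := (isCompact_closedBall zb (ρ / 2)).inter_right hQ
  obtain ⟨ρ', hρ', hnear⟩ : ∃ ρ' > 0, ∀ z : E × F, ‖z.1 - xb‖ < ρ' →
      ‖G z.1 + z.2 - yb‖ < ρ' → z ∈ ball zb (ρ / 2) := by
    obtain ⟨η, hη, hGη⟩ := Metric.continuousAt_iff.1 hGxb (ρ / 4) (by positivity)
    refine ⟨min η (ρ / 4), by positivity, fun z h1 h2 => ?_⟩
    have h3 := hGη (x := z.1) (by rw [dist_eq_norm]; exact h1.trans_le (min_le_left _ _))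
    rw [dist_eq_norm] at h3
    have h1' := h1.trans_le (min_le_right _ _)
    have h2' := h2.trans_le (min_le_right _ _)
    rw [mem_ball, dist_eq_norm, Prod.norm_def, max_lt_iff]
    refine ⟨?_, ?_⟩
    · change ‖z.1 - xb‖ < _
      linarith
    · change ‖z.2 - (yb - G xb)‖ < _
      have : z.2 - (yb - G xb) = (G z.1 + z.2 - yb) - (G z.1 - G xb) := by abel
      rw [this]
      linarith [norm_sub_le (G z.1 + z.2 - yb) (G z.1 - G xb)]
  have hu0 : 0 ≤ ‖u‖ := norm_nonneg u
  set δ : ℝ := min (ε / 2) (ρ' / (2 * (‖u‖ + 2))) with hδ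
  have hδ0 : 0 < δ := by positivity
  have hδε : δ ≤ ε / 2 := min_le_left _ _
  have hδρ : δ * (‖u‖ + 2) ≤ ρ' / 2 := by
    calc δ * (‖u‖ + 2) ≤ ρ' / (2 * (‖u‖ + 2)) * (‖u‖ + 2) := by gcongr; exact min_le_right _ _
      _ = ρ' / 2 := by field_simp
  set κ : ℝ := 2 * (‖u‖ + 1) / ε ^ 2 with hκ
  have hκ0 : 0 < κ := by positivity
  have hκε : κ * ε ^ 2 = 2 * (‖u‖ + 1) := by rw [hκ]; field_simp
  obtain ⟨t, ht, u', hu', hlt⟩ : ∃ t ∈ Icc (0:ℝ) δ, ∃ u' : E, dist u' u ≤ δ ∧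
      ENNReal.ofReal κ * Metric.infEDist yb ((fun y => G (xb + t • u') + y) '' Q (xb + t • u'))
        < Metric.infEDist (xb + t • u') S := by
    by_contra! hcon
    exact hnot ⟨δ, hδ0, κ, hκ0, hcon⟩
  rw [dist_eq_norm] at hu'
  set x : E := xb + t • u' with hx
  have hinfx : ∀ x' ∈ S, Metric.infEDist x S ≤ ENNReal.ofReal ‖x - x'‖ := fun x' hx' => by
    rw [← dist_eq_norm, ← edist_dist]
    exact Metric.infEDist_le_edist_of_mem hx'
  have ht0 : 0 < t := by
    refine ht.1.lt_of_ne fun h => ?_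
    have := hinfx xb hxbS
    rw [hx, ← h, zero_smul, add_zero, sub_self, norm_zero, ENNReal.ofReal_zero] at this
    rw [hx, ← h, zero_smul, add_zero] at hlt
    exact not_lt_zero (hlt.trans_le this)
  obtain ⟨y, hy, hylt⟩ : ∃ y ∈ Q x, ∀ x' ∈ S, κ * ‖G x + y - yb‖ < ‖x - x'‖ := by
    have hκ' : ENNReal.ofReal κ ≠ 0 := by simpa using hκ0
    rw [mul_comm, ← ENNReal.lt_div_iff_mul_lt (Or.inl hκ') (Or.inl ENNReal.ofReal_ne_top)] at hlt
    obtain ⟨_, ⟨y, hy, rfl⟩, hlt'⟩ := Metric.infEDist_lt_iff.1 hlt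
    refine ⟨y, hy, fun x' hx' => ?_⟩
    rw [ENNReal.lt_div_iff_mul_lt (Or.inl hκ') (Or.inl ENNReal.ofReal_ne_top), edist_dist,
      ← ENNReal.ofReal_mul dist_nonneg] at hlt'
    have := (ENNReal.ofReal_lt_ofReal_iff').1 (hlt'.trans_le (hinfx x' hx'))
    rw [mul_comm, dist_comm, dist_eq_norm] at this
    exact this.1
  set e : ℝ := ‖G x + y - yb‖ with he
  have he0 : 0 ≤ e := norm_nonneg _
  have hu'n : ‖u'‖ ≤ ‖u‖ + δ := by
    have : u' = u + (u' - u) := by abel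
    rw [this]
    linarith [norm_add_le u (u' - u)]
  have hxxb : ‖x - xb‖ ≤ t * (‖u‖ + 1) := by
    rw [hx, add_sub_cancel_left, norm_smul, Real.norm_of_nonneg ht0.le]
    gcongr
    linarith
  have heκ : κ * e ≤ t * (‖u‖ + 1) := (hylt xb hxbS).le.trans hxxb
  have he1 : 2 * e ≤ ε ^ 2 * t := by
    have h1 : 2 * (‖u‖ + 1) * e ≤ (ε ^ 2 * t) * (‖u‖ + 1) := by
      rw [← hκε]
      nlinarith [sq_nonneg ε]
    have h2 : 0 < ‖u‖ + 1 := by linarith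
    nlinarith
  have hεt : ε ^ 2 * t ≤ ε * t := by
    gcongr
    nlinarith
  have htε : ε * t ≤ t := by nlinarith
  have htρ : t * (‖u‖ + 2) ≤ ρ' / 2 :=
    (mul_le_mul_of_nonneg_right ht.2 (by linarith)).trans hδρ
  have htu : 0 ≤ t * ‖u‖ := by positivity
  have hxyK : (x, y) ∈ K :=
    ⟨ball_subset_closedBall (hnear (x, y) (by change ‖x - xb‖ < _; linarith)
      (by change e < _; linarith)), hy⟩
  have hcont : ContinuousOn (fun z : E × F => ‖G z.1 + z.2 - yb‖ + ε * ‖z.1 - x‖) K := by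
    have hGK : ContinuousOn (fun z : E × F => G z.1) K := by
      intro z hz
      have hz1 : z.1 ∈ ball xb ρ := by
        have h1 : dist z zb ≤ ρ / 2 := hz.1
        have h2 : dist z.1 xb ≤ dist z zb := le_max_left _ _
        rw [mem_ball]
        linarith
      exact ((hGρ _ hz1).comp continuousAt_fst).continuousWithinAt
    exact ((hGK.add continuousOn_snd).sub continuousOn_const).norm.add
      (continuousOn_const.mul (continuousOn_fst.sub continuousOn_const).norm)
  obtain ⟨z, hzK, hzmin⟩ := hKc.exists_isMinOn ⟨_, hxyK⟩ hcont
  have hmin : ∀ z' ∈ K, ‖G z.1 + z.2 - yb‖ + ε * ‖z.1 - x‖ ≤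
      ‖G z'.1 + z'.2 - yb‖ + ε * ‖z'.1 - x‖ := fun z' hz' => hzmin hz'
  have hze : ‖G z.1 + z.2 - yb‖ + ε * ‖z.1 - x‖ ≤ e := by
    have := hmin _ hxyK
    simpa using this
  have hzx0 : 0 ≤ ‖z.1 - x‖ := norm_nonneg _
  have hr0 : 0 ≤ ‖G z.1 + z.2 - yb‖ := norm_nonneg _
  have hzx : 2 * ‖z.1 - x‖ ≤ ε * t := by
    have : ε * (2 * ‖z.1 - x‖) ≤ ε * (ε * t) := by nlinarith
    exact le_of_mul_le_mul_left this hε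
  have hre : ‖G z.1 + z.2 - yb‖ ≤ e := by linarith [mul_nonneg hε.le hzx0]
  refine ⟨t, ht0, ht.2.trans (by linarith), z, hzK.2, ?_, by linarith, ?_, ?_⟩
  · intro h0
    have h1 := hylt z.1 (hS' z.1 z.2 hzK.2 h0)
    rw [norm_sub_rev] at h1
    have h2 : ε * ‖z.1 - x‖ ≤ e := by linarith
    have h3 : 1 ≤ κ * ε := by
      have : κ * ε * ε ≤ κ * ε * 1 := by gcongr
      linarith
    have h4 : ε * (κ * e) < ε * ‖z.1 - x‖ := mul_lt_mul_of_pos_left h1 hε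
    have h5 : 1 * e ≤ κ * ε * e := mul_le_mul_of_nonneg_right h3 he0
    linarith
  · have h1 : z.1 - (xb + t • u) = (z.1 - x) + t • (u' - u) := by
      rw [hx, smul_sub]; abel
    have h2 : ‖t • (u' - u)‖ ≤ t * (ε / 2) := by
      rw [norm_smul, Real.norm_of_nonneg ht0.le]
      gcongr
      linarith
    rw [h1]
    linarith [norm_add_le (z.1 - x) (t • (u' - u))]
  · have hzball : z ∈ ball zb (ρ / 2) := by
      refine hnear z ?_ (by linarith)
      have : z.1 - xb = (z.1 - x) + (x - xb) := by abel
      rw [this]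
      linarith [norm_add_le (z.1 - x) (x - xb)]
    filter_upwards [isOpen_ball.mem_nhds hzball] with z' hz' hz'Q
    have h1 := hmin z' ⟨ball_subset_closedBall hz', hz'Q⟩
    have h2 : ‖z'.1 - x‖ ≤ ‖z'.1 - z.1‖ + ‖z.1 - x‖ := by
      have : z'.1 - x = (z'.1 - z.1) + (z.1 - x) := by abel
      rw [this]
      exact norm_add_le _ _
    have h3 := mul_le_mul_of_nonneg_left h2 hε.le
    linarith

lemma HasStrictFDerivAt.eventually_eventually_norm_sub_le {E F : Type*} [NormedAddCommGroup E]
    [NormedSpace ℝ E] [NormedAddCommGroup F] [NormedSpace ℝ F] {G : E → F} {A : E →L[ℝ] F} {xb : E}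
    (hG : HasStrictFDerivAt G A xb) {c : ℝ} (hc : 0 < c) :
    ∀ᶠ x in 𝓝 xb, ∀ᶠ p in 𝓝 (x, x), ‖G p.1 - G p.2 - A (p.1 - p.2)‖ ≤ c * ‖p.1 - p.2‖ := by
  have hdiag : Tendsto (fun x : E => (x, x)) (𝓝 xb) (𝓝 (xb, xb)) :=
    Continuous.tendsto (by fun_prop) xb
  exact hdiag.eventually (hG.isLittleO.def hc).eventually_nhds

lemma HasStrictFDerivAt.eventually_continuousAt {E F : Type*} [NormedAddCommGroup E]
    [NormedSpace ℝ E] [NormedAddCommGroup F] [NormedSpace ℝ F] {G : E → F} {A : E →L[ℝ] F} {xb : E}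
    (hG : HasStrictFDerivAt G A xb) : ∀ᶠ x in 𝓝 xb, ContinuousAt G x := by
  obtain ⟨L, S, hS, hL⟩ := hG.exists_lipschitzOnWith
  filter_upwards [eventually_mem_nhds_iff.2 hS] with x hx
  exact hL.continuousOn.continuousAt hx

lemma neg_mul_norm_le_inner_of_local_min {E F : Type*} [NormedAddCommGroup E] [NormedSpace ℝ E]
    [NormedAddCommGroup F] [InnerProductSpace ℝ F] {G : E → F} {A : E →L[ℝ] F} {yb : F}
    {Γ : Set (E × F)} {z w : E × F} {c ε : ℝ} (hr : G z.1 + z.2 - yb ≠ 0)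
    (hG : ∀ᶠ p in 𝓝 (z.1, z.1), ‖G p.1 - G p.2 - A (p.1 - p.2)‖ ≤ c * ‖p.1 - p.2‖)
    (hmin : ∀ᶠ z' in 𝓝 z, z' ∈ Γ →
      ‖G z.1 + z.2 - yb‖ ≤ ‖G z'.1 + z'.2 - yb‖ + ε * ‖z'.1 - z.1‖)
    (hw : ∀ᶠ τ in 𝓝[>] (0:ℝ), z + τ • w ∈ Γ) :
    -((c + ε) * ‖w.1‖ * ‖G z.1 + z.2 - yb‖) ≤ ⟪G z.1 + z.2 - yb, A w.1 + w.2⟫ := by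
  refine neg_mul_norm_le_inner_of_eventually hr ?_
  have hray : Tendsto (fun τ : ℝ => z + τ • w) (𝓝[>] 0) (𝓝 z) := by
    have : Tendsto (fun τ : ℝ => z + τ • w) (𝓝 0) (𝓝 (z + (0:ℝ) • w)) :=
      Continuous.tendsto (by fun_prop) 0
    rw [zero_smul, add_zero] at this
    exact this.mono_left nhdsWithin_le_nhds
  have hpair : Tendsto (fun τ : ℝ => ((z + τ • w).1, z.1)) (𝓝[>] 0) (𝓝 (z.1, z.1)) :=
    ((continuous_fst.tendsto z).comp hray).prodMk_nhds tendsto_const_nhds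
  filter_upwards [hray.eventually hmin, hpair.eventually hG, hw, self_mem_nhdsWithin]
    with τ h1 h2 h3 (h4 : 0 < τ)
  have h5 := h1 h3
  have h6 : (z + τ • w).1 - z.1 = τ • w.1 := by simp
  rw [h6, norm_smul, Real.norm_of_nonneg h4.le] at h2 h5
  have h7 : G (z + τ • w).1 + (z + τ • w).2 - yb =
      (G z.1 + z.2 - yb + τ • (A w.1 + w.2)) + (G (z + τ • w).1 - G z.1 - A (τ • w.1)) := by
    simp only [Prod.snd_add, Prod.smul_snd, map_smul, smul_add]
    abel
  rw [h7] at h5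
  have h8 := norm_add_le (G z.1 + z.2 - yb + τ • (A w.1 + w.2))
    (G (z + τ • w).1 - G z.1 - A (τ • w.1))
  linarith

lemma tendsto_second_order_expansion {E F : Type*} [NormedAddCommGroup E]
    [NormedSpace ℝ E] [NormedAddCommGroup F] [NormedSpace ℝ F] {G : E → F} {A : E →L[ℝ] F}
    {xb u : E} {w : F}
    (hlim : Tendsto (fun q : ℝ × E => (2 / q.1 ^ 2) • (G (xb + q.1 • q.2) - G xb - q.1 • A q.2))
      ((𝓝[>] (0:ℝ)) ×ˢ 𝓝 u) (𝓝 w))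
    {t : ℕ → ℝ} {x : ℕ → E} (ht : ∀ n, 0 < t n) (ht0 : Tendsto t atTop (𝓝 0))
    (hx : Tendsto (fun n => (t n)⁻¹ • (x n - xb)) atTop (𝓝 u)) :
    Tendsto (fun n => (2 / t n ^ 2) • (G (x n) - G xb - A (x n - xb))) atTop (𝓝 w) := by
  have htt : Tendsto t atTop (𝓝[>] 0) :=
    tendsto_nhdsWithin_iff.2 ⟨ht0, Eventually.of_forall ht⟩
  refine (hlim.comp (htt.prodMk hx)).congr fun n => ?_
  have h1 : t n • (t n)⁻¹ • (x n - xb) = x n - xb := smul_inv_smul₀ (ht n).ne' _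
  simp only [Function.comp_apply]
  rw [← map_smul, h1, add_sub_cancel]

/-- Second-order sufficient condition for metric subregularity in direction `u` of
`M = G + Q` with `Q` polyhedral (Theorem `ThSecOrdDirMetrSub`). -/
theorem stmt10 {s d : ℕ} (G : Es s → Es d) (Q : Es s → Set (Es d)) (xb : Es s) (yb : Es d)
    (A : Es s →L[ℝ] Es d) (hG : HasStrictFDerivAt G A xb)
    (hQ : ∃ (N : ℕ) (C : Fin N → Set (Es s × Es d)), (∀ j, IsPolyhedron (C j)) ∧
      gph Q = ⋃ j, C j)
    (hbar : yb - G xb ∈ Q xb)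
    (u : Es s) (hu : u ≠ 0) (w : Es d)
    (hlim : Tendsto (fun q : ℝ × Es s =>
        (2 / q.1 ^ 2) • (G (xb + q.1 • q.2) - G xb - q.1 • A q.2))
      ((𝓝[>] (0:ℝ)) ×ˢ 𝓝 u) (𝓝 w))
    (hcond : ∀ vs : Es d, vs ≠ 0 →
      (-(ContinuousLinearMap.adjoint A vs), -vs) ∈
        dnc2 (gph Q) (xb, yb - G xb) (u, -(A u)) →
      ⟪vs, w⟫ < 0) :
    DirMetrSubregAt (fun x => (fun y => G x + y) '' Q x) xb yb u := by
  by_contra hnot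
  obtain ⟨N, C, hC, hgph⟩ := hQ
  choose m f c hfc using hC
  obtain rfl : C = fun j => {z | ∀ i, f j i z ≤ c j i} := funext hfc
  have hclosed : IsClosed (gph Q) := by
    rw [hgph]
    exact isClosed_iUnion_of_finite fun j => isClosed_setOf_forall_clm_le (f j) (c j)
  have hseq := fun n : ℕ => exists_almost_minimizer_of_not_dirMetrSubregAt
    hG.eventually_continuousAt hclosed hbar hnot (ε := 1 / ((n:ℝ) + 1)) (by positivity)
    (by
      rw [div_le_one (by positivity)]
      linarith [(Nat.cast_nonneg n : (0:ℝ) ≤ n)])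
  choose t ht htε z hz hr hrε hxε hmin using hseq
  set zb : Es s × Es d := (xb, yb - G xb) with hzb
  set r : ℕ → Es d := fun n => G (z n).1 + (z n).2 - yb with hrdef
  have hε0 : Tendsto (fun n : ℕ => 1 / ((n:ℝ) + 1)) atTop (𝓝 0) :=
    tendsto_one_div_add_atTop_nhds_zero_nat
  have ht0 : Tendsto t atTop (𝓝 0) := squeeze_zero (fun n => (ht n).le) htε hε0
  have hscale : ∀ {k : ℕ} (n : ℕ) (a : Es k), ‖a‖ ≤ 1 / ((n:ℝ) + 1) * t n →
      ‖(t n)⁻¹ • a‖ ≤ 1 / ((n:ℝ) + 1) := by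
    intro k n a ha
    rw [norm_smul, Real.norm_of_nonneg (inv_nonneg.2 (ht n).le), inv_mul_le_iff₀ (ht n), mul_comm]
    exact ha
  have hxu : Tendsto (fun n => (t n)⁻¹ • ((z n).1 - xb)) atTop (𝓝 u) := by
    rw [tendsto_iff_norm_sub_tendsto_zero]
    refine squeeze_zero (fun n => norm_nonneg _) (fun n => ?_) hε0
    have h1 : (t n)⁻¹ • ((z n).1 - xb) - u = (t n)⁻¹ • ((z n).1 - (xb + t n • u)) := by
      rw [← sub_sub, smul_sub _ _ (t n • u), inv_smul_smul₀ (ht n).ne']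
    rw [h1]
    exact hscale n _ (hxε n)
  have hexp := tendsto_second_order_expansion hlim ht ht0 hxu
  have hr0 : Tendsto (fun n => (t n)⁻¹ • r n) atTop (𝓝 0) := by
    rw [tendsto_zero_iff_norm_tendsto_zero]
    exact squeeze_zero (fun n => norm_nonneg _) (fun n => hscale n _ (hrε n)) hε0
  have hyu : Tendsto (fun n => (t n)⁻¹ • ((z n).2 - (yb - G xb))) atTop (𝓝 (-(A u))) := by
    have h1 : Tendsto (fun n => (t n)⁻¹ • r n - A ((t n)⁻¹ • ((z n).1 - xb))
        - (t n / 2) • (2 / t n ^ 2) • (G (z n).1 - G xb - A ((z n).1 - xb))) atTop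
        (𝓝 (0 - A u - ((0:ℝ) / 2) • w)) :=
      (hr0.sub ((A.continuous.tendsto u).comp hxu)).sub ((ht0.div_const 2).smul hexp)
    rw [zero_div, zero_smul, sub_zero, zero_sub] at h1
    refine h1.congr fun n => ?_
    have h2 : t n / 2 * (2 / t n ^ 2) = (t n)⁻¹ := by
      have := (ht n).ne'
      field_simp
    rw [smul_smul, h2, map_smul, ← smul_sub, ← smul_sub]
    congr 1
    simp only [hrdef]
    abel
  have hdir : Tendsto (fun n => (t n)⁻¹ • (z n - zb)) atTop (𝓝 (u, -(A u))) :=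
    hxu.prodMk_nhds hyu
  have hzlim : Tendsto z atTop (𝓝 zb) := by
    have h1 : Tendsto (fun n => zb + t n • (t n)⁻¹ • (z n - zb)) atTop
        (𝓝 (zb + (0:ℝ) • (u, -(A u)))) := tendsto_const_nhds.add (ht0.smul hdir)
    rw [zero_smul, add_zero] at h1
    refine h1.congr fun n => ?_
    rw [smul_inv_smul₀ (ht n).ne', add_sub_cancel]
  have hxlim : Tendsto (fun n => (z n).1) atTop (𝓝 xb) := (continuous_fst.tendsto zb).comp hzlim
  have hnorm : ∀ n, ‖‖r n‖⁻¹ • r n‖ = 1 := fun n => by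
    rw [norm_smul, norm_inv, norm_norm, inv_mul_cancel₀ (norm_ne_zero_iff.2 (hr n))]
  obtain ⟨v, hv, φ, hφ, hvφ⟩ := (isCompact_sphere (0 : Es d) 1).tendsto_subseq
    (x := fun n => ‖r n‖⁻¹ • r n) fun n => by simpa using hnorm n
  have hv1 : ‖v‖ = 1 := by simpa using hv
  obtain ⟨σ, hσ⟩ := Finite.exists_infinite_fiber fun n => polySig f c (z (φ n))
  have hfreq : ∃ᶠ n in atTop, polySig f c (z (φ n)) = σ := by
    rw [Nat.frequently_atTop_iff_infinite]
    exact Set.infinite_coe_iff.1 hσ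
  obtain ⟨ψ, hψ, hσψ⟩ := extraction_of_frequently_atTop hfreq
  set θ : ℕ → ℕ := fun n => φ (ψ n) with hθ
  have hθlim : Tendsto θ atTop atTop := hφ.tendsto_atTop.comp hψ.tendsto_atTop
  have hvθ : Tendsto (fun n => ‖r (θ n)‖⁻¹ • r (θ n)) atTop (𝓝 v) := hvφ.comp hψ.tendsto_atTop
  have hpolar : ∀ k, ∀ a ∈ tcone (gph Q) (z (θ k)), 0 ≤ ⟪v, A a.1 + a.2⟫ := by
    intro k a ha
    have hfeas : ∀ n, ∀ᶠ τ in 𝓝[>] (0:ℝ), z (θ n) + τ • a ∈ gph Q := fun n => by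
      rw [hgph] at ha ⊢
      exact eventually_add_smul_mem_of_polySig_eq ((hσψ k).trans (hσψ n).symm) ha
    have hlower : ∀ b > 0, -(b * ‖a.1‖) ≤ ⟪v, A a.1 + a.2⟫ := by
      intro b hb
      have h1 : Tendsto (fun n => -((b + 1 / ((θ n : ℝ) + 1)) * ‖a.1‖)) atTop
          (𝓝 (-((b + 0) * ‖a.1‖))) :=
        ((tendsto_const_nhds.add (hε0.comp hθlim)).mul_const _).neg
      rw [add_zero] at h1
      refine le_of_tendsto_of_tendsto h1 (hvθ.inner tendsto_const_nhds) ?_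
      filter_upwards [(hxlim.comp hθlim).eventually (hG.eventually_eventually_norm_sub_le hb)]
        with n hn
      have h2 := neg_mul_norm_le_inner_of_local_min (hr (θ n)) hn (hmin (θ n)) (hfeas n)
      have h3 : 0 < ‖r (θ n)‖ := norm_pos_iff.2 (hr (θ n))
      rw [real_inner_smul_left, le_inv_mul_iff₀ h3]
      linarith
    have h1 : Tendsto (fun b : ℝ => -(b * ‖a.1‖)) (𝓝[>] 0) (𝓝 (-(0 * ‖a.1‖))) :=
      Tendsto.mono_left (Continuous.tendsto (by fun_prop) 0) nhdsWithin_le_nhds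
    rw [zero_mul, neg_zero] at h1
    exact le_of_tendsto h1 (by filter_upwards [self_mem_nhdsWithin] with b hb using hlower b hb)
  have hneg : ⟪v, w⟫ < 0 := by
    refine hcond v (norm_ne_zero_iff.1 (by rw [hv1]; exact one_ne_zero))
      ⟨fun n => t (θ n), fun n => (t (θ n))⁻¹ • (z (θ n) - zb), fun _ => _, fun n => ht _,
        ht0.comp hθlim, hdir.comp hθlim, tendsto_const_nhds, fun n => ?_⟩
    rw [smul_inv_smul₀ (ht _).ne', add_sub_cancel]
    refine ⟨hz _, fun a ha => ?_⟩
    have h1 := hpolar n a ha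
    rw [inner_add_right] at h1
    simp only [pr2, inner_neg_left, ContinuousLinearMap.adjoint_inner_left]
    linarith
  have hpos : ∀ᶠ n in atTop, 0 < ⟪v, ‖r (θ n)‖⁻¹ • r (θ n)⟫ := by
    have h1 : Tendsto (fun n => ⟪v, ‖r (θ n)‖⁻¹ • r (θ n)⟫) atTop (𝓝 ⟪v, v⟫) :=
      tendsto_const_nhds.inner hvθ
    refine h1.eventually_const_lt ?_
    rw [real_inner_self_eq_norm_sq, hv1]
    norm_num
  have hnonneg : 0 ≤ ⟪v, w⟫ := by
    refine ge_of_tendsto (tendsto_const_nhds.inner (hexp.comp hθlim)) ?_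
    filter_upwards [hpos, (hzlim.comp hθlim).eventually (eventually_sub_mem_tcone f c zb)]
      with n h1 h2
    have h3 : 0 < ⟪v, r (θ n)⟫ := by
      rw [real_inner_smul_right] at h1
      exact pos_of_mul_pos_right h1 (inv_nonneg.2 (norm_nonneg _))
    rw [← hgph] at h2
    have h4 : 0 ≤ ⟪v, A (zb - z (θ n)).1 + (zb - z (θ n)).2⟫ := hpolar n _ (h2 (hz _))
    have h5 : r (θ n) = (G (z (θ n)).1 - G xb - A ((z (θ n)).1 - xb))
        - (A (zb - z (θ n)).1 + (zb - z (θ n)).2) := by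
      simp only [hrdef, hzb, Prod.fst_sub, Prod.snd_sub, map_sub]
      abel
    rw [h5, inner_sub_right] at h3
    simp only [Function.comp_apply, real_inner_smul_right]
    have h6 := ht (θ n)
    exact mul_nonneg (by positivity) (by linarith)
  exact hneg.not_ge hnonneg
end
end

section
/- Let M : ℝˢ ⇒ ℝᵈ be given by M(x) := G(x) − D, where G : ℝˢ → ℝᵈ is continuously differentiable, D ⊆ ℝᵈ is closed, and G(x̄) ∈ D. Then M is metrically subregular at (x̄, 0) if either of the following holds: (1) (FOSCMS) for every u ≠ 0 with ∇G(x̄)u ∈ T_D(G(x̄)), the conditions ∇G(x̄)ᵀv* = 0 and v* ∈ N_D(G(x̄); ∇G(x̄)u) imply v* = 0; or (2) (SOSCMS) G is twice Fréchet differentiable at x̄, D is a union of finitely many convex polyhedra, and for every u ≠ 0 with ∇G(x̄)u ∈ T_D(G(x̄)), the conditions ∇G(x̄)ᵀv* = 0, v* ∈ N_D(G(x̄); ∇G(x̄)u) and uᵀ∇²(v*ᵀG)(x̄)u ≥ 0 imply v* = 0. -/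
open Filter Topology Metric Set
open scoped RealInnerProductSpace

noncomputable section

/-- The regular (Fréchet) normal cone to `A` at `x`; it is empty (by convention)
when `x ∉ A`. -/
def rnc1 {E : Type*} [NormedAddCommGroup E] [InnerProductSpace ℝ E] (A : Set E) (x : E) :
    Set E :=
  {xs | x ∈ A ∧ ∀ w ∈ tcone A x, ⟪xs, w⟫ ≤ 0}

/-- The directional limiting normal cone to `A` at `x` in direction `w`. -/
def dnc1 {E : Type*} [NormedAddCommGroup E] [InnerProductSpace ℝ E] (A : Set E) (x w : E) :
    Set E :=
  {xs | ∃ t : ℕ → ℝ, ∃ w' : ℕ → E, ∃ xs' : ℕ → E,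
    (∀ k, 0 < t k) ∧ Tendsto t atTop (𝓝 0) ∧ Tendsto w' atTop (𝓝 w) ∧
    Tendsto xs' atTop (𝓝 xs) ∧ ∀ k, xs' k ∈ rnc1 A (x + t k • w' k)}

/-- Difference quotients along a convergent sequence of directions converge to the derivative. -/
theorem tendsto_difference_quotient {E F : Type*} [NormedAddCommGroup E] [NormedSpace ℝ E]
    [NormedAddCommGroup F] [NormedSpace ℝ F] {H : E → F} {x u : E} {c : ℕ → ℝ} {u' : ℕ → E}
    (hH : DifferentiableAt ℝ H x) (hc : ∀ n, 0 < c n) (hc0 : Tendsto c atTop (𝓝 0))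
    (hu : Tendsto u' atTop (𝓝 u)) :
    Tendsto (fun n => (c n)⁻¹ • (H (x + c n • u' n) - H x)) atTop (𝓝 (fderiv ℝ H x u)) := by
  have h1 := hH.hasFDerivAt.hasFDerivWithinAt (s := univ)
  refine h1.lim (c := fun n => (c n)⁻¹) (d := fun n => c n • u' n) ?_ (by simp) ?_
  · simpa using hc0.smul hu
  · refine hu.congr fun n => ?_
    rw [smul_smul, inv_mul_cancel₀ (hc n).ne', one_smul]

/-- The residual of a nearest point projection is a regular normal. -/
theorem smul_sub_mem_rnc1 {E : Type*} [NormedAddCommGroup E] [InnerProductSpace ℝ E] {D : Set E}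
    {p y : E} (hy : y ∈ D) (hmin : ∀ y' ∈ D, ‖p - y‖ ≤ ‖p - y'‖) {c : ℝ} (hc : 0 ≤ c) :
    c • (p - y) ∈ rnc1 D y := by
  refine ⟨hy, ?_⟩
  rintro w ⟨t, w', ht, ht0, hw', hmem⟩
  have key : ∀ k, ⟪p - y, w' k⟫ ≤ t k * ‖w' k‖ ^ 2 / 2 := by
    intro k
    have h1 := hmin _ (hmem k)
    have h2 : p - (y + t k • w' k) = (p - y) - t k • w' k := by abel
    have h3 : ‖p - y‖ ^ 2 ≤ ‖(p - y) - t k • w' k‖ ^ 2 := by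
      rw [← h2]; gcongr
    rw [norm_sub_sq_real (p - y), inner_smul_right, norm_smul, mul_pow, Real.norm_eq_abs,
      sq_abs] at h3
    have h4 : t k * ⟪p - y, w' k⟫ ≤ t k * (t k * ‖w' k‖ ^ 2 / 2) := by linarith
    exact le_of_mul_le_mul_left h4 (ht k)
  have hl : Tendsto (fun k => ⟪p - y, w' k⟫) atTop (𝓝 ⟪p - y, w⟫) :=
    tendsto_const_nhds.inner hw'
  have hr : Tendsto (fun k => t k * ‖w' k‖ ^ 2 / 2) atTop (𝓝 (0 * ‖w‖ ^ 2 / 2)) :=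
    (ht0.mul (hw'.norm.pow 2)).div_const 2
  have := le_of_tendsto_of_tendsto' hl hr key
  rw [inner_smul_left]
  simp only [zero_mul, zero_div] at this
  exact mul_nonpos_of_nonneg_of_nonpos (by simpa using hc) this

/-- Fermat's rule for `x ↦ ‖G x - y‖ + ε * ‖x - z‖` at a point `z` with `G z ≠ y`. -/
theorem norm_adjoint_fderiv_le {E F : Type*} [NormedAddCommGroup E] [InnerProductSpace ℝ E]
    [CompleteSpace E] [NormedAddCommGroup F] [InnerProductSpace ℝ F] [CompleteSpace F]
    {G : E → F} {z : E} {y : F} {ε : ℝ} (hε : 0 ≤ ε) (hG : DifferentiableAt ℝ G z)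
    (hne : G z ≠ y)
    (hmin : ∀ x, ‖G z - y‖ ≤ ‖G x - y‖ + ε * ‖x - z‖) :
    ‖ContinuousLinearMap.adjoint (fderiv ℝ G z) (‖G z - y‖⁻¹ • (G z - y))‖ ≤ ε := by
  set r := ‖G z - y‖ with hr
  have hrpos : 0 < r := norm_pos_iff.2 (sub_ne_zero.2 hne)
  have key : ∀ h : E, 0 ≤ ⟪G z - y, fderiv ℝ G z h⟫ + r * ε * ‖h‖ := by
    intro h
    have hline : HasDerivAt (fun τ : ℝ => z + τ • h) h 0 := by
      simpa using ((hasDerivAt_id (0 : ℝ)).smul_const h).const_add z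
    have hGl : HasDerivAt (fun τ : ℝ => G (z + τ • h) - y) (fderiv ℝ G z h) 0 := by
      have h0 : HasFDerivAt G (fderiv ℝ G z) (z + (0 : ℝ) • h) := by
        simpa using hG.hasFDerivAt
      exact (h0.comp_hasDerivAt (0 : ℝ) hline).sub_const y
    have hsq := hGl.norm_sq
    have hp : HasDerivAt (fun τ : ℝ => ‖G (z + τ • h) - y‖ ^ 2 + τ * (2 * r * ε * ‖h‖))
        (2 * ⟪G z - y, fderiv ℝ G z h⟫ + 2 * r * ε * ‖h‖) 0 := by
      have := hsq.fun_add ((hasDerivAt_id (0 : ℝ)).mul_const (2 * r * ε * ‖h‖))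
      simpa using this
    have hs := hp.tendsto_slope_zero_right
    have hsmall : ∀ᶠ τ : ℝ in 𝓝[>] 0, ε * (τ * ‖h‖) < r := by
      have hc : Tendsto (fun τ : ℝ => ε * (τ * ‖h‖)) (𝓝[>] 0) (𝓝 (ε * (0 * ‖h‖))) := by
        apply Tendsto.mono_left _ nhdsWithin_le_nhds
        exact Continuous.tendsto (by fun_prop) 0
      apply hc.eventually_lt_const
      simpa using hrpos
    have hge : ∀ᶠ τ : ℝ in 𝓝[>] 0, 0 ≤ τ⁻¹ • ((‖G (z + (0 + τ) • h) - y‖ ^ 2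
        + (0 + τ) * (2 * r * ε * ‖h‖)) - (‖G (z + (0 : ℝ) • h) - y‖ ^ 2
        + 0 * (2 * r * ε * ‖h‖))) := by
      filter_upwards [hsmall, self_mem_nhdsWithin] with τ hτ hτ0
      have hτ0 : 0 < τ := hτ0
      have h1 := hmin (z + τ • h)
      rw [add_sub_cancel_left, norm_smul, Real.norm_of_nonneg hτ0.le] at h1
      have h2 : (r - ε * (τ * ‖h‖)) ^ 2 ≤ ‖G (z + τ • h) - y‖ ^ 2 := by
        apply pow_le_pow_left₀ <;> linarith
      simp only [zero_add, zero_smul, add_zero, zero_mul, smul_eq_mul, ← hr]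
      apply mul_nonneg (inv_nonneg.2 hτ0.le)
      nlinarith [sq_nonneg (ε * (τ * ‖h‖))]
    have := ge_of_tendsto hs hge
    linarith
  set v := r⁻¹ • (G z - y) with hv
  set a := ContinuousLinearMap.adjoint (fderiv ℝ G z) v with ha
  have h1 := key (-a)
  have h2 : ⟪G z - y, fderiv ℝ G z (-a)⟫ = - (r * ‖a‖ ^ 2) := by
    have : G z - y = r • v := by rw [hv, smul_smul, mul_inv_cancel₀ hrpos.ne', one_smul]
    rw [this, inner_smul_left, ← ContinuousLinearMap.adjoint_inner_left, ← ha, inner_neg_right,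
      real_inner_self_eq_norm_sq]
    simp
  rw [h2, norm_neg] at h1
  by_contra! hlt
  have ha0 : 0 < ‖a‖ := hε.trans_lt hlt
  have h3 := mul_pos hrpos (mul_pos ha0 (sub_pos.2 hlt))
  linarith

/-- A penalized minimization: a point at which the error bound fails with constant `ε⁻²` yields a
nearby point outside the feasible set that is almost stationary for the residual. -/
theorem exists_almost_stationary {E F : Type*} [NormedAddCommGroup E] [InnerProductSpace ℝ E]
    [FiniteDimensional ℝ E] [NormedAddCommGroup F] [InnerProductSpace ℝ F]
    [FiniteDimensional ℝ F] {G : E → F} {D : Set F} {xb x : E} {ε : ℝ}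
    (hG : Differentiable ℝ G) (hD : IsClosed D) (hbar : G xb ∈ D) (hε : 0 < ε) (hε2 : ε ≤ 1 / 2)
    (hx : infDist (G x) D < ε ^ 2 * infDist x (G ⁻¹' D)) :
    ∃ (z : E) (y v : F) (r : ℝ), z ≠ xb ∧ ‖z - xb‖ ≤ 2 * ‖x - xb‖ ∧ 0 < r ∧
      r ≤ ε * ‖z - xb‖ ∧ ‖v‖ = 1 ∧ G z = y + r • v ∧ v ∈ rnc1 D y ∧
      ‖ContinuousLinearMap.adjoint (fderiv ℝ G z) v‖ ≤ ε := by
  have hxb : infDist x (G ⁻¹' D) ≤ ‖x - xb‖ := by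
    rw [← dist_eq_norm]; exact infDist_le_dist_of_mem hbar
  have hcont : Continuous fun x' => infDist (G x') D + ε * ‖x' - x‖ := by
    have := hG.continuous
    exact ((continuous_infDist_pt D).comp this).add (by fun_prop)
  have hcoer : Tendsto (fun x' => infDist (G x') D + ε * ‖x' - x‖) (cocompact E) atTop := by
    apply tendsto_atTop_mono (f := fun x' => ε * (‖x'‖ - ‖x‖))
    · intro x'
      have h1 := norm_sub_norm_le x' x
      have h2 : 0 ≤ infDist (G x') D := infDist_nonneg
      nlinarith
    · exact (tendsto_atTop_add_const_right _ _ tendsto_norm_cocompact_atTop).const_mul_atTop hε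
  obtain ⟨z, hz⟩ := hcont.exists_forall_le hcoer
  have hzx := hz x
  simp only [sub_self, norm_zero, mul_zero, add_zero] at hzx
  have hf0 : 0 ≤ infDist (G z) D := infDist_nonneg
  have hn0 : 0 ≤ ‖z - x‖ := norm_nonneg _
  have hi0 : 0 ≤ infDist x (G ⁻¹' D) := infDist_nonneg
  have hzx1 : ‖z - x‖ < ε * infDist x (G ⁻¹' D) := by
    have : ε * ‖z - x‖ < ε * (ε * infDist x (G ⁻¹' D)) := by nlinarith
    exact lt_of_mul_lt_mul_left this hε.le
  have hzD : G z ∉ D := by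
    intro hmem
    have : infDist x (G ⁻¹' D) ≤ ‖z - x‖ := by
      rw [← dist_eq_norm, dist_comm]; exact infDist_le_dist_of_mem hmem
    nlinarith
  obtain ⟨y, hyD, hy⟩ := hD.exists_infDist_eq_dist ⟨_, hbar⟩ (G z)
  rw [dist_eq_norm] at hy
  have hne : G z ≠ y := fun h => hzD (h ▸ hyD)
  have hr : 0 < ‖G z - y‖ := norm_pos_iff.2 (sub_ne_zero.2 hne)
  have htri : ‖x - xb‖ ≤ ‖z - x‖ + ‖z - xb‖ := by
    have := norm_sub_le (z - xb) (z - x)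
    rw [sub_sub_sub_cancel_left] at this
    linarith
  have htri' : ‖z - xb‖ ≤ ‖z - x‖ + ‖x - xb‖ := by
    simpa using norm_add_le (z - x) (x - xb)
  have hd0 : 0 ≤ ‖x - xb‖ := norm_nonneg _
  have hsmall : ‖z - x‖ ≤ 1 / 2 * ‖x - xb‖ := by nlinarith
  refine ⟨z, y, ‖G z - y‖⁻¹ • (G z - y), ‖G z - y‖, ?_, by linarith, hr, ?_, ?_, ?_, ?_, ?_⟩
  · rintro rfl; exact hzD hbar
  · rw [← hy]
    have h1 : ε ^ 2 * infDist x (G ⁻¹' D) ≤ ε * (1 / 2) * ‖x - xb‖ := by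
      rw [pow_two]; gcongr
    nlinarith
  · rw [norm_smul, norm_inv, norm_norm, inv_mul_cancel₀ hr.ne']
  · rw [smul_smul, mul_inv_cancel₀ hr.ne', one_smul]; abel
  · apply smul_sub_mem_rnc1 hyD _ (inv_nonneg.2 hr.le)
    intro y' hy'
    rw [← hy, ← dist_eq_norm]
    exact infDist_le_dist_of_mem hy'
  · apply norm_adjoint_fderiv_le hε.le (hG z) hne
    intro x'
    have h1 := hz x'
    have h2 : infDist (G x') D ≤ ‖G x' - y‖ := by
      rw [← dist_eq_norm]; exact infDist_le_dist_of_mem hyD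
    have h3 : ‖x' - x‖ ≤ ‖x' - z‖ + ‖z - x‖ := by
      simpa using norm_add_le (x' - z) (z - x)
    rw [← hy]
    nlinarith

/-- A first-order mean value argument: nonnegative increments of a function with vanishing
gradient along a sequence with direction `u` force a nonnegative second derivative along `u`. -/
theorem inner_snd_fderiv_nonneg {E F : Type*} [NormedAddCommGroup E] [NormedSpace ℝ E]
    [NormedAddCommGroup F] [InnerProductSpace ℝ F] {G : E → F} {xb u : E} {v : F} {t : ℕ → ℝ}
    {u' : ℕ → E} (hG : Differentiable ℝ G) (hG2 : DifferentiableAt ℝ (fderiv ℝ G) xb)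
    (hv : ∀ h, ⟪v, fderiv ℝ G xb h⟫ = 0) (ht : ∀ n, 0 < t n) (ht0 : Tendsto t atTop (𝓝 0))
    (hu : Tendsto u' atTop (𝓝 u))
    (hinc : ∀ᶠ n in atTop, 0 ≤ ⟪v, G (xb + t n • u' n) - G xb⟫) :
    0 ≤ ⟪v, fderiv ℝ (fderiv ℝ G) xb u u⟫ := by
  have hmv : ∀ n, ∃ c ∈ Ioo 0 (t n), ⟪v, G (xb + t n • u' n) - G xb⟫ =
      t n * ⟪v, fderiv ℝ G (xb + c • u' n) (u' n)⟫ := by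
    intro n
    have hder : ∀ τ : ℝ, HasDerivAt (fun τ : ℝ => ⟪v, G (xb + τ • u' n)⟫)
        ⟪v, fderiv ℝ G (xb + τ • u' n) (u' n)⟫ τ := by
      intro τ
      have hline : HasDerivAt (fun τ : ℝ => xb + τ • u' n) (u' n) τ := by
        simpa using ((hasDerivAt_id τ).smul_const (u' n)).const_add xb
      have h1 := ((hG _).hasFDerivAt (x := xb + τ • u' n)).comp_hasDerivAt τ hline
      simpa using (hasDerivAt_const τ v).inner ℝ h1
    obtain ⟨c, hc, hceq⟩ := exists_hasDerivAt_eq_slope (fun τ : ℝ => ⟪v, G (xb + τ • u' n)⟫) _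
      (ht n) (fun τ _ => (hder τ).continuousAt.continuousWithinAt) (fun τ _ => hder τ)
    refine ⟨c, hc, ?_⟩
    rw [hceq]
    have := (ht n).ne'
    simp only [zero_smul, add_zero, sub_zero, inner_sub_right]
    field_simp
  choose c hc hceq using hmv
  have hc0 : Tendsto c atTop (𝓝 0) :=
    squeeze_zero (fun n => (hc n).1.le) (fun n => (hc n).2.le) ht0
  have hlim : Tendsto (fun n => (c n)⁻¹ • (fderiv ℝ G (xb + c n • u' n) - fderiv ℝ G xb)) atTop
      (𝓝 (fderiv ℝ (fderiv ℝ G) xb u)) := by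
    exact tendsto_difference_quotient hG2 (fun n => (hc n).1) hc0 hu
  have hlim2 : Tendsto (fun n => ⟪v, ((c n)⁻¹ • (fderiv ℝ G (xb + c n • u' n) - fderiv ℝ G xb))
      (u' n)⟫) atTop (𝓝 ⟪v, fderiv ℝ (fderiv ℝ G) xb u u⟫) :=
    tendsto_const_nhds.inner
      ((isBoundedBilinearMap_apply.continuous.tendsto (_, u)).comp (hlim.prodMk_nhds hu))
  refine ge_of_tendsto hlim2 ?_
  filter_upwards [hinc] with n hn
  rw [hceq n] at hn
  have h1 := nonneg_of_mul_nonneg_right hn (ht n)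
  simp only [smul_apply, sub_apply, inner_smul_right,
    inner_sub_right, hv, sub_zero]
  exact mul_nonneg (inv_nonneg.2 (hc n).1.le) h1

/-- A direction annihilated by all constraints active at `y` is tangent. -/
theorem mem_tcone_of_active {E : Type*} [NormedAddCommGroup E] [NormedSpace ℝ E] {D : Set E}
    {m : ℕ} {f : Fin m → (E →L[ℝ] ℝ)} {c : Fin m → ℝ} (hsub : {z | ∀ i, f i z ≤ c i} ⊆ D)
    {y w : E} (hy : ∀ i, f i y ≤ c i) (hw : ∀ i, f i y = c i → f i w = 0) : w ∈ tcone D y := by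
  have hev : ∀ᶠ τ : ℝ in 𝓝 0, ∀ i, f i (y + τ • w) ≤ c i := by
    rw [eventually_all]
    intro i
    rcases (hy i).eq_or_lt with h | h
    · refine Eventually.of_forall fun τ => ?_
      simp [hw i h, h]
    · have hc : Continuous fun τ : ℝ => f i (y + τ • w) := by fun_prop
      have h0 : f i (y + (0 : ℝ) • w) < c i := by simpa using h
      exact (hc.continuousAt.eventually_lt_const h0).mono fun _ h => h.le
  obtain ⟨δ, hδ, hball⟩ := Metric.eventually_nhds_iff.1 hev
  refine ⟨fun k => δ / 2 * (1 / ((k : ℝ) + 1)), fun _ => w, fun k => by positivity, ?_,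
    tendsto_const_nhds, fun k => hsub (hball ?_)⟩
  · simpa using (tendsto_one_div_add_atTop_nhds_zero_nat (𝕜 := ℝ)).const_mul (δ / 2)
  · have h1 : 1 / ((k : ℝ) + 1) ≤ 1 := by
      rw [div_le_one (by positivity)]
      linarith [(Nat.cast_nonneg k : (0 : ℝ) ≤ k)]
    rw [dist_zero_right, Real.norm_of_nonneg (by positivity)]
    nlinarith

/-- Along a sequence in a finite union of polyhedra, limits of regular normals are, up to a
subsequence, orthogonal to the displacements from the limit point. -/
theorem exists_subseq_inner_sub_eq_zero {E : Type*} [NormedAddCommGroup E]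
    [InnerProductSpace ℝ E] {N : ℕ} {C : Fin N → Set E} (hC : ∀ j, IsPolyhedron (C j))
    {y v : ℕ → E} {yb vb : E} (hy : Tendsto y atTop (𝓝 yb)) (hv : Tendsto v atTop (𝓝 vb))
    (hn : ∀ n, v n ∈ rnc1 (⋃ j, C j) (y n)) :
    ∃ φ : ℕ → ℕ, StrictMono φ ∧ ∀ n, ⟪vb, y (φ n) - yb⟫ = 0 := by
  classical
  choose m f c hfc using hC
  have hmem : ∀ n, ∃ j, y n ∈ C j := fun n => mem_iUnion.1 (hn n).1
  choose j hj using hmem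
  let act : ℕ → (Σ j : Fin N, Finset (Fin (m j))) := fun n =>
    ⟨j n, Finset.univ.filter fun i => f (j n) i (y n) = c (j n) i⟩
  obtain ⟨⟨j₀, A⟩, hA⟩ := Finite.exists_infinite_fiber act
  have hfreq : ∃ᶠ n in atTop, act n = ⟨j₀, A⟩ := by
    rw [Nat.frequently_atTop_iff_infinite]
    exact infinite_coe_iff.1 hA
  obtain ⟨φ, hφ, hφA⟩ := extraction_of_frequently_atTop hfreq
  have hspec : ∀ n, y (φ n) ∈ C j₀ ∧ ∀ i, f j₀ i (y (φ n)) = c j₀ i ↔ i ∈ A := by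
    intro n
    have h1 := hφA n
    have hjn := hj (φ n)
    simp only [act] at h1
    generalize j (φ n) = j' at h1 hjn
    obtain ⟨rfl, h2⟩ := Sigma.mk.inj_iff.1 h1
    refine ⟨hjn, fun i => ?_⟩
    rw [← eq_of_heq h2]
    simp
  have hyφ := hy.comp hφ.tendsto_atTop
  have hlim : ∀ i ∈ A, f j₀ i yb = c j₀ i := by
    intro i hi
    have h1 : Tendsto (fun n => f j₀ i (y (φ n))) atTop (𝓝 (f j₀ i yb)) :=
      ((f j₀ i).continuous.tendsto yb).comp hyφ
    refine tendsto_nhds_unique h1 ?_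
    simp only [((hspec _).2 i).2 hi]
    exact tendsto_const_nhds
  have horth : ∀ k l, ⟪v (φ k), y (φ l) - yb⟫ = 0 := by
    intro k l
    have hsub : {z | ∀ i, f j₀ i z ≤ c j₀ i} ⊆ ⋃ j, C j := by
      rw [← hfc j₀]; exact subset_iUnion C j₀
    have hyk : ∀ i, f j₀ i (y (φ k)) ≤ c j₀ i := by
      have := (hspec k).1
      rw [hfc j₀] at this
      exact this
    have hz : ∀ i, f j₀ i (y (φ k)) = c j₀ i → f j₀ i (y (φ l) - yb) = 0 := by
      intro i hi
      have hiA := ((hspec k).2 i).1 hi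
      rw [map_sub, ((hspec l).2 i).2 hiA, hlim i hiA, sub_self]
    have h1 := (hn (φ k)).2 _ (mem_tcone_of_active hsub hyk hz)
    have h2 := (hn (φ k)).2 _ (mem_tcone_of_active hsub hyk (w := -(y (φ l) - yb))
      fun i hi => by rw [map_neg, hz i hi, neg_zero])
    rw [inner_neg_right] at h2
    linarith
  refine ⟨φ, hφ, fun l => ?_⟩
  have h1 : Tendsto (fun k => ⟪v (φ k), y (φ l) - yb⟫) atTop (𝓝 ⟪vb, y (φ l) - yb⟫) :=
    (hv.comp hφ.tendsto_atTop).inner tendsto_const_nhds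
  simp only [horth] at h1
  exact tendsto_nhds_unique h1 tendsto_const_nhds

/-- If metric subregularity fails, there is a critical direction together with a unit multiplier,
both realized along a sequence of almost stationary points. -/
theorem exists_critical_sequence {s d : ℕ} {G : Es s → Es d} {D : Set (Es d)} {xb : Es s}
    (hG : ContDiff ℝ 1 G) (hD : IsClosed D) (hbar : G xb ∈ D)
    (hnot : ¬ MetrSubregAt (fun x => (fun y => G x - y) '' D) xb 0) :
    ∃ (t r : ℕ → ℝ) (u' : ℕ → Es s) (y v : ℕ → Es d) (u : Es s) (vb : Es d),
      (∀ n, 0 < t n) ∧ Tendsto t atTop (𝓝 0) ∧ Tendsto u' atTop (𝓝 u) ∧ u ≠ 0 ∧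
      Tendsto v atTop (𝓝 vb) ∧ vb ≠ 0 ∧ (∀ n, 0 < r n) ∧
      Tendsto (fun n => r n / t n) atTop (𝓝 0) ∧
      (∀ n, G (xb + t n • u' n) = y n + r n • v n) ∧ (∀ n, v n ∈ rnc1 D (y n)) ∧
      ContinuousLinearMap.adjoint (fderiv ℝ G xb) vb = 0 := by
  have hfail : ∀ n : ℕ, ∃ x, ‖x - xb‖ < 1 / ((n : ℝ) + 1) ∧
      infDist (G x) D < (1 / ((n : ℝ) + 2)) ^ 2 * infDist x (G ⁻¹' D) := by
    intro n
    simp only [MetrSubregAt] at hnot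
    push Not at hnot
    obtain ⟨x, hx, hlt⟩ := hnot (((n : ℝ) + 2) ^ 2) (by positivity) (1 / ((n : ℝ) + 1))
      (by positivity)
    refine ⟨x, by rwa [← dist_eq_norm], ?_⟩
    have hset : {x' | (0 : Es d) ∈ (fun y => G x' - y) '' D} = G ⁻¹' D := by
      ext x'
      simp only [mem_ofPred_eq, mem_image, mem_preimage, sub_eq_zero]
      exact ⟨fun ⟨y, hy, h⟩ => h ▸ hy, fun h => ⟨_, h, rfl⟩⟩
    have hedist : infEDist 0 ((fun y => G x - y) '' D) = infEDist (G x) D := by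
      simp only [infEDist, iInf_image]
      simp only [edist_eq_enorm_sub, zero_sub, enorm_neg]
    change ENNReal.ofReal (((n : ℝ) + 2) ^ 2) * infEDist 0 ((fun y => G x - y) '' D) <
      infEDist x {x' | (0 : Es d) ∈ (fun y => G x' - y) '' D} at hlt
    rw [hset, hedist, ← ENNReal.ofReal_toReal (infEDist_ne_top ⟨_, hbar⟩),
      ← ENNReal.ofReal_toReal (infEDist_ne_top (s := G ⁻¹' D) ⟨xb, hbar⟩),
      ← ENNReal.ofReal_mul (by positivity)] at hlt
    have h1 := (ENNReal.ofReal_lt_ofReal_iff_of_nonneg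
      (mul_nonneg (by positivity) ENNReal.toReal_nonneg)).1 hlt
    change ((n : ℝ) + 2) ^ 2 * infDist (G x) D < infDist x (G ⁻¹' D) at h1
    rw [one_div, inv_pow, ← div_eq_inv_mul, lt_div_iff₀ (by positivity)]
    linarith
  choose x hx hxlt using hfail
  have hdiff : Differentiable ℝ G := hG.differentiable one_ne_zero
  have hstat := fun n : ℕ => exists_almost_stationary (x := x n) (ε := 1 / ((n : ℝ) + 2)) hdiff hD
    hbar (by positivity)
    (one_div_le_one_div_of_le two_pos (by linarith [(Nat.cast_nonneg n : (0 : ℝ) ≤ n)])) (hxlt n)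
  choose z y v r hzne hz hr hrle hvnorm hGz hvn hadj using hstat
  have hε : Tendsto (fun n : ℕ => 1 / ((n : ℝ) + 2)) atTop (𝓝 0) := by
    have := (tendsto_add_atTop_iff_nat 1).2 (tendsto_one_div_add_atTop_nhds_zero_nat (𝕜 := ℝ))
    refine this.congr fun n => ?_
    push_cast
    ring_nf
  have htpos : ∀ n, 0 < ‖z n - xb‖ := fun n => norm_pos_iff.2 (sub_ne_zero.2 (hzne n))
  have ht0 : Tendsto (fun n => ‖z n - xb‖) atTop (𝓝 0) := by
    refine squeeze_zero (fun n => norm_nonneg _)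
      (fun n => (hz n).trans (mul_le_mul_of_nonneg_left (hx n).le two_pos.le)) ?_
    simpa using (tendsto_one_div_add_atTop_nhds_zero_nat (𝕜 := ℝ)).const_mul 2
  have hunorm : ∀ n, ‖‖z n - xb‖⁻¹ • (z n - xb)‖ = 1 := fun n => by
    rw [norm_smul, norm_inv, norm_norm, inv_mul_cancel₀ (htpos n).ne']
  obtain ⟨⟨u, vb⟩, ⟨hu, hvb⟩, φ, hφ, hlim⟩ :=
    ((isCompact_sphere (0 : Es s) 1).prod (isCompact_sphere (0 : Es d) 1)).tendsto_subseq
      (x := fun n => (‖z n - xb‖⁻¹ • (z n - xb), v n))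
      (fun n => ⟨by simpa using hunorm n, by simpa using hvnorm n⟩)
  have hφt := hφ.tendsto_atTop
  have hlim' := Prod.tendsto_iff _ _ |>.1 hlim
  have hpt : ∀ n, xb + ‖z n - xb‖ • ‖z n - xb‖⁻¹ • (z n - xb) = z n := fun n => by
    rw [smul_smul, mul_inv_cancel₀ (htpos n).ne', one_smul]; abel
  refine ⟨fun n => ‖z (φ n) - xb‖, r ∘ φ, fun n => ‖z (φ n) - xb‖⁻¹ • (z (φ n) - xb), y ∘ φ,
    v ∘ φ, u, vb, fun n => htpos _, ht0.comp hφt, hlim'.1, ?_, hlim'.2, ?_, fun n => hr _, ?_, ?_,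
    fun n => hvn _, ?_⟩
  · rintro rfl; simp at hu
  · rintro rfl; simp at hvb
  · refine squeeze_zero (fun n => div_nonneg (hr _).le (htpos _).le) (fun n => ?_) (hε.comp hφt)
    exact (div_le_iff₀ (htpos _)).2 (hrle _)
  · intro n
    rw [hpt]; exact hGz _
  · have hzlim : Tendsto z atTop (𝓝 xb) := tendsto_iff_norm_sub_tendsto_zero.2 ht0
    have hfd : Tendsto (fun n => fderiv ℝ G (z (φ n))) atTop (𝓝 (fderiv ℝ G xb)) :=
      ((hG.continuous_fderiv one_ne_zero).tendsto xb).comp (hzlim.comp hφt)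
    have hA : Tendsto (fun n => ContinuousLinearMap.adjoint (fderiv ℝ G (z (φ n)))) atTop
        (𝓝 (ContinuousLinearMap.adjoint (fderiv ℝ G xb))) :=
      (ContinuousLinearMap.adjoint.continuous.tendsto _).comp hfd
    have hA0 : Tendsto (fun n => ContinuousLinearMap.adjoint (fderiv ℝ G (z (φ n))) (v (φ n)))
        atTop (𝓝 0) := squeeze_zero_norm (fun n => hadj _) (hε.comp hφt)
    exact tendsto_nhds_unique
      ((isBoundedBilinearMap_apply.continuous.tendsto (_, vb)).comp (hA.prodMk_nhds hlim'.2)) hA0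

/-- FOSCMS and SOSCMS: first- and second-order sufficient conditions for metric
subregularity of the constraint system `M(x) = G(x) - D` at `(xb, 0)`
(Corollary `CorMS_ConstrSyst`). -/
theorem stmt11 {s d : ℕ} (G : Es s → Es d) (D : Set (Es d)) (xb : Es s)
    (hG : ContDiff ℝ 1 G) (hD : IsClosed D) (hbar : G xb ∈ D)
    (h : (∀ u : Es s, u ≠ 0 → fderiv ℝ G xb u ∈ tcone D (G xb) →
        ∀ vs : Es d, ContinuousLinearMap.adjoint (fderiv ℝ G xb) vs = 0 →
          vs ∈ dnc1 D (G xb) (fderiv ℝ G xb u) → vs = 0) ∨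
      (DifferentiableAt ℝ (fderiv ℝ G) xb ∧
        (∃ (N : ℕ) (C : Fin N → Set (Es d)), (∀ j, IsPolyhedron (C j)) ∧ D = ⋃ j, C j) ∧
        ∀ u : Es s, u ≠ 0 → fderiv ℝ G xb u ∈ tcone D (G xb) →
          ∀ vs : Es d, ContinuousLinearMap.adjoint (fderiv ℝ G xb) vs = 0 →
            vs ∈ dnc1 D (G xb) (fderiv ℝ G xb u) →
            0 ≤ ⟪vs, fderiv ℝ (fderiv ℝ G) xb u u⟫ → vs = 0)) :
    MetrSubregAt (fun x => (fun y => G x - y) '' D) xb 0 := by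
  by_contra hnot
  obtain ⟨t, r, u', y, v, u, vb, ht, ht0, hu', hu, hv, hvb, hr, hrt, hGy, hn, hadj⟩ :=
    exists_critical_sequence hG hD hbar hnot
  have hdiff : Differentiable ℝ G := hG.differentiable one_ne_zero
  have hw : Tendsto (fun n => (t n)⁻¹ • (y n - G xb)) atTop (𝓝 (fderiv ℝ G xb u)) := by
    have h1 : Tendsto (fun n => (t n)⁻¹ • (G (xb + t n • u' n) - G xb)) atTop
        (𝓝 (fderiv ℝ G xb u)) :=
      tendsto_difference_quotient (hdiff xb) ht ht0 hu'
    have h2 := h1.sub (hrt.smul hv)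
    simp only [zero_smul, sub_zero] at h2
    refine h2.congr fun n => ?_
    rw [hGy n, div_eq_inv_mul, mul_smul, ← smul_sub]
    congr 1
    abel
  have hyeq : ∀ n, G xb + t n • (t n)⁻¹ • (y n - G xb) = y n := fun n => by
    rw [smul_smul, mul_inv_cancel₀ (ht n).ne', one_smul]; abel
  have htan : fderiv ℝ G xb u ∈ tcone D (G xb) :=
    ⟨t, _, ht, ht0, hw, fun n => by rw [hyeq]; exact (hn n).1⟩
  have hdn : vb ∈ dnc1 D (G xb) (fderiv ℝ G xb u) :=
    ⟨t, _, v, ht, ht0, hw, hv, fun n => by rw [hyeq]; exact hn n⟩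
  rcases h with h | ⟨hG2, ⟨N, C, hC, rfl⟩, h⟩
  · exact hvb (h u hu htan vb hadj hdn)
  refine hvb (h u hu htan vb hadj hdn ?_)
  have hy : Tendsto y atTop (𝓝 (G xb)) := by
    have h1 := (ht0.smul hw).const_add (G xb)
    simp only [zero_smul, add_zero] at h1
    exact h1.congr hyeq
  obtain ⟨φ, hφ, horth⟩ := exists_subseq_inner_sub_eq_zero hC hy hv hn
  have hφt := hφ.tendsto_atTop
  refine inner_snd_fderiv_nonneg (t := t ∘ φ) (u' := u' ∘ φ) hdiff hG2 (fun w => ?_)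
    (fun n => ht _) (ht0.comp hφt) (hu'.comp hφt) ?_
  · rw [← ContinuousLinearMap.adjoint_inner_left, hadj, inner_zero_left]
  · have hpos : ∀ᶠ n in atTop, 0 < ⟪vb, v n⟫ := by
      have h1 : Tendsto (fun n => ⟪vb, v n⟫) atTop (𝓝 ⟪vb, vb⟫) := tendsto_const_nhds.inner hv
      exact h1.eventually_const_lt (real_inner_self_pos.2 hvb)
    filter_upwards [hφt.eventually hpos] with n hpn
    have h2 : G (xb + t (φ n) • u' (φ n)) - G xb = (y (φ n) - G xb) + r (φ n) • v (φ n) := by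
      rw [hGy]; abel
    simp only [Function.comp_apply]
    rw [h2, inner_add_right, horth, zero_add, inner_smul_right]
    exact (mul_pos (hr _) hpn).le
end
end

section
/- Let Γ be a convex polyhedral set in ℝᵐ, let (ȳ, ȳ*) ∈ gph N_Γ and (v, v*) ∈ T_{gph N_Γ}(ȳ, ȳ*). Then the directional limiting normal cone N_{gph N_Γ}((ȳ,ȳ*); (v,v*)) equals the union of all product sets K° × K over the cones K of the form K = F₁ − F₂, where F₁ and F₂ are closed faces of the critical cone K_Γ(ȳ,ȳ*) satisfying v ∈ F₂ ⊆ F₁ ⊆ [v*]⊥. -/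
open Filter Topology Metric Set
open scoped RealInnerProductSpace

noncomputable section

open Pointwise

/-- The normal-cone map of convex analysis associated with `Γ`. -/
def Nmap {E : Type*} [NormedAddCommGroup E] [InnerProductSpace ℝ E] (Γ : Set E) :
    E → Set E :=
  fun y => {ys | y ∈ Γ ∧ ∀ z ∈ Γ, ⟪ys, z - y⟫ ≤ 0}

/-- The (negative) polar cone. -/
def pol {E : Type*} [NormedAddCommGroup E] [InnerProductSpace ℝ E] (K : Set E) : Set E :=
  {zs | ∀ w ∈ K, ⟪zs, w⟫ ≤ 0}

/-- `F` is a closed face of the convex polyhedral cone `K`. -/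
def IsFaceOf {E : Type*} [NormedAddCommGroup E] [InnerProductSpace ℝ E] (K F : Set E) :
    Prop :=
  ∃ zs ∈ pol K, F = K ∩ {w | ⟪zs, w⟫ = 0}

section PolyhedralCones

variable {E : Type*} [NormedAddCommGroup E] [InnerProductSpace ℝ E]

/-- **Farkas' lemma** for finitely many linear functionals. -/
theorem farkas {V : Type*} [AddCommGroup V] [Module ℝ V] (n : ℕ) :
    ∀ (f : Fin n → V →ₗ[ℝ] ℝ) (b : V →ₗ[ℝ] ℝ), (∀ x, (∀ i, f i x ≤ 0) → b x ≤ 0) →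
      ∃ l : Fin n → ℝ, (∀ i, 0 ≤ l i) ∧ ∀ x, b x = ∑ i, l i * f i x := by
  induction n with
  | zero =>
    intro f b h
    refine ⟨fun _ => 0, fun _ => le_rfl, fun x => ?_⟩
    have h1 := h x (fun i => i.elim0)
    have h2 := h (-x) (fun i => i.elim0)
    rw [map_neg] at h2
    simp only [Finset.univ_eq_empty, Finset.sum_empty]
    linarith
  | succ n ih =>
    intro f b h
    by_cases hb : ∀ x, (∀ i : Fin n, f i.castSucc x ≤ 0) → b x ≤ 0
    · obtain ⟨l, hl, hl'⟩ := ih (fun i => f i.castSucc) b hb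
      refine ⟨Fin.snoc l 0, fun i => ?_, fun x => ?_⟩
      · refine Fin.lastCases ?_ (fun j => ?_) i
        · simp
        · simpa using hl j
      · rw [Fin.sum_univ_castSucc]
        simpa using hl' x
    · push Not at hb
      obtain ⟨x₁, hx₁, hbx₁⟩ := hb
      have hpos : 0 < f (Fin.last n) x₁ := by
        by_contra! hle
        exact absurd (h x₁ (fun i => Fin.lastCases hle hx₁ i)) (not_le.mpr hbx₁)
      obtain ⟨x₀, hx₀, hbx₀, h1⟩ : ∃ x₀, (∀ i : Fin n, f i.castSucc x₀ ≤ 0) ∧ 0 < b x₀ ∧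
          f (Fin.last n) x₀ = 1 := by
        refine ⟨(f (Fin.last n) x₁)⁻¹ • x₁, fun i => ?_, ?_, ?_⟩
        · rw [map_smul, smul_eq_mul]
          exact mul_nonpos_of_nonneg_of_nonpos (inv_pos.mpr hpos).le (hx₁ i)
        · rw [map_smul, smul_eq_mul]
          exact mul_pos (inv_pos.mpr hpos) hbx₁
        · rw [map_smul, smul_eq_mul, inv_mul_cancel₀ hpos.ne']
      let P : V →ₗ[ℝ] V := LinearMap.id - (f (Fin.last n)).smulRight x₀
      have hP : ∀ x, P x = x - f (Fin.last n) x • x₀ := fun x => by simp [P]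
      obtain ⟨l, hl, hl'⟩ := ih (fun i => f i.castSucc ∘ₗ P) (b ∘ₗ P) (fun x hx => by
        refine h (P x) (fun i => Fin.lastCases ?_ hx i)
        simp [hP, h1])
      refine ⟨Fin.snoc l (b x₀ - ∑ i, l i * f i.castSucc x₀), fun i => ?_, fun x => ?_⟩
      · refine Fin.lastCases ?_ (fun j => ?_) i
        · have : ∑ i, l i * f i.castSucc x₀ ≤ 0 :=
            Finset.sum_nonpos fun i _ => mul_nonpos_of_nonneg_of_nonpos (hl i) (hx₀ i)
          simp only [Fin.snoc_last]
          linarith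
        · simpa using hl j
      · have hx := hl' x
        simp only [LinearMap.comp_apply, hP, map_sub, map_smul, smul_eq_mul, mul_sub,
          Finset.sum_sub_distrib] at hx
        have hs : ∑ i, l i * (f (Fin.last n) x * f i.castSucc x₀) =
            f (Fin.last n) x * ∑ i, l i * f i.castSucc x₀ := by
          rw [Finset.mul_sum]
          exact Finset.sum_congr rfl fun i _ => by ring
        rw [Fin.sum_univ_castSucc]
        simp only [Fin.snoc_castSucc, Fin.snoc_last]
        rw [hs] at hx
        linarith

variable {n : ℕ}

/-- The polyhedron cut out by the inequalities `⟪a i, z⟫ ≤ c i`. -/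
def polyhedron (a : Fin n → E) (c : Fin n → ℝ) : Set E := {z | ∀ i, ⟪a i, z⟫ ≤ c i}

/-- The polyhedral cone cut out by the inequalities `⟪a i, w⟫ ≤ 0`, `i ∈ J`. -/
def polyCone (a : Fin n → E) (J : Set (Fin n)) : Set E := {w | ∀ i ∈ J, ⟪a i, w⟫ ≤ 0}

/-- The indices of the inequalities that are active at `y`. -/
def activeSet (a : Fin n → E) (c : Fin n → ℝ) (y : E) : Set (Fin n) := {i | ⟪a i, y⟫ = c i}

variable {a : Fin n → E} {c : Fin n → ℝ} {I J : Set (Fin n)}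

lemma polyCone_anti (h : J ⊆ I) : polyCone a I ⊆ polyCone a J := fun _ hw i hi => hw i (h hi)

lemma isClosed_polyCone : IsClosed (polyCone a J) := by
  have : polyCone a J = ⋂ i ∈ J, {w | ⟪a i, w⟫ ≤ 0} := by ext; simp [polyCone]
  rw [this]
  exact isClosed_biInter fun i _ => isClosed_le (by fun_prop) continuous_const

lemma isClosed_pol (K : Set E) : IsClosed (pol K) := by
  have : pol K = ⋂ w ∈ K, {z : E | ⟪z, w⟫ ≤ 0} := by ext; simp [pol]
  rw [this]
  exact isClosed_biInter fun i _ => isClosed_le (by fun_prop) continuous_const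

lemma isClosed_orthogonal (z : E) : IsClosed {w : E | ⟪z, w⟫ = 0} :=
  isClosed_eq (by fun_prop) continuous_const

lemma pol_anti {K L : Set E} (h : K ⊆ L) : pol L ⊆ pol K := fun _ hz w hw => hz w (h hw)

lemma eventually_inner_lt {a y w : E} {c : ℝ} (h : ⟪a, y⟫ < c) :
    ∀ᶠ t : ℝ in 𝓝[>] 0, ⟪a, y + t • w⟫ < c := by
  have : Tendsto (fun t : ℝ => ⟪a, y + t • w⟫) (𝓝[>] 0) (𝓝 ⟪a, y⟫) := by
    have h0 : Continuous (fun t : ℝ => ⟪a, y + t • w⟫) := by fun_prop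
    have := h0.tendsto 0
    simp only [zero_smul, add_zero] at this
    exact this.mono_left nhdsWithin_le_nhds
  exact this.eventually_lt_const h

lemma eventually_inner_le {a y w : E} {c : ℝ} (h : ⟪a, y⟫ ≤ c) (hw : ⟪a, y⟫ = c → ⟪a, w⟫ ≤ 0) :
    ∀ᶠ t : ℝ in 𝓝[>] 0, ⟪a, y + t • w⟫ ≤ c := by
  rcases h.lt_or_eq with h | h
  · exact (eventually_inner_lt h).mono fun _ => le_of_lt
  · filter_upwards [self_mem_nhdsWithin] with t ht
    rw [inner_add_right, real_inner_smul_right, h]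
    have := mul_nonpos_of_nonneg_of_nonpos (le_of_lt ht) (hw h)
    linarith

lemma eventually_mem_polyhedron {y w : E} (hy : y ∈ polyhedron a c)
    (hw : w ∈ polyCone a (activeSet a c y)) :
    ∀ᶠ t : ℝ in 𝓝[>] 0, y + t • w ∈ polyhedron a c :=
  eventually_all.mpr fun i => eventually_inner_le (hy i) (hw i)

lemma eventually_mem_polyCone {d w : E} (hd : d ∈ polyCone a I)
    (hw : ∀ i ∈ I, ⟪a i, d⟫ = 0 → ⟪a i, w⟫ ≤ 0) :
    ∀ᶠ t : ℝ in 𝓝[>] 0, d + t • w ∈ polyCone a I :=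
  eventually_all.mpr fun i => eventually_imp_distrib_left.mpr fun hi =>
    eventually_inner_le (hd i hi) (hw i hi)

lemma eventually_activeSet_subset (y w : E) :
    ∀ᶠ t : ℝ in 𝓝[>] 0, y ∈ polyhedron a c →
      activeSet a c (y + t • w) ⊆ activeSet a c y := by
  refine eventually_imp_distrib_left.mpr fun hy => ?_
  have : ∀ᶠ t : ℝ in 𝓝[>] 0, ∀ i, ⟪a i, y⟫ < c i → ⟪a i, y + t • w⟫ < c i :=
    eventually_all.mpr fun i => eventually_imp_distrib_left.mpr fun hi => eventually_inner_lt hi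
  filter_upwards [this] with t ht i hi
  by_contra hne
  exact (ht i (lt_of_le_of_ne (hy i) hne)).ne hi

lemma exists_add_smul_mem_polyCone {d w : E} (hd : d ∈ polyCone a I)
    (hw : ∀ i ∈ I, ⟪a i, d⟫ = 0 → ⟪a i, w⟫ ≤ 0) :
    ∃ N : ℝ, 0 < N ∧ w + N • d ∈ polyCone a I := by
  obtain ⟨t, ht, h0⟩ := ((eventually_mem_polyCone hd hw).and self_mem_nhdsWithin).exists
  have h0 : 0 < t := h0
  refine ⟨t⁻¹, inv_pos.mpr h0, fun i hi => ?_⟩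
  have : w + t⁻¹ • d = t⁻¹ • (d + t • w) := by
    rw [smul_add, smul_smul, inv_mul_cancel₀ h0.ne', one_smul, add_comm]
  rw [this, real_inner_smul_right]
  exact mul_nonpos_of_nonneg_of_nonpos (inv_pos.mpr h0).le (ht i hi)

lemma mem_tcone_of_eventually {F : Type*} [NormedAddCommGroup F] [NormedSpace ℝ F]
    {A : Set F} {x w : F} (h : ∀ᶠ t : ℝ in 𝓝[>] 0, x + t • w ∈ A) : w ∈ tcone A x := by
  obtain ⟨t, ht, h⟩ := exists_seq_forall_of_frequently (h.and self_mem_nhdsWithin).frequently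
  exact ⟨t, fun _ => w, fun k => (h k).2, ht.mono_right nhdsWithin_le_nhds, tendsto_const_nhds,
    fun k => (h k).1⟩

lemma tcone_polyhedron {y : E} (hy : y ∈ polyhedron a c) :
    tcone (polyhedron a c) y = polyCone a (activeSet a c y) := by
  refine Subset.antisymm ?_ fun w hw => mem_tcone_of_eventually (eventually_mem_polyhedron hy hw)
  rintro w ⟨t, w', ht, -, hw', h⟩ i hi
  have hi : ⟪a i, y⟫ = c i := hi
  refine le_of_tendsto (tendsto_const_nhds.inner hw') (Eventually.of_forall fun k => ?_)
  have := h k i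
  rw [inner_add_right, real_inner_smul_right, hi] at this
  exact nonpos_of_mul_nonpos_right (by linarith) (ht k)

lemma mem_Nmap_polyhedron {y ys : E} :
    ys ∈ Nmap (polyhedron a c) y ↔
      y ∈ polyhedron a c ∧ ys ∈ pol (polyCone a (activeSet a c y)) := by
  refine ⟨fun h => ⟨h.1, fun u hu => ?_⟩, fun h => ⟨h.1, fun z hz => h.2 _ fun i hi => ?_⟩⟩
  · obtain ⟨t, ht, h0⟩ := ((eventually_mem_polyhedron h.1 hu).and self_mem_nhdsWithin).exists
    have := h.2 _ ht
    rw [add_sub_cancel_left, real_inner_smul_right] at this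
    exact nonpos_of_mul_nonpos_right this h0
  · have hi : ⟪a i, y⟫ = c i := hi
    rw [inner_sub_right, hi]
    linarith [hz i]

/-- Tangents to the graph of the normal cone map of a polyhedron lie in the product of the
critical cone and its polar. -/
lemma tcone_gph_Nmap_subset {y ys w ws : E} (hy : ys ∈ Nmap (polyhedron a c) y)
    (hw : (w, ws) ∈ tcone (gph (Nmap (polyhedron a c))) (y, ys)) :
    w ∈ polyCone a (activeSet a c y) ∩ {u | ⟪ys, u⟫ = 0} ∧
      ws ∈ pol (polyCone a (activeSet a c y) ∩ {u | ⟪ys, u⟫ = 0}) := by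
  obtain ⟨t, W, ht, ht0, hW, h⟩ := hw
  have hW1 : Tendsto (fun k => (W k).1) atTop (𝓝 w) := (continuous_fst.tendsto _).comp hW
  have hW2 : Tendsto (fun k => (W k).2) atTop (𝓝 ws) := (continuous_snd.tendsto _).comp hW
  have hN : ∀ k, ys + t k • (W k).2 ∈ Nmap (polyhedron a c) (y + t k • (W k).1) := h
  have hys : ∀ k, ⟪ys, (W k).1⟫ ≤ 0 := fun k => by
    have := hy.2 _ (hN k).1
    rw [add_sub_cancel_left, real_inner_smul_right] at this
    exact nonpos_of_mul_nonpos_right this (ht k)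
  have hlim : Tendsto (fun k => ⟪ys, (W k).1⟫) atTop (𝓝 ⟪ys, w⟫) := tendsto_const_nhds.inner hW1
  refine ⟨⟨?_, le_antisymm (le_of_tendsto hlim (Eventually.of_forall hys)) ?_⟩, fun u hu => ?_⟩
  · rw [← tcone_polyhedron hy.1]
    exact ⟨t, _, ht, ht0, hW1, fun k => (hN k).1⟩
  · have hlim' : Tendsto (fun k => ⟪ys + t k • (W k).2, (W k).1⟫) atTop (𝓝 ⟪ys, w⟫) := by
      have := (tendsto_const_nhds (x := ys)).add (ht0.smul hW2)
      simpa using this.inner (𝕜 := ℝ) hW1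
    refine ge_of_tendsto hlim' (Eventually.of_forall fun k => ?_)
    have := (hN k).2 y hy.1
    rw [sub_add_cancel_left, inner_neg_right, real_inner_smul_right] at this
    exact nonneg_of_mul_nonneg_right (by linarith) (ht k)
  · obtain ⟨s, hs, h0⟩ := ((eventually_mem_polyhedron hy.1 hu.1).and self_mem_nhdsWithin).exists
    have hlim' : Tendsto (fun k => ⟪(W k).2, s • u - t k • (W k).1⟫) atTop (𝓝 ⟪ws, s • u⟫) := by
      have := (tendsto_const_nhds (x := s • u)).sub (ht0.smul hW1)
      simpa using hW2.inner (𝕜 := ℝ) this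
    refine nonpos_of_mul_nonpos_right (a := s) ?_ h0
    rw [← real_inner_smul_right]
    refine le_of_tendsto hlim' (Eventually.of_forall fun k => ?_)
    have h1 := (hN k).2 _ hs
    rw [add_sub_add_left_eq_sub, inner_add_left, real_inner_smul_left, inner_sub_right ys,
      real_inner_smul_right, real_inner_smul_right, (show ⟪ys, u⟫ = 0 from hu.2)] at h1
    have h2 : t k * ⟪(W k).2, s • u - t k • (W k).1⟫ ≤ 0 := by
      have := mul_nonpos_of_nonneg_of_nonpos (ht k).le (hys k)
      linarith
    exact nonpos_of_mul_nonpos_right h2 (ht k)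

/-- The regular normal cone to the graph of the normal cone map of a polyhedron is the product
of the polar of the critical cone and the critical cone. -/
lemma mem_rnc2_gph_Nmap {y ys : E} (hy : ys ∈ Nmap (polyhedron a c) y) (p : E × E) :
    p ∈ rnc2 (gph (Nmap (polyhedron a c))) (y, ys) ↔
      p.1 ∈ pol (polyCone a (activeSet a c y) ∩ {u | ⟪ys, u⟫ = 0}) ∧
        p.2 ∈ polyCone a (activeSet a c y) ∩ {u | ⟪ys, u⟫ = 0} := by
  have hy' := mem_Nmap_polyhedron.mp hy
  constructor
  · rintro ⟨-, h⟩
    have hvert : ∀ ws : E, (∀ᶠ t : ℝ in 𝓝[>] 0, ys + t • ws ∈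
        pol (polyCone a (activeSet a c y))) → ⟪p.2, ws⟫ ≤ 0 := fun ws hws => by
      have := h (0, ws) (mem_tcone_of_eventually (hws.mono fun t ht => by
        simpa [gph] using mem_Nmap_polyhedron.mpr ⟨hy'.1, ht⟩))
      simpa [pr2] using this
    refine ⟨fun w hw => ?_, fun i hi => ?_, ?_⟩
    · have := h (w, 0) (mem_tcone_of_eventually ?_)
      · simpa [pr2] using this
      · filter_upwards [eventually_mem_polyhedron hy.1 hw.1] with t ht
        refine ⟨ht, fun z hz => ?_⟩
        have h1 := hy.2 z hz
        have h2 : ⟪ys, w⟫ = 0 := hw.2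
        simp only [Prod.smul_mk, smul_zero, Prod.mk_add_mk, add_zero]
        rw [← sub_sub, inner_sub_right, real_inner_smul_right, h2]
        linarith
    · rw [real_inner_comm]
      refine hvert _ ?_
      filter_upwards [self_mem_nhdsWithin] with t ht u hu
      rw [inner_add_left, real_inner_smul_left]
      have := mul_nonpos_of_nonneg_of_nonpos (le_of_lt ht) (hu i hi)
      linarith [hy'.2 u hu]
    · have h1 : ⟪p.2, ys⟫ ≤ 0 := by
        refine hvert _ ?_
        filter_upwards [self_mem_nhdsWithin] with t ht u hu
        rw [inner_add_left, real_inner_smul_left]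
        have := mul_nonpos_of_nonneg_of_nonpos (le_of_lt ht) (hy'.2 u hu)
        linarith [hy'.2 u hu]
      have h2 : ⟪p.2, -ys⟫ ≤ 0 := by
        refine hvert _ ?_
        filter_upwards [Ioo_mem_nhdsGT (show (0 : ℝ) < 1 by norm_num)] with t ht u hu
        rw [inner_add_left, real_inner_smul_left, inner_neg_left]
        have := mul_nonpos_of_nonneg_of_nonpos (sub_nonneg.mpr ht.2.le) (hy'.2 u hu)
        linarith
      rw [inner_neg_right] at h2
      show ⟪ys, p.2⟫ = 0
      rw [real_inner_comm]
      linarith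
  · rintro ⟨h1, h2⟩
    refine ⟨hy, fun w hw => ?_⟩
    obtain ⟨hw1, hw2⟩ := tcone_gph_Nmap_subset hy (w := w.1) (ws := w.2) hw
    have := hw2 _ h2
    rw [real_inner_comm] at this
    exact add_nonpos (h1 _ hw1) this

/-- Moving from `z ∈ pol C`, `C` a polyhedral cone, in a direction polar to the face
`C ∩ z⊥` stays in `pol C` for small steps. -/
lemma eventually_add_smul_mem_pol {z w : E} (hz : z ∈ pol (polyCone a J))
    (hw : w ∈ pol (polyCone a J ∩ {u | ⟪z, u⟫ = 0})) :
    ∀ᶠ t : ℝ in 𝓝[>] 0, z + t • w ∈ pol (polyCone a J) := by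
  classical
  let f : Fin (n + 1) → E →ₗ[ℝ] ℝ :=
    Fin.snoc (α := fun _ => E →ₗ[ℝ] ℝ) (fun i => if i ∈ J then innerₗ E (a i) else 0) (-innerₗ E z)
  obtain ⟨l, hl, h⟩ := farkas (n + 1) f (innerₗ E w) (fun u hu => by
    have huJ : u ∈ polyCone a J := fun i hi => by simpa [f, hi] using hu i.castSucc
    refine hw u ⟨huJ, le_antisymm (hz u huJ) ?_⟩
    simpa [f] using hu (Fin.last n))
  have hsmall : ∀ᶠ t : ℝ in 𝓝[>] 0, t * l (Fin.last n) < 1 := by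
    have : Tendsto (fun t : ℝ => t * l (Fin.last n)) (𝓝[>] 0) (𝓝 (0 * l (Fin.last n))) :=
      ((continuous_id.mul continuous_const).tendsto 0).mono_left nhdsWithin_le_nhds
    exact this.eventually_lt_const (by simp)
  filter_upwards [self_mem_nhdsWithin, hsmall] with t ht ht1 u hu
  have hsum : ∑ i : Fin n, l i.castSucc * f i.castSucc u ≤ 0 := by
    refine Finset.sum_nonpos fun i _ => mul_nonpos_of_nonneg_of_nonpos (hl _) ?_
    by_cases hi : i ∈ J
    · simpa [f, hi] using hu i hi
    · simp [f, hi]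
  have hwu := h u
  rw [Fin.sum_univ_castSucc] at hwu
  have hlast : f (Fin.last n) u = -⟪z, u⟫ := by simp [f]
  rw [hlast, innerₗ_apply_apply] at hwu
  rw [inner_add_left, real_inner_smul_left, hwu]
  have h1 := mul_nonpos_of_nonneg_of_nonpos (le_of_lt ht) hsum
  have h2 := mul_nonpos_of_nonneg_of_nonpos (sub_nonneg.mpr ht1.le) (hz u hu)
  linarith

/-- A relative interior point of an additively closed part `F` of a polyhedral cone. -/
lemma exists_relint {F : Set E} (hF : F ⊆ polyCone a J) (h0 : (0 : E) ∈ F)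
    (hadd : ∀ x ∈ F, ∀ y ∈ F, x + y ∈ F) :
    ∃ r ∈ F, ∀ i ∈ J, ⟪a i, r⟫ = 0 → ∀ w ∈ F, ⟪a i, w⟫ = 0 := by
  classical
  suffices h : ∀ s : Finset (Fin n), ∃ r ∈ F, ∀ i ∈ s, i ∈ J → ⟪a i, r⟫ = 0 →
      ∀ w ∈ F, ⟪a i, w⟫ = 0 by
    obtain ⟨r, hr, h⟩ := h Finset.univ
    exact ⟨r, hr, fun i hi => h i (Finset.mem_univ i) hi⟩
  intro s
  induction s using Finset.induction_on with
  | empty => exact ⟨0, h0, by simp⟩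
  | insert j s _ ih =>
    obtain ⟨r, hr, h⟩ := ih
    by_cases hj : ∀ w ∈ F, ⟪a j, w⟫ = 0
    · refine ⟨r, hr, fun i hi hiJ hir => ?_⟩
      rcases Finset.mem_insert.mp hi with rfl | hi
      · exact hj
      · exact h i hi hiJ hir
    · push Not at hj
      obtain ⟨w, hw, hjw⟩ := hj
      refine ⟨r + w, hadd r hr w hw, fun i hi hiJ hir => ?_⟩
      have h1 := hF hr i hiJ
      have h2 := hF hw i hiJ
      rw [inner_add_right] at hir
      rcases Finset.mem_insert.mp hi with rfl | hi
      · exact absurd (by linarith) hjw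
      · exact h i hi hiJ (by linarith)

/-- A face of a polyhedral cone is determined by the inequalities vanishing on it. -/
lemma mem_face_of_vanishing {z w : E} (hz : z ∈ pol (polyCone a J)) (hw : w ∈ polyCone a J)
    (h : ∀ i ∈ J, (∀ u ∈ polyCone a J ∩ {u | ⟪z, u⟫ = 0}, ⟪a i, u⟫ = 0) → ⟪a i, w⟫ = 0) :
    ⟪z, w⟫ = 0 := by
  obtain ⟨r, hr, hr'⟩ := exists_relint (F := polyCone a J ∩ {u | ⟪z, u⟫ = 0})
    inter_subset_left ⟨fun i _ => by simp, by simp⟩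
    (fun x hx y hy => ⟨fun i hi => by
      rw [inner_add_right]; exact add_nonpos (hx.1 i hi) (hy.1 i hi), by
      have h1 : ⟪z, x⟫ = 0 := hx.2
      have h2 : ⟪z, y⟫ = 0 := hy.2
      show ⟪z, x + y⟫ = 0
      rw [inner_add_right, h1, h2, add_zero]⟩)
  obtain ⟨t, ht, h0⟩ := ((eventually_mem_polyCone (w := -w) hr.1 fun i hi hir => by
    rw [inner_neg_right, h i hi (hr' i hi hir), neg_zero]).and self_mem_nhdsWithin).exists
  have h0 : 0 < t := h0
  have hrz : ⟪z, r⟫ = 0 := hr.2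
  have h1 := hz _ ht
  rw [inner_add_right, real_inner_smul_right, inner_neg_right, hrz] at h1
  have h2 : 0 ≤ ⟪z, w⟫ := nonneg_of_mul_nonneg_right (a := t) (by linarith) h0
  exact le_antisymm (hz w hw) h2

lemma face_eq_of_vanishing_eq {z z' : E} (hz : z ∈ pol (polyCone a J))
    (hz' : z' ∈ pol (polyCone a J))
    (h : {i | ∀ u ∈ polyCone a J ∩ {u | ⟪z, u⟫ = 0}, ⟪a i, u⟫ = 0} =
      {i | ∀ u ∈ polyCone a J ∩ {u | ⟪z', u⟫ = 0}, ⟪a i, u⟫ = 0}) :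
    polyCone a J ∩ {u | ⟪z, u⟫ = 0} = polyCone a J ∩ {u | ⟪z', u⟫ = 0} := by
  ext w
  constructor
  · exact fun hw => ⟨hw.1, mem_face_of_vanishing hz' hw.1 fun i _ hi =>
      (h.symm.subset hi : _ ∈ {i | _}) w hw⟩
  · exact fun hw => ⟨hw.1, mem_face_of_vanishing hz hw.1 fun i _ hi =>
      (h.subset hi : _ ∈ {i | _}) w hw⟩

/-- A sequence of points of the graph with constant active set `J` and constant critical cone `G`
approaching `(yb, ybs)` in direction `(v, vs)` exhibits `G` as a difference of faces. -/
lemma exists_faces_of_seq {yb ybs v vs : E} {t : ℕ → ℝ} {V VS : ℕ → E} {G : Set E}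
    (hybs : ybs ∈ pol (polyCone a (activeSet a c yb)))
    (hv : v ∈ polyCone a (activeSet a c yb) ∩ {u | ⟪ybs, u⟫ = 0})
    (hJ : J ⊆ activeSet a c yb) (hJv : ∀ i ∈ J, ⟪a i, v⟫ = 0)
    (ht : ∀ k, 0 < t k) (ht0 : Tendsto t atTop (𝓝 0)) (hVS : Tendsto VS atTop (𝓝 vs))
    (hmem : ∀ k, yb + t k • V k ∈ polyhedron a c)
    (hact : ∀ k, activeSet a c (yb + t k • V k) = J)
    (hpol : ∀ k, ybs + t k • VS k ∈ pol (polyCone a J))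
    (hG : ∀ k, polyCone a J ∩ {u | ⟪ybs + t k • VS k, u⟫ = 0} = G) :
    ∃ F₁ F₂ : Set E,
      IsFaceOf (polyCone a (activeSet a c yb) ∩ {w | ⟪ybs, w⟫ = 0}) F₁ ∧
      IsFaceOf (polyCone a (activeSet a c yb) ∩ {w | ⟪ybs, w⟫ = 0}) F₂ ∧
      v ∈ F₂ ∧ F₂ ⊆ F₁ ∧ F₁ ⊆ {w | ⟪vs, w⟫ = 0} ∧ G = F₁ - F₂ := by
  classical
  set I := activeSet a c yb with hI
  set K := polyCone a I ∩ {w | ⟪ybs, w⟫ = 0} with hK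
  have hys : Tendsto (fun k => ybs + t k • VS k) atTop (𝓝 ybs) := by
    simpa using (tendsto_const_nhds (x := ybs)).add (ht0.smul hVS)
  have hybsJ : ybs ∈ pol (polyCone a J) :=
    (isClosed_pol _).mem_of_tendsto hys (Eventually.of_forall hpol)
  have hGk : ∀ w ∈ G, ∀ k, ⟪ybs + t k • VS k, w⟫ = 0 := fun w hw k => by
    rw [← hG k] at hw; exact hw.2
  have hGJ : G ⊆ polyCone a J := by rw [← hG 0]; exact inter_subset_left
  have hGybs : ∀ w ∈ G, ⟪ybs, w⟫ = 0 := fun w hw =>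
    tendsto_nhds_unique (hys.inner tendsto_const_nhds) (by simp only [hGk w hw]; simp)
  have hGvs : ∀ w ∈ G, ⟪vs, w⟫ = 0 := fun w hw => by
    have : ∀ k, ⟪VS k, w⟫ = 0 := fun k => by
      have h1 := hGk w hw k
      rw [inner_add_left, real_inner_smul_left, hGybs w hw, zero_add] at h1
      exact (mul_eq_zero.mp h1).resolve_left (ht k).ne'
    exact tendsto_nhds_unique (hVS.inner tendsto_const_nhds) (by simp only [this]; simp)
  have hs : (∑ i ∈ Finset.univ.filter (· ∈ J), a i) ∈ pol K := fun w hw => by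
    rw [sum_inner]
    exact Finset.sum_nonpos fun i hi => hw.1 i (hJ (Finset.mem_filter.mp hi).2)
  have hsum : ∀ w ∈ polyCone a I, ⟪∑ i ∈ Finset.univ.filter (· ∈ J), a i, w⟫ = 0 ↔
      ∀ i ∈ J, ⟪a i, w⟫ = 0 := fun w hw => by
    rw [sum_inner, Finset.sum_eq_zero_iff_of_nonpos fun i hi => hw i (hJ (Finset.mem_filter.mp hi).2)]
    simp
  have hF₂G : ∀ w, (∀ i ∈ J, ⟪a i, w⟫ = 0) → ∀ k, ⟪ybs + t k • VS k, w⟫ = 0 := fun w hw k => by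
    have h1 := hpol k w fun i hi => (hw i hi).le
    have h2 := hpol k (-w) fun i hi => by rw [inner_neg_right, hw i hi, neg_zero]
    rw [inner_neg_right] at h2
    linarith
  have hV : ∀ i ∈ I, ⟪a i, V 0⟫ ≤ 0 ∧ (⟪a i, V 0⟫ = 0 ↔ i ∈ J) := fun i hi => by
    have hi : ⟪a i, yb⟫ = c i := hi
    have h1 := hmem 0 i
    rw [← hact 0]
    simp only [activeSet, mem_ofPred_eq]
    rw [inner_add_right, real_inner_smul_right, hi] at h1 ⊢
    refine ⟨nonpos_of_mul_nonpos_right (by linarith) (ht 0), fun h => by rw [h]; ring, fun h => ?_⟩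
    exact (mul_eq_zero.mp (by linarith : t 0 * ⟪a i, V 0⟫ = 0)).resolve_left (ht 0).ne'
  have hVI : V 0 ∈ polyCone a I := fun i hi => (hV i hi).1
  have hVJ : ∀ i ∈ J, ⟪a i, V 0⟫ = 0 := fun i hi => (hV i (hJ hi)).2.mpr hi
  have hVybs : ⟪ybs, V 0⟫ = 0 := by
    have h2 := hybsJ (-V 0) fun i hi => by rw [inner_neg_right, hVJ i hi, neg_zero]
    rw [inner_neg_right] at h2
    linarith [hybs _ hVI]
  have hKJ : K ⊆ polyCone a J := fun w hw => polyCone_anti hJ hw.1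
  have hF₁G : K ∩ {w | ⟪ybs + t 0 • VS 0, w⟫ = 0} ⊆ G := fun w hw => by
    rw [← hG 0]; exact ⟨hKJ hw.1, hw.2⟩
  refine ⟨K ∩ {w | ⟪ybs + t 0 • VS 0, w⟫ = 0},
    K ∩ {w | ⟪∑ i ∈ Finset.univ.filter (· ∈ J), a i, w⟫ = 0},
    ⟨_, pol_anti hKJ (hpol 0), rfl⟩, ⟨_, hs, rfl⟩, ⟨hv, (hsum v hv.1).mpr hJv⟩,
    fun w hw => ⟨hw.1, hF₂G w ((hsum w hw.1.1).mp hw.2) 0⟩,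
    fun w hw => hGvs w (hF₁G hw), Subset.antisymm (fun w hw => ?_) ?_⟩
  · obtain ⟨N, hN, hNI⟩ := exists_add_smul_mem_polyCone hVI fun i hi h0 =>
      hGJ hw i ((hV i hi).2.mp h0)
    have hNV : N • V 0 ∈ K ∩ {w | ⟪∑ i ∈ Finset.univ.filter (· ∈ J), a i, w⟫ = 0} := by
      have hI' : N • V 0 ∈ polyCone a I := fun i hi => by
        rw [real_inner_smul_right]
        exact mul_nonpos_of_nonneg_of_nonpos hN.le (hVI i hi)
      refine ⟨⟨hI', ?_⟩, (hsum _ hI').mpr fun i hi => ?_⟩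
      · show ⟪ybs, N • V 0⟫ = 0
        rw [real_inner_smul_right, hVybs, mul_zero]
      · rw [real_inner_smul_right, hVJ i hi, mul_zero]
    refine Set.mem_sub.mpr ⟨w + N • V 0, ⟨⟨hNI, ?_⟩, ?_⟩, N • V 0, hNV, by simp⟩
    · show ⟪ybs, w + N • V 0⟫ = 0
      rw [inner_add_right, hGybs w hw, real_inner_smul_right, hVybs, mul_zero, add_zero]
    · show ⟪ybs + t 0 • VS 0, w + N • V 0⟫ = 0
      rw [inner_add_right, hGk w hw 0, real_inner_smul_right, hF₂G _ hVJ 0, mul_zero, add_zero]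
  · rintro _ ⟨w₁, hw₁, w₂, hw₂, rfl⟩
    have hJ₂ := (hsum w₂ hw₂.1.1).mp hw₂.2
    rw [← hG 0]
    refine ⟨fun i hi => ?_, ?_⟩
    · show ⟪a i, w₁ - w₂⟫ ≤ 0
      rw [inner_sub_right, hJ₂ i hi, sub_zero]
      exact hw₁.1.1 i (hJ hi)
    · show ⟪ybs + t 0 • VS 0, w₁ - w₂⟫ = 0
      rw [inner_sub_right, hF₂G _ hJ₂ 0, (show ⟪ybs + t 0 • VS 0, w₁⟫ = 0 from hw₁.2), sub_zero]

lemma exists_faces_of_mem_dnc2 {yb ybs v vs : E} {p : E × E}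
    (hbar : ybs ∈ Nmap (polyhedron a c) yb)
    (hv : v ∈ polyCone a (activeSet a c yb) ∩ {u | ⟪ybs, u⟫ = 0})
    (hp : p ∈ dnc2 (gph (Nmap (polyhedron a c))) (yb, ybs) (v, vs)) :
    ∃ F₁ F₂ : Set E,
      IsFaceOf (polyCone a (activeSet a c yb) ∩ {w | ⟪ybs, w⟫ = 0}) F₁ ∧
      IsFaceOf (polyCone a (activeSet a c yb) ∩ {w | ⟪ybs, w⟫ = 0}) F₂ ∧
      v ∈ F₂ ∧ F₂ ⊆ F₁ ∧ F₁ ⊆ {w | ⟪vs, w⟫ = 0} ∧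
      p.1 ∈ pol (F₁ - F₂) ∧ p.2 ∈ F₁ - F₂ := by
  obtain ⟨t, W, P, ht, ht0, hW, hP, h⟩ := hp
  have hW1 : Tendsto (fun k => (W k).1) atTop (𝓝 v) := (continuous_fst.tendsto _).comp hW
  have hW2 : Tendsto (fun k => (W k).2) atTop (𝓝 vs) := (continuous_snd.tendsto _).comp hW
  have hN : ∀ k, ybs + t k • (W k).2 ∈ Nmap (polyhedron a c) (yb + t k • (W k).1) :=
    fun k => (h k).1
  have hN' := fun k => mem_Nmap_polyhedron.mp (hN k)
  have hy : Tendsto (fun k => yb + t k • (W k).1) atTop (𝓝 yb) := by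
    simpa using (tendsto_const_nhds (x := yb)).add (ht0.smul hW1)
  have hev : ∀ᶠ k in atTop, ∀ i, i ∈ activeSet a c (yb + t k • (W k).1) →
      i ∈ activeSet a c yb ∧ ⟪a i, v⟫ = 0 := by
    refine eventually_all.mpr fun i => ?_
    by_cases hi : i ∈ activeSet a c yb
    · have hi' : ⟪a i, yb⟫ = c i := hi
      rcases (hv.1 i hi).lt_or_eq with hlt | heq
      · have hlim : Tendsto (fun k => ⟪a i, (W k).1⟫) atTop (𝓝 ⟪a i, v⟫) :=
          tendsto_const_nhds.inner hW1
        filter_upwards [hlim.eventually_lt_const hlt] with k hk hik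
        have hik : ⟪a i, yb + t k • (W k).1⟫ = c i := hik
        rw [inner_add_right, real_inner_smul_right, hi'] at hik
        exact absurd (mul_neg_of_pos_of_neg (ht k) hk) (by linarith)
      · exact Eventually.of_forall fun k _ => ⟨hi, heq⟩
    · have hlim : Tendsto (fun k => ⟪a i, yb + t k • (W k).1⟫) atTop (𝓝 ⟪a i, yb⟫) :=
        tendsto_const_nhds.inner hy
      filter_upwards [hlim.eventually_lt_const (lt_of_le_of_ne (hbar.1 i) hi)] with k hk hik
      exact absurd hik hk.ne
  let code : ℕ → Set (Fin n) × Set (Fin n) := fun k =>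
    (activeSet a c (yb + t k • (W k).1),
      {i | ∀ u ∈ polyCone a (activeSet a c (yb + t k • (W k).1)) ∩
        {u | ⟪ybs + t k • (W k).2, u⟫ = 0}, ⟪a i, u⟫ = 0})
  obtain ⟨⟨J, L⟩, hJL⟩ : ∃ x, ∃ᶠ k in atTop, code k = x := by
    by_contra! hcon
    have : ∀ᶠ k in atTop, ∀ x, code k ≠ x :=
      eventually_all.mpr fun x => hcon x
    obtain ⟨k, hk⟩ := this.exists
    exact hk _ rfl
  obtain ⟨φ, hφ, hcode⟩ := extraction_of_frequently_atTop (hJL.and_eventually hev)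
  have hact : ∀ k, activeSet a c (yb + t (φ k) • (W (φ k)).1) = J :=
    fun k => (Prod.mk.inj (hcode k).1).1
  have hvan : ∀ k, {i | ∀ u ∈ polyCone a J ∩ {u | ⟪ybs + t (φ k) • (W (φ k)).2, u⟫ = 0},
      ⟪a i, u⟫ = 0} = L := fun k => by
    rw [← hact k]; exact (Prod.mk.inj (hcode k).1).2
  have hpol : ∀ k, ybs + t (φ k) • (W (φ k)).2 ∈ pol (polyCone a J) := fun k => by
    rw [← hact k]; exact (hN' (φ k)).2
  have hG : ∀ k, polyCone a J ∩ {u | ⟪ybs + t (φ k) • (W (φ k)).2, u⟫ = 0} =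
      polyCone a J ∩ {u | ⟪ybs + t (φ 0) • (W (φ 0)).2, u⟫ = 0} := fun k =>
    face_eq_of_vanishing_eq (hpol k) (hpol 0) ((hvan k).trans (hvan 0).symm)
  have hJ : ∀ i ∈ J, i ∈ activeSet a c yb ∧ ⟪a i, v⟫ = 0 := fun i hi =>
    (hcode 0).2 i (by rw [hact 0]; exact hi)
  obtain ⟨F₁, F₂, hF₁, hF₂, hvF, hFF, hFv, hGF⟩ := exists_faces_of_seq (t := t ∘ φ)
    (V := fun k => (W (φ k)).1) (VS := fun k => (W (φ k)).2)
    (mem_Nmap_polyhedron.mp hbar).2 hv (fun i hi => (hJ i hi).1) (fun i hi => (hJ i hi).2)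
    (fun k => ht _) (ht0.comp hφ.tendsto_atTop) (hW2.comp hφ.tendsto_atTop)
    (fun k => (hN _).1) hact hpol hG
  refine ⟨F₁, F₂, hF₁, hF₂, hvF, hFF, hFv, ?_⟩
  rw [← hGF]
  have hPφ : Tendsto (fun k => P (φ k)) atTop (𝓝 p) := hP.comp hφ.tendsto_atTop
  have hPk : ∀ k, (P (φ k)).1 ∈ pol (polyCone a J ∩
        {u | ⟪ybs + t (φ 0) • (W (φ 0)).2, u⟫ = 0}) ∧
      (P (φ k)).2 ∈ polyCone a J ∩ {u | ⟪ybs + t (φ 0) • (W (φ 0)).2, u⟫ = 0} := fun k => by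
    have := (mem_rnc2_gph_Nmap (hN (φ k)) _).mp (h (φ k))
    rwa [hact k, hG k] at this
  exact ⟨(isClosed_pol _).mem_of_tendsto ((continuous_fst.tendsto _).comp hPφ)
      (Eventually.of_forall fun k => (hPk k).1),
    (isClosed_polyCone.inter (isClosed_orthogonal _)).mem_of_tendsto
      ((continuous_snd.tendsto _).comp hPφ) (Eventually.of_forall fun k => (hPk k).2)⟩

/-- For a direction `d` in the relative interior of the face `F₂` and a functional `e` exposing
the face `F₁`, the pairs in `pol (F₁ - F₂) × (F₁ - F₂)` are regular normals at the points
`(yb, ybs) + t (d, e)` for small `t > 0`. -/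
lemma eventually_mem_rnc2 {yb ybs d e : E} {p : E × E} {F₁ F₂ : Set E}
    (hbar : ybs ∈ Nmap (polyhedron a c) yb)
    (he : e ∈ pol (polyCone a (activeSet a c yb) ∩ {w | ⟪ybs, w⟫ = 0}))
    (hF₁ : F₁ = polyCone a (activeSet a c yb) ∩ {w | ⟪ybs, w⟫ = 0} ∩ {w | ⟪e, w⟫ = 0})
    (hF : F₂ ⊆ F₁) (hsmul : ∀ N : ℝ, 0 < N → ∀ x ∈ F₂, N • x ∈ F₂) (hd : d ∈ F₂)
    (hrel : ∀ i ∈ activeSet a c yb, ⟪a i, d⟫ = 0 → ∀ w ∈ F₂, ⟪a i, w⟫ = 0)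
    (hp : p.1 ∈ pol (F₁ - F₂) ∧ p.2 ∈ F₁ - F₂) :
    ∀ᶠ t : ℝ in 𝓝[>] 0, p ∈ rnc2 (gph (Nmap (polyhedron a c))) ((yb, ybs) + t • (d, e)) := by
  have hbar' := mem_Nmap_polyhedron.mp hbar
  have horth : ∀ w ∈ F₁, w ∈ polyCone a (activeSet a c yb) ∧ ⟪ybs, w⟫ = 0 ∧ ⟪e, w⟫ = 0 :=
    fun w hw => by
      rw [hF₁] at hw
      exact ⟨hw.1.1, hw.1.2, hw.2⟩
  obtain ⟨hdI, hdybs, hde⟩ := horth d (hF hd)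
  have hdbl : ∀ᶠ t : ℝ in 𝓝[>] 0, ybs + t • ((2 : ℝ) • e) ∈
      pol (polyCone a (activeSet a c yb)) :=
    eventually_add_smul_mem_pol hbar'.2 fun w hw => by
      rw [real_inner_smul_left]
      linarith [he w hw]
  filter_upwards [self_mem_nhdsWithin, eventually_mem_polyhedron hbar.1 hdI,
    eventually_activeSet_subset (a := a) (c := c) yb d,
    eventually_add_smul_mem_pol hbar'.2 he, hdbl] with t ht hmem hact hpol hpol2
  have ht : 0 < t := ht
  have hN : ybs + t • e ∈ Nmap (polyhedron a c) (yb + t • d) := by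
    refine ⟨hmem, fun z hz => ?_⟩
    have h1 := (mem_Nmap_polyhedron.mpr ⟨hbar.1, hpol⟩).2 z hz
    rw [← sub_sub, inner_sub_right, real_inner_smul_right, inner_add_left _ _ d,
      real_inner_smul_left, hdybs, hde]
    linarith
  have hiff : ∀ i ∈ activeSet a c yb, (i ∈ activeSet a c (yb + t • d) ↔ ⟪a i, d⟫ = 0) :=
    fun i hi => by
      have hi : ⟪a i, yb⟫ = c i := hi
      simp only [activeSet, mem_ofPred_eq]
      rw [inner_add_right, real_inner_smul_right, hi]
      simp [ht.ne']
  show p ∈ rnc2 (gph (Nmap (polyhedron a c))) (yb + t • d, ybs + t • e)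
  rw [mem_rnc2_gph_Nmap hN]
  refine ⟨fun u hu => hp.1 u ?_, ?_⟩
  · obtain ⟨N, hN0, hNI⟩ := exists_add_smul_mem_polyCone hdI fun i hi h0 =>
      hu.1 i ((hiff i hi).mpr h0)
    have hu2 : ⟪ybs + t • e, u + N • d⟫ = 0 := by
      rw [inner_add_right, (show ⟪ybs + t • e, u⟫ = 0 from hu.2), real_inner_smul_right,
        inner_add_left, real_inner_smul_left, hdybs, hde]
      ring
    have h1 := hbar'.2 _ hNI
    have h2 := hpol2 _ hNI
    rw [inner_add_left, real_inner_smul_left] at hu2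
    rw [inner_add_left, real_inner_smul_left, real_inner_smul_left] at h2
    have h3 : ⟪ybs, u + N • d⟫ = 0 := by linarith
    rw [h3, zero_add] at hu2
    have h4 : ⟪e, u + N • d⟫ = 0 := (mul_eq_zero.mp hu2).resolve_left ht.ne'
    exact Set.mem_sub.mpr ⟨u + N • d, by rw [hF₁]; exact ⟨⟨hNI, h3⟩, h4⟩, N • d,
      hsmul N hN0 d hd, by simp⟩
  · obtain ⟨w₁, hw₁, w₂, hw₂, hw⟩ := Set.mem_sub.mp hp.2
    obtain ⟨h1, h2, h3⟩ := horth w₁ hw₁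
    obtain ⟨h1', h2', h3'⟩ := horth w₂ (hF hw₂)
    rw [← hw]
    refine ⟨fun i hi => ?_, ?_⟩
    · have hi' := hact hbar.1 hi
      rw [inner_sub_right, hrel i hi' ((hiff i hi').mp hi) w₂ hw₂, sub_zero]
      exact h1 i hi'
    · show ⟪ybs + t • e, w₁ - w₂⟫ = 0
      rw [inner_sub_right, inner_add_left, inner_add_left, real_inner_smul_left,
        real_inner_smul_left, h2, h3, h2', h3']
      ring

lemma mem_dnc2_of_faces {yb ybs v vs : E} {p : E × E} {F₁ F₂ : Set E}
    (hbar : ybs ∈ Nmap (polyhedron a c) yb)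
    (hvs : vs ∈ pol (polyCone a (activeSet a c yb) ∩ {w | ⟪ybs, w⟫ = 0}))
    (hF₁ : IsFaceOf (polyCone a (activeSet a c yb) ∩ {w | ⟪ybs, w⟫ = 0}) F₁)
    (hF₂ : IsFaceOf (polyCone a (activeSet a c yb) ∩ {w | ⟪ybs, w⟫ = 0}) F₂)
    (hv : v ∈ F₂) (hF : F₂ ⊆ F₁) (hFvs : F₁ ⊆ {w | ⟪vs, w⟫ = 0})
    (hp : p.1 ∈ pol (F₁ - F₂) ∧ p.2 ∈ F₁ - F₂) :
    p ∈ dnc2 (gph (Nmap (polyhedron a c))) (yb, ybs) (v, vs) := by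
  obtain ⟨z₁, hz₁, rfl⟩ := hF₁
  obtain ⟨z₂, hz₂, hF₂⟩ := hF₂
  have hF₂mem : ∀ x, x ∈ F₂ ↔ (∀ i ∈ activeSet a c yb, ⟪a i, x⟫ ≤ 0) ∧ ⟪ybs, x⟫ = 0 ∧
      ⟪z₂, x⟫ = 0 := fun x => by
    rw [hF₂, ← and_assoc]; rfl
  have hsmul : ∀ N : ℝ, 0 < N → ∀ x ∈ F₂, N • x ∈ F₂ := fun N hN x hx => by
    rw [hF₂mem] at hx ⊢
    simp only [real_inner_smul_right, hx.2.1, hx.2.2, mul_zero, and_self, and_true]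
    exact fun i hi => mul_nonpos_of_nonneg_of_nonpos hN.le (hx.1 i hi)
  have hadd : ∀ x ∈ F₂, ∀ y ∈ F₂, x + y ∈ F₂ := fun x hx y hy => by
    rw [hF₂mem] at hx hy ⊢
    simp only [inner_add_right, hx.2.1, hx.2.2, hy.2.1, hy.2.2, add_zero, and_self, and_true]
    exact fun i hi => add_nonpos (hx.1 i hi) (hy.1 i hi)
  obtain ⟨r, hr, hrel⟩ := exists_relint (a := a) (J := activeSet a c yb) (F := F₂)
    (fun x hx => ((hF₂mem x).mp hx).1) ((hF₂mem 0).mpr (by simp)) hadd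
  have hstep : ∀ k : ℕ, ∃ t : ℝ, 0 < t ∧ t < 1 / ((k : ℝ) + 1) ∧
      p ∈ rnc2 (gph (Nmap (polyhedron a c))) ((yb, ybs) + t •
        (v + (1 / ((k : ℝ) + 1)) • r, vs + (1 / ((k : ℝ) + 1)) • z₁)) := fun k => by
    have hε : 0 < 1 / ((k : ℝ) + 1) := by positivity
    set ε := 1 / ((k : ℝ) + 1)
    have hrnc := eventually_mem_rnc2 (d := v + ε • r) (e := vs + ε • z₁) hbar
      (fun w hw => by
        rw [inner_add_left, real_inner_smul_left]
        exact add_nonpos (hvs w hw) (mul_nonpos_of_nonneg_of_nonpos hε.le (hz₁ w hw)))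
      (F₁ := polyCone a (activeSet a c yb) ∩ {w | ⟪ybs, w⟫ = 0} ∩ {w | ⟪z₁, w⟫ = 0})
      (Set.ext fun w => and_congr_right fun hw => by
        simp only [mem_ofPred_eq, inner_add_left, real_inner_smul_left]
        refine ⟨fun h => ?_, fun h => ?_⟩
        · rw [(show ⟪vs, w⟫ = 0 from hFvs ⟨hw, h⟩), h]
          ring
        · have h1 := hvs w hw
          have h2 := mul_nonpos_of_nonneg_of_nonpos hε.le (hz₁ w hw)
          exact (mul_eq_zero.mp (by linarith : ε * ⟪z₁, w⟫ = 0)).resolve_left hε.ne')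
      hF hsmul (hadd v hv _ (hsmul ε hε r hr))
      (fun i hi h0 => hrel i hi (by
        rw [inner_add_right, real_inner_smul_right] at h0
        have h1 := ((hF₂mem v).mp hv).1 i hi
        have h2 := mul_nonpos_of_nonneg_of_nonpos hε.le (((hF₂mem r).mp hr).1 i hi)
        exact (mul_eq_zero.mp (by linarith : ε * ⟪a i, r⟫ = 0)).resolve_left hε.ne')) hp
    obtain ⟨t, h1, h2⟩ := (hrnc.and (Ioo_mem_nhdsGT hε)).exists
    exact ⟨t, h2.1, h2.2, h1⟩
  choose t ht ht1 h using hstep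
  have hε0 : Tendsto (fun k : ℕ => 1 / ((k : ℝ) + 1)) atTop (𝓝 0) :=
    tendsto_one_div_add_atTop_nhds_zero_nat
  refine ⟨t, _, fun _ => p, ht, squeeze_zero (fun k => (ht k).le) (fun k => (ht1 k).le) hε0,
    ?_, tendsto_const_nhds, h⟩
  refine Tendsto.prodMk_nhds ?_ ?_
  · simpa using (tendsto_const_nhds (x := v)).add (hε0.smul_const r)
  · simpa using (tendsto_const_nhds (x := vs)).add (hε0.smul_const z₁)

end PolyhedralCones

/-- Description of the directional limiting normal cone to the graph of the normal-cone
map of a convex polyhedron via faces of the critical cone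
(Theorem `ThPolyDirLimNormCone`). -/
theorem stmt12 {m : ℕ} (Γ : Set (Es m)) (hΓ : IsPolyhedron Γ)
    (yb ybs v vs : Es m) (hbar : ybs ∈ Nmap Γ yb)
    (htan : (v, vs) ∈ tcone (gph (Nmap Γ)) (yb, ybs)) :
    dnc2 (gph (Nmap Γ)) (yb, ybs) (v, vs) =
      {p : Es m × Es m | ∃ F₁ F₂ : Set (Es m),
        IsFaceOf (tcone Γ yb ∩ {w | ⟪ybs, w⟫ = 0}) F₁ ∧
        IsFaceOf (tcone Γ yb ∩ {w | ⟪ybs, w⟫ = 0}) F₂ ∧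
        v ∈ F₂ ∧ F₂ ⊆ F₁ ∧ F₁ ⊆ {w | ⟪vs, w⟫ = 0} ∧
        p.1 ∈ pol (F₁ - F₂) ∧ p.2 ∈ F₁ - F₂} := by
  obtain ⟨n, f, c, hf⟩ := hΓ
  obtain rfl : Γ = polyhedron (fun i => (InnerProductSpace.toDual ℝ (Es m)).symm (f i)) c := by
    rw [hf]
    ext z
    simp [polyhedron]
  obtain ⟨hv, hvs⟩ := tcone_gph_Nmap_subset hbar htan
  rw [tcone_polyhedron hbar.1]
  ext p
  constructor
  · exact exists_faces_of_mem_dnc2 hbar hv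
  · rintro ⟨F₁, F₂, hF₁, hF₂, hvF, hF, hFvs, hp⟩
    exact mem_dnc2_of_faces hbar hvs hF₁ hF₂ hvF hF hFvs hp
end
end

section
/- Let Γ be a convex polyhedral set in ℝᵐ and (ȳ, ȳ*) ∈ gph N_Γ. Then there exists ρ > 0 such that for every (y, y*) ∈ gph N_Γ with ‖(y,y*) − (ȳ,ȳ*)‖ ≤ ρ one has K_Γ(y, y*) = (K_Γ(ȳ, ȳ*) ∩ [y* − ȳ*]⊥) + [y − ȳ]. -/
open Filter Topology Metric Set
open scoped RealInnerProductSpace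

noncomputable section

open Pointwise

/-- The line `ℝ w` spanned by a vector `w`. -/
def lineSpan {E : Type*} [AddCommGroup E] [Module ℝ E] (w : E) : Set E :=
  {z | ∃ α : ℝ, z = α • w}

/-- Finitely many affine inequalities that hold at `0`, with nonpositive slope where they are
tight, persist for small positive arguments. -/
lemma eventually_forall_add_mul_le {ι : Type*} [Finite ι] {a b c : ι → ℝ}
    (hac : ∀ i, a i ≤ c i) (hb : ∀ i, a i = c i → b i ≤ 0) :
    ∀ᶠ t : ℝ in 𝓝[>] 0, ∀ i, a i + t * b i ≤ c i := by
  refine eventually_all.2 fun i => ?_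
  rcases (hac i).eq_or_lt with h | h
  · filter_upwards [self_mem_nhdsWithin] with t (ht : 0 < t)
    have := mul_nonpos_of_nonneg_of_nonpos ht.le (hb i h)
    linarith
  · have hc : Tendsto (fun t : ℝ => a i + t * b i) (𝓝 0) (𝓝 (a i + 0 * b i)) :=
      Continuous.tendsto (by fun_prop) 0
    rw [zero_mul, add_zero] at hc
    exact (hc.mono_left nhdsWithin_le_nhds).eventually_le_const h

section Polyhedron

variable {ι : Type*} [Finite ι]

lemma eventually_add_smul_mem_polyhedron {E : Type*} [NormedAddCommGroup E] [NormedSpace ℝ E]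
    {f : ι → (E →L[ℝ] ℝ)} {c : ι → ℝ} {y w : E} (hy : ∀ i, f i y ≤ c i)
    (hw : ∀ i, f i y = c i → f i w ≤ 0) :
    ∀ᶠ t : ℝ in 𝓝[>] 0, y + t • w ∈ {z | ∀ i, f i z ≤ c i} := by
  filter_upwards [eventually_forall_add_mul_le hy hw] with t ht
  simpa using ht

/-- The tangent cone to a polyhedron is cut out by the linear parts of the active constraints. -/
lemma mem_tcone_polyhedron_iff {E : Type*} [NormedAddCommGroup E] [NormedSpace ℝ E]
    {f : ι → (E →L[ℝ] ℝ)} {c : ι → ℝ} {y w : E} (hy : ∀ i, f i y ≤ c i) :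
    w ∈ tcone {z | ∀ i, f i z ≤ c i} y ↔ ∀ i, f i y = c i → f i w ≤ 0 := by
  constructor
  · rintro ⟨t, w', ht, -, hw', hmem⟩ i hi
    refine le_of_tendsto (((f i).continuous.tendsto w).comp hw') (Eventually.of_forall fun k => ?_)
    have h := hmem k i
    rw [map_add, map_smul, smul_eq_mul, hi] at h
    exact nonpos_of_mul_nonpos_right (add_le_iff_nonpos_right (c i) |>.1 h) (ht k)
  · intro hw
    obtain ⟨t, ht, hmem⟩ :=
      (frequently_iff_seq_forall (l := 𝓝[>] (0 : ℝ))).1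
        ((eventually_add_smul_mem_polyhedron hy hw).and self_mem_nhdsWithin).frequently
    exact ⟨t, fun _ => w, fun k => (hmem k).2, tendsto_nhds_of_tendsto_nhdsWithin ht,
      tendsto_const_nhds, fun k => (hmem k).1⟩

variable {E : Type*} [NormedAddCommGroup E] [InnerProductSpace ℝ E]

lemma inner_nonpos_of_mem_Nmap_polyhedron {f : ι → (E →L[ℝ] ℝ)} {c : ι → ℝ} {y ys w : E}
    (hys : ys ∈ Nmap {z | ∀ i, f i z ≤ c i} y) (hw : ∀ i, f i y = c i → f i w ≤ 0) :
    ⟪ys, w⟫ ≤ 0 := by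
  obtain ⟨t, hmem, ht⟩ :=
    ((eventually_add_smul_mem_polyhedron hys.1 hw).and self_mem_nhdsWithin).exists
  have h := hys.2 _ hmem
  rw [add_sub_cancel_left, real_inner_smul_right] at h
  exact nonpos_of_mul_nonpos_right h ht

/-- Near a given functional, every functional in the polar of a polyhedral cone exposes a face
of the cone contained in the face exposed by the given one. -/
lemma eventually_inner_eq_zero_of_polar (f : ι → (E →L[ℝ] ℝ)) {ybs : E}
    (hybs : ∀ w, (∀ i, f i w ≤ 0) → ⟪ybs, w⟫ ≤ 0) :
    ∀ᶠ ys in 𝓝 ybs, (∀ w, (∀ i, f i w ≤ 0) → ⟪ys, w⟫ ≤ 0) →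
      ∀ w, (∀ i, f i w ≤ 0) → ⟪ys, w⟫ = 0 → ⟪ybs, w⟫ = 0 := by
  have key : ∀ J : Set ι, ∀ᶠ ys in 𝓝 ybs, (∀ w, (∀ i, f i w ≤ 0) → ⟪ys, w⟫ ≤ 0) →
      ∀ w, (∀ i, f i w ≤ 0) → {i | f i w = 0} = J → ⟪ys, w⟫ = 0 → ⟪ybs, w⟫ = 0 := by
    intro J
    by_cases hJ : ∃ u, (∀ i, f i u ≤ 0) ∧ {i | f i u = 0} = J ∧ ⟪ybs, u⟫ < 0
    · obtain ⟨u, -, huJ, hu⟩ := hJ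
      have hlim : Tendsto (fun ys : E => ⟪ys, u⟫) (𝓝 ybs) (𝓝 ⟪ybs, u⟫) :=
        Continuous.tendsto (by fun_prop) ybs
      filter_upwards [hlim.eventually_lt_const hu] with ys hys hpolar w hw hwJ hw0
      have hslope : ∀ i, f i w = 0 → f i (-u) ≤ 0 := fun i hi => by
        have hi' : i ∈ {i | f i u = 0} := by rw [huJ, ← hwJ]; exact hi
        rw [map_neg, show f i u = 0 from hi', neg_zero]
      obtain ⟨t, hmem, ht⟩ :=
        ((eventually_add_smul_mem_polyhedron hw hslope).and self_mem_nhdsWithin).exists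
      have h := hpolar _ hmem
      rw [inner_add_right, hw0, real_inner_smul_right, inner_neg_right, zero_add] at h
      have := nonpos_of_mul_nonpos_right h ht
      linarith
    · push Not at hJ
      exact Eventually.of_forall fun ys _ w hw hwJ _ => le_antisymm (hybs w hw) (hJ w hw hwJ)
  filter_upwards [eventually_all.2 key] with ys hys hpolar w hw hw0
  exact hys _ hpolar w hw rfl hw0

end Polyhedron

/-- Local description of the critical cones of a convex polyhedron near a given graph
point of its normal-cone map (Lemma `LemPolyDescr`). -/
theorem stmt13 {m : ℕ} (Γ : Set (Es m)) (hΓ : IsPolyhedron Γ)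
    (yb ybs : Es m) (hbar : ybs ∈ Nmap Γ yb) :
    ∃ ρ : ℝ, 0 < ρ ∧ ∀ y ys : Es m, ys ∈ Nmap Γ y → dist (y, ys) (yb, ybs) ≤ ρ →
      tcone Γ y ∩ {w | ⟪ys, w⟫ = 0} =
        ((tcone Γ yb ∩ {w | ⟪ybs, w⟫ = 0}) ∩ {w | ⟪ys - ybs, w⟫ = 0}) +
          lineSpan (y - yb) := by
  obtain ⟨k, f, c, rfl⟩ := hΓ
  have hyb : ∀ i, f i yb ≤ c i := hbar.1
  have hface := eventually_inner_eq_zero_of_polar (fun i : {i // f i yb = c i} => f i)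
    (ybs := ybs) fun w hw => inner_nonpos_of_mem_Nmap_polyhedron hbar fun i hi => hw ⟨i, hi⟩
  have hactive : ∀ᶠ y in 𝓝 yb, ∀ i, f i y = c i → f i yb = c i := by
    refine eventually_all.2 fun i => ?_
    rcases (hyb i).eq_or_lt with h | h
    · exact Eventually.of_forall fun _ _ => h
    · filter_upwards [((f i).continuous.tendsto yb).eventually_lt_const h] with y hy hyc
      exact absurd hyc hy.ne
  obtain ⟨ρ, hρ, hball⟩ := nhds_basis_closedBall.eventually_iff.1
    ((hactive.prod_inl_nhds ybs).and (hface.prod_inr_nhds yb))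
  refine ⟨ρ, hρ, fun y ys hys hdist => ?_⟩
  obtain ⟨hact, hface⟩ := hball (mem_closedBall.2 hdist)
  have hy : ∀ i, f i y ≤ c i := hys.1
  have hv0 : ∀ i, f i y = c i → f i (y - yb) = 0 := fun i hi => by
    rw [map_sub, hi, hact i hi, sub_self]
  have hysv : ⟪ys, y - yb⟫ = 0 := by
    refine le_antisymm (inner_nonpos_of_mem_Nmap_polyhedron hys fun i hi => (hv0 i hi).le) ?_
    have h := inner_nonpos_of_mem_Nmap_polyhedron (w := -(y - yb)) hys fun i hi => by
      rw [map_neg, hv0 i hi, neg_zero]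
    rw [inner_neg_right] at h
    linarith
  have hpolar : ∀ w, (∀ i : {i // f i yb = c i}, f i w ≤ 0) → ⟪ys, w⟫ ≤ 0 := fun w hw =>
    inner_nonpos_of_mem_Nmap_polyhedron hys fun i hi => hw ⟨i, hact i hi⟩
  ext w
  simp only [Set.mem_add, mem_inter_iff, mem_ofPred_eq, lineSpan, mem_tcone_polyhedron_iff hy,
    mem_tcone_polyhedron_iff hyb]
  constructor
  · rintro ⟨hw, hw0⟩
    obtain ⟨t, hmem, ht : 0 < t⟩ := ((eventually_add_smul_mem_polyhedron
      (f := fun i : {i // f i yb = c i} => f i) (c := 0) (y := y - yb) (w := w)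
      (fun i => by
        have := hy i
        rw [map_sub, i.2]
        exact sub_nonpos.2 this)
      (fun i hi => by
        refine hw i ?_
        rw [map_sub, i.2] at hi
        exact sub_eq_zero.1 hi)).and self_mem_nhdsWithin).exists
    have hu : ∀ i : {i // f i yb = c i}, f i (w + t⁻¹ • (y - yb)) ≤ 0 := fun i => by
      have h : f i (y - yb + t • w) ≤ 0 := hmem i
      have heq : w + t⁻¹ • (y - yb) = t⁻¹ • (y - yb + t • w) := by
        rw [smul_add, inv_smul_smul₀ ht.ne', add_comm]
      rw [heq, map_smul, smul_eq_mul]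
      exact mul_nonpos_of_nonneg_of_nonpos (inv_nonneg.2 ht.le) h
    have hysu : ⟪ys, w + t⁻¹ • (y - yb)⟫ = 0 := by
      rw [inner_add_right, real_inner_smul_right, hysv, hw0, mul_zero, add_zero]
    have hybsu := hface hpolar _ hu hysu
    refine ⟨w + t⁻¹ • (y - yb), ⟨⟨fun i hi => hu ⟨i, hi⟩, hybsu⟩, ?_⟩,
      -t⁻¹ • (y - yb), ⟨-t⁻¹, rfl⟩, ?_⟩
    · rw [inner_sub_left, hysu, hybsu, sub_zero]
    · rw [neg_smul, add_neg_cancel_right]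
  · rintro ⟨u, ⟨⟨hu, hybsu⟩, hdiff⟩, _, ⟨α, rfl⟩, rfl⟩
    rw [inner_sub_left, hybsu, sub_zero] at hdiff
    refine ⟨fun i hi => ?_, ?_⟩
    · rw [map_add, map_smul, hv0 i hi, smul_zero, add_zero]
      exact hu i (hact i hi)
    · rw [inner_add_right, real_inner_smul_right, hysv, hdiff, mul_zero, add_zero]
end
end

section
/- Let K ⊆ ℝᵈ be a convex polyhedral cone and (v, v*) ∈ gph N_K. Then: (a) the collection of closed faces of the cone (K ∩ [v*]⊥) + [v] equals {F + [v] : F a closed face of K with v ∈ F ⊆ [v*]⊥}; and (b) the collection of difference cones {F̃₁ − F̃₂ : F̃₁, F̃₂ closed faces of (K ∩ [v*]⊥) + [v] with F̃₂ ⊆ F̃₁} equals {F₁ − F₂ : F₁, F₂ closed faces of K with v ∈ F₂ ⊆ F₁ ⊆ [v*]⊥}. -/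
open Filter Topology Metric Set Pointwise
open scoped RealInnerProductSpace

noncomputable section

/-- A convex polyhedral cone: a set defined by finitely many linear inequalities. -/
def IsPolyCone {E : Type*} [NormedAddCommGroup E] [NormedSpace ℝ E] (K : Set E) : Prop :=
  ∃ (k : ℕ) (f : Fin k → (E →L[ℝ] ℝ)), K = {z | ∀ i, f i z ≤ 0}

/-- **Farkas' lemma** for finitely many linear functionals. -/
theorem exists_nonneg_sum_of_forall_nonpos {E : Type*} [AddCommGroup E] [Module ℝ E] {n : ℕ}
    (f : Fin n → E →ₗ[ℝ] ℝ) (g : E →ₗ[ℝ] ℝ)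
    (h : ∀ x, (∀ i, f i x ≤ 0) → g x ≤ 0) :
    ∃ c : Fin n → ℝ, (∀ i, 0 ≤ c i) ∧ ∀ x, g x = ∑ i, c i * f i x := by
  induction n generalizing g with
  | zero =>
    refine ⟨fun _ => 0, fun _ => le_rfl, fun x => ?_⟩
    have h₁ := h x fun i => i.elim0
    have h₂ := h (-x) fun i => i.elim0
    rw [map_neg] at h₂
    simp only [Finset.univ_eq_empty, Finset.sum_empty]
    linarith
  | succ n ih =>
    by_cases hg : ∀ x, (∀ i : Fin n, f i.succ x ≤ 0) → g x ≤ 0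
    · obtain ⟨c, hc, hsum⟩ := ih (fun i => f i.succ) g hg
      refine ⟨Fin.cons 0 c, Fin.cases le_rfl hc, fun x => ?_⟩
      simp [Fin.sum_univ_succ, hsum x]
    · push Not at hg
      obtain ⟨y, hy, hgy⟩ := hg
      have hpos : 0 < f 0 y := by
        by_contra hle
        exact (h y (Fin.cases (not_lt.mp hle) hy)).not_gt hgy
      obtain ⟨c, hc, hsum⟩ := ih (fun i => f i.succ - (f i.succ y / f 0 y) • f 0)
        (g - (g y / f 0 y) • f 0) (by
          intro x hx
          have hx' := h (x - (f 0 x / f 0 y) • y) (by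
            refine Fin.cases ?_ fun i => ?_
            · simp [hpos.ne']
            · refine le_of_eq_of_le ?_ (hx i)
              simp only [map_sub, map_smul, smul_eq_mul, LinearMap.sub_apply,
                LinearMap.smul_apply]
              ring)
          refine le_of_eq_of_le ?_ hx'
          simp only [map_sub, map_smul, smul_eq_mul, LinearMap.sub_apply, LinearMap.smul_apply]
          ring)
      refine ⟨Fin.cons (g y / f 0 y - ∑ i, c i * (f i.succ y / f 0 y)) c,
        ?_, fun x => ?_⟩
      · refine Fin.cases ?_ hc
        have hs : ∑ i, c i * (f i.succ y / f 0 y) ≤ 0 := Finset.sum_nonpos fun i _ =>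
          mul_nonpos_of_nonneg_of_nonpos (hc i) (div_nonpos_of_nonpos_of_nonneg (hy i) hpos.le)
        have hq : 0 < g y / f 0 y := div_pos hgy hpos
        simp only [Fin.cons_zero]
        linarith
      · have hx := hsum x
        simp only [smul_eq_mul, LinearMap.sub_apply, LinearMap.smul_apply, mul_sub,
          Finset.sum_sub_distrib, ← mul_assoc] at hx
        rw [← Finset.sum_mul] at hx
        simp only [Fin.sum_univ_succ, Fin.cons_zero, Fin.cons_succ]
        simp only [← mul_div_assoc] at hx ⊢
        linarith

section Faces

variable {E : Type*} [NormedAddCommGroup E] [InnerProductSpace ℝ E] {K : Set E} {v vs zs : E}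

theorem IsPolyCone.add_mem (hK : IsPolyCone K) {x y : E} (hx : x ∈ K) (hy : y ∈ K) :
    x + y ∈ K := by
  obtain ⟨k, f, rfl⟩ := hK
  intro i
  rw [map_add]
  exact add_nonpos (hx i) (hy i)

theorem IsPolyCone.smul_mem (hK : IsPolyCone K) {x : E} (hx : x ∈ K) {a : ℝ} (ha : 0 ≤ a) :
    a • x ∈ K := by
  obtain ⟨k, f, rfl⟩ := hK
  intro i
  rw [map_smul]
  exact mul_nonpos_of_nonneg_of_nonpos ha (hx i)

/-- A functional that is nonpositive on the face `K ∩ [vs]⊥` becomes polar to `K` after adding a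
large multiple of `vs`. -/
theorem IsPolyCone.exists_add_smul_mem_pol (hK : IsPolyCone K)
    (hzs : zs ∈ pol (K ∩ {w | ⟪vs, w⟫ = 0})) (hvs : vs ∈ pol K) :
    ∃ μ : ℝ, zs + μ • vs ∈ pol K := by
  obtain ⟨k, f, rfl⟩ := hK
  obtain ⟨c, hc, hsum⟩ := exists_nonneg_sum_of_forall_nonpos
    (Fin.cons (-(innerSL ℝ vs : E →ₗ[ℝ] ℝ)) fun i => (f i : E →ₗ[ℝ] ℝ))
    (innerSL ℝ zs : E →ₗ[ℝ] ℝ) (by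
      intro x hx
      have hxK : ∀ i, f i x ≤ 0 := fun i => by simpa using hx i.succ
      have hx₀ : 0 ≤ ⟪vs, x⟫ := by simpa using hx 0
      simpa using hzs x ⟨hxK, le_antisymm (hvs x hxK) hx₀⟩)
  refine ⟨c 0, fun w hw => ?_⟩
  have hw' := hsum w
  simp only [Fin.sum_univ_succ, Fin.cons_zero, Fin.cons_succ, LinearMap.neg_apply,
    ContinuousLinearMap.coe_coe, innerSL_apply_apply] at hw'
  have hs : ∑ i, c i.succ * f i w ≤ 0 := Finset.sum_nonpos fun i _ =>
    mul_nonpos_of_nonneg_of_nonpos (hc _) (hw i)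
  rw [inner_add_left, real_inner_smul_left]
  linarith

/-- Faces of the face `K ∩ [vs]⊥` are faces of `K`. -/
theorem IsPolyCone.isFaceOf_inter (hK : IsPolyCone K)
    (hzs : zs ∈ pol (K ∩ {w | ⟪vs, w⟫ = 0})) (hvs : vs ∈ pol K) :
    IsFaceOf K (K ∩ {w | ⟪vs, w⟫ = 0} ∩ {w | ⟪zs, w⟫ = 0}) := by
  obtain ⟨μ, hμ⟩ := hK.exists_add_smul_mem_pol hzs hvs
  have key : ∀ w, ⟪zs + (μ + 1) • vs, w⟫ = ⟪zs + μ • vs, w⟫ + ⟪vs, w⟫ := fun w => by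
    simp only [inner_add_left, real_inner_smul_left]
    ring
  refine ⟨zs + (μ + 1) • vs, fun w hw => ?_, ?_⟩
  · rw [key]
    exact add_nonpos (hμ w hw) (hvs w hw)
  · ext w
    simp only [mem_inter_iff, mem_ofPred_eq]
    constructor
    · rintro ⟨⟨hw, h₁⟩, h₂⟩
      refine ⟨hw, ?_⟩
      rw [inner_add_left, real_inner_smul_left, h₁, h₂]
      simp
    · rintro ⟨hw, h⟩
      have h₁ := hμ w hw
      have h₂ := hvs w hw
      rw [key] at h
      have h₃ : ⟪vs, w⟫ = 0 := by linarith
      rw [inner_add_left, real_inner_smul_left, h₃] at h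
      exact ⟨⟨hw, h₃⟩, by linarith [h]⟩

theorem isFaceOf_add_lineSpan {F : Set E} (hF : IsFaceOf K F) (hvF : v ∈ F)
    (hFvs : F ⊆ {w | ⟪vs, w⟫ = 0}) :
    IsFaceOf ((K ∩ {w | ⟪vs, w⟫ = 0}) + lineSpan v) (F + lineSpan v) := by
  obtain ⟨zs, hzs, rfl⟩ := hF
  have hv₀ : ⟪zs, v⟫ = 0 := hvF.2
  refine ⟨zs, ?_, ?_⟩
  · rintro _ ⟨g, hg, _, ⟨α, rfl⟩, rfl⟩
    simpa [inner_add_right, real_inner_smul_right, hv₀] using hzs g hg.1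
  · ext x
    constructor
    · rintro ⟨g, hg, _, ⟨α, rfl⟩, rfl⟩
      refine ⟨⟨g, ⟨hg.1, hFvs hg⟩, _, ⟨α, rfl⟩, rfl⟩, ?_⟩
      simpa [inner_add_right, real_inner_smul_right, hv₀] using hg.2
    · rintro ⟨⟨g, hg, _, ⟨α, rfl⟩, rfl⟩, hx⟩
      refine ⟨g, ⟨hg.1, ?_⟩, _, ⟨α, rfl⟩, rfl⟩
      simpa [inner_add_right, real_inner_smul_right, hv₀] using hx

theorem IsPolyCone.exists_isFaceOf_of_isFaceOf_add_lineSpan (hK : IsPolyCone K) (hv : v ∈ K)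
    (hvs : vs ∈ pol K) (hperp : ⟪vs, v⟫ = 0) {F' : Set E}
    (hF' : IsFaceOf ((K ∩ {w | ⟪vs, w⟫ = 0}) + lineSpan v) F') :
    ∃ F, IsFaceOf K F ∧ v ∈ F ∧ F ⊆ {w | ⟪vs, w⟫ = 0} ∧ F' = F + lineSpan v := by
  obtain ⟨zs, hzs, rfl⟩ := hF'
  have hline : ∀ (g : E) (_ : g ∈ K ∩ {w | ⟪vs, w⟫ = 0}) (α : ℝ), ⟪zs, g + α • v⟫ ≤ 0 :=
    fun g hg α => hzs _ ⟨g, hg, _, ⟨α, rfl⟩, rfl⟩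
  have hv₀ : ⟪zs, v⟫ = 0 := by
    have h₁ := hline v ⟨hv, hperp⟩ 0
    have h₂ := hline v ⟨hv, hperp⟩ (-2)
    simp only [inner_add_right, real_inner_smul_right] at h₁ h₂
    linarith
  have hzs' : zs ∈ pol (K ∩ {w | ⟪vs, w⟫ = 0}) := fun g hg => by simpa using hline g hg 0
  refine ⟨_, hK.isFaceOf_inter hzs' hvs, ⟨⟨hv, hperp⟩, hv₀⟩, fun w hw => hw.1.2, ?_⟩
  ext x
  constructor
  · rintro ⟨⟨g, hg, _, ⟨α, rfl⟩, rfl⟩, hx⟩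
    refine ⟨g, ⟨hg, ?_⟩, _, ⟨α, rfl⟩, rfl⟩
    simpa [inner_add_right, real_inner_smul_right, hv₀] using hx
  · rintro ⟨g, hg, _, ⟨α, rfl⟩, rfl⟩
    refine ⟨⟨g, hg.1, _, ⟨α, rfl⟩, rfl⟩, ?_⟩
    simpa [inner_add_right, real_inner_smul_right, hv₀] using hg.2

theorem IsFaceOf.subset_of_subset_add_lineSpan {F₁ F₂ : Set E} (h₁ : IsFaceOf K F₁)
    (h₂ : IsFaceOf K F₂) (hv : v ∈ F₁) (h : F₂ ⊆ F₁ + lineSpan v) : F₂ ⊆ F₁ := by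
  obtain ⟨z₁, -, rfl⟩ := h₁
  obtain ⟨z₂, -, rfl⟩ := h₂
  intro x hx
  refine ⟨hx.1, ?_⟩
  obtain ⟨g, hg, _, ⟨α, rfl⟩, rfl⟩ := h hx
  have hg₀ : ⟪z₁, g⟫ = 0 := hg.2
  have hv₀ : ⟪z₁, v⟫ = 0 := hv.2
  simp [inner_add_right, real_inner_smul_right, hg₀, hv₀]

theorem subset_add_lineSpan (F : Set E) (v : E) : F ⊆ F + lineSpan v :=
  fun x hx => ⟨x, hx, 0, ⟨0, by simp⟩, by simp⟩

theorem IsPolyCone.add_smul_mem_of_isFaceOf (hK : IsPolyCone K) {F : Set E} (hF : IsFaceOf K F)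
    (hv : v ∈ F) {x : E} (hx : x ∈ F) {a : ℝ} (ha : 0 ≤ a) : x + a • v ∈ F := by
  obtain ⟨z, -, rfl⟩ := hF
  refine ⟨hK.add_mem hx.1 (hK.smul_mem hv.1 ha), ?_⟩
  have hx₀ : ⟪z, x⟫ = 0 := hx.2
  have hv₀ : ⟪z, v⟫ = 0 := hv.2
  simp [inner_add_right, real_inner_smul_right, hx₀, hv₀]

/-- Difference cones of faces through `v` absorb the line spanned by `v`. -/
theorem IsPolyCone.add_lineSpan_sub_add_lineSpan (hK : IsPolyCone K) {F₁ F₂ : Set E}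
    (h₁ : IsFaceOf K F₁) (h₂ : IsFaceOf K F₂) (hv₁ : v ∈ F₁) (hv₂ : v ∈ F₂) :
    (F₁ + lineSpan v) - (F₂ + lineSpan v) = F₁ - F₂ := by
  refine Subset.antisymm ?_
    (sub_subset_sub (subset_add_lineSpan F₁ v) (subset_add_lineSpan F₂ v))
  rintro _ ⟨_, ⟨x, hx, _, ⟨α, rfl⟩, rfl⟩, _, ⟨y, hy, _, ⟨β, rfl⟩, rfl⟩, rfl⟩
  rcases le_total β α with hαβ | hαβ
  · refine ⟨x + (α - β) • v,
      hK.add_smul_mem_of_isFaceOf h₁ hv₁ hx (sub_nonneg.2 hαβ), y, hy, ?_⟩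
    module
  · refine ⟨x, hx, y + (β - α) • v,
      hK.add_smul_mem_of_isFaceOf h₂ hv₂ hy (sub_nonneg.2 hαβ), ?_⟩
    module

end Faces

/-- Description of the faces of `(K ∩ [v*]⊥) + [v]` and of the corresponding difference
cones via faces of `K` (Lemma `LemFace`). -/
theorem stmt14 {d : ℕ} (K : Set (Es d)) (hK : IsPolyCone K)
    (v vs : Es d) (hv : v ∈ K) (hvs : vs ∈ pol K) (hperp : ⟪vs, v⟫ = 0) :
    ({F' | IsFaceOf ((K ∩ {w | ⟪vs, w⟫ = 0}) + lineSpan v) F'} =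
      {F' | ∃ F : Set (Es d), IsFaceOf K F ∧ v ∈ F ∧ F ⊆ {w | ⟪vs, w⟫ = 0} ∧
        F' = F + lineSpan v}) ∧
    ({C | ∃ Ft₁ Ft₂ : Set (Es d),
        IsFaceOf ((K ∩ {w | ⟪vs, w⟫ = 0}) + lineSpan v) Ft₁ ∧
        IsFaceOf ((K ∩ {w | ⟪vs, w⟫ = 0}) + lineSpan v) Ft₂ ∧
        Ft₂ ⊆ Ft₁ ∧ C = Ft₁ - Ft₂} =
      {C | ∃ F₁ F₂ : Set (Es d), IsFaceOf K F₁ ∧ IsFaceOf K F₂ ∧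
        v ∈ F₂ ∧ F₂ ⊆ F₁ ∧ F₁ ⊆ {w | ⟪vs, w⟫ = 0} ∧ C = F₁ - F₂}) := by
  refine ⟨?_, ?_⟩
  · ext F'
    constructor
    · exact hK.exists_isFaceOf_of_isFaceOf_add_lineSpan hv hvs hperp
    · rintro ⟨F, hF, hvF, hFvs, rfl⟩
      exact isFaceOf_add_lineSpan hF hvF hFvs
  · ext C
    constructor
    · rintro ⟨Ft₁, Ft₂, h₁, h₂, hsub, rfl⟩
      obtain ⟨F₁, hF₁, hv₁, hp₁, rfl⟩ :=
        hK.exists_isFaceOf_of_isFaceOf_add_lineSpan hv hvs hperp h₁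
      obtain ⟨F₂, hF₂, hv₂, -, rfl⟩ :=
        hK.exists_isFaceOf_of_isFaceOf_add_lineSpan hv hvs hperp h₂
      exact ⟨F₁, F₂, hF₁, hF₂, hv₂,
        hF₁.subset_of_subset_add_lineSpan hF₂ hv₁ ((subset_add_lineSpan F₂ v).trans hsub), hp₁,
        hK.add_lineSpan_sub_add_lineSpan hF₁ hF₂ hv₁ hv₂⟩
    · rintro ⟨F₁, F₂, hF₁, hF₂, hv₂, hsub, hp₁, rfl⟩
      exact ⟨F₁ + lineSpan v, F₂ + lineSpan v, isFaceOf_add_lineSpan hF₁ (hsub hv₂) hp₁,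
        isFaceOf_add_lineSpan hF₂ hv₂ (hsub.trans hp₁), add_subset_add_right hsub,
        (hK.add_lineSpan_sub_add_lineSpan hF₁ hF₂ (hsub hv₂) hv₂).symm⟩
end
end

section
/- Let M : ℝˢ ⇒ ℝᵈ have closed graph, (x̄,ȳ) ∈ gph M, and a direction u ∈ ℝˢ be given. Assume M is metrically subregular in direction u at (x̄,ȳ) with modulus κ (i.e., for every κ' > κ there is δ > 0 such that dist(x̄+tu', M⁻¹(ȳ)) ≤ κ'·dist(ȳ, M(x̄+tu')) for all t ∈ [0,δ] and ‖u' − u‖ ≤ δ). Then u ∈ T_{M⁻¹(ȳ)}(x̄) if and only if 0 ∈ DM(x̄,ȳ)(u), and moreover N_{M⁻¹(ȳ)}(x̄; u) ⊆ {x* : ∃ y* with ‖y*‖ ≤ κ‖x*‖ and (x*, y*) ∈ N_{gph M}((x̄,ȳ); (u,0))}, which in turn is contained in the range of D*M((x̄,ȳ);(u,0)). -/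
open Filter Topology Metric Set
open scoped RealInnerProductSpace

noncomputable section

/-- A regular normal satisfies the Fréchet inequality, in finite dimensions. -/
theorem exists_inner_sub_le_of_mem_rnc1 {E : Type*} [NormedAddCommGroup E]
    [InnerProductSpace ℝ E] [ProperSpace E] {A : Set E} {x xs : E} (h : xs ∈ rnc1 A x)
    {ε : ℝ} (hε : 0 < ε) :
    ∃ r : ℝ, 0 < r ∧ ∀ x' ∈ A, ‖x' - x‖ ≤ r → ⟪xs, x' - x⟫ ≤ ε * ‖x' - x‖ := by
  by_contra! hcon
  choose y hyA hyr hlt using fun n : ℕ => hcon (1 / ((n : ℝ) + 1)) Nat.one_div_pos_of_nat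
  have hpos : ∀ n, 0 < ‖y n - x‖ := fun n => by
    refine norm_pos_iff.2 fun h0 => ?_
    have := hlt n
    simp [h0] at this
  have hsph : ∀ n, ‖y n - x‖⁻¹ • (y n - x) ∈ sphere (0 : E) 1 := fun n => by
    simp [norm_smul, (hpos n).ne']
  obtain ⟨w, -, φ, hφ, hw⟩ := (isCompact_sphere (0 : E) 1).tendsto_subseq hsph
  have hnorm : Tendsto (fun n => ‖y n - x‖) atTop (𝓝 0) :=
    squeeze_zero (fun _ => norm_nonneg _) hyr tendsto_one_div_add_atTop_nhds_zero_nat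
  have hwt : w ∈ tcone A x := by
    refine ⟨fun n => ‖y (φ n) - x‖, _, fun n => hpos _, hnorm.comp hφ.tendsto_atTop, hw,
      fun n => ?_⟩
    simp [smul_smul, (hpos (φ n)).ne', hyA]
  have hlim : Tendsto (fun n => ⟪xs, ‖y (φ n) - x‖⁻¹ • (y (φ n) - x)⟫) atTop (𝓝 ⟪xs, w⟫) :=
    tendsto_const_nhds.inner hw
  have hge : ε ≤ ⟪xs, w⟫ := ge_of_tendsto' hlim fun n => by
    rw [real_inner_smul_right, inv_mul_eq_div, le_div_iff₀ (hpos _)]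
    exact (hlt _).le
  linarith [h.2 w hwt]

/-- The contingent cone is contained in Mathlib's positive tangent cone. -/
theorem tcone_subset_posTangentConeAt {E : Type*} [NormedAddCommGroup E] [NormedSpace ℝ E]
    (A : Set E) (x : E) : tcone A x ⊆ posTangentConeAt A x := by
  rintro w ⟨t, w', ht, ht0, hw, hA⟩
  refine mem_tangentConeAt_of_seq atTop (fun k => Real.toNNReal (t k)⁻¹) (fun k => t k • w' k)
    (by simpa using ht0.smul hw) (Eventually.of_forall hA) (hw.congr fun k => ?_)
  have : 0 ≤ (t k)⁻¹ := inv_nonneg.2 (ht k).le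
  rw [NNReal.smul_def, Real.coe_toNNReal _ this, smul_smul, inv_mul_cancel₀ (ht k).ne', one_smul]

/-- The derivative of the smoothed norm `q ↦ √(‖g q‖² + δ²)`. -/
theorem hasFDerivAt_sqrt_norm_sq_add {G E : Type*} [NormedAddCommGroup G] [NormedSpace ℝ G]
    [NormedAddCommGroup E] [InnerProductSpace ℝ E] {g : G → E} {g' : G →L[ℝ] E} {p : G}
    (hg : HasFDerivAt g g' p) {δ : ℝ} (hδ : 0 < δ) :
    HasFDerivAt (fun q => √(‖g q‖ ^ 2 + δ ^ 2))
      ((√(‖g p‖ ^ 2 + δ ^ 2))⁻¹ • (innerSL ℝ (g p)).comp g') p := by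
  have hpos : ‖g p‖ ^ 2 + δ ^ 2 ≠ 0 := by positivity
  refine ((hg.norm_sq.add_const (δ ^ 2)).sqrt hpos).congr_fderiv ?_
  ext w
  simp
  ring

/-- Regular normals to a graph near a point at which an inequality coming from a subregularity
estimate holds. -/
theorem exists_rnc2_near_of_inner_le {E F : Type*} [NormedAddCommGroup E]
    [InnerProductSpace ℝ E] [ProperSpace E] [NormedAddCommGroup F] [InnerProductSpace ℝ F]
    [ProperSpace F] {A : Set (E × F)} (hA : IsClosed A) {x xs : E} {y : F} (hxy : (x, y) ∈ A)
    {L ε ρ : ℝ} (hL : 0 ≤ L) (hε : 0 < ε) (hρ : 0 < ρ) (hρ1 : ρ ≤ 1)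
    (hle : ∀ q ∈ A, ‖q - (x, y)‖ ≤ ρ →
      ⟪xs, q.1 - x⟫ ≤ L * ‖q.2 - y‖ + 2 * ε * ‖q.1 - x‖) :
    ∃ p, ‖p - (x, y)‖ ≤ ρ ∧ ∃ z ∈ rnc2 A p, ‖z.1 - xs‖ ≤ 4 * ε ∧ ‖z.2‖ ≤ L + 2 * ε := by
  have hLε : 0 < L + 2 * ε := by linarith
  set δ : ℝ := ε * ρ ^ 2 / (4 * (L + 2 * ε)) with hδdef
  have hδ : 0 < δ := by positivity
  have hδeq : (L + 2 * ε) * δ = ε * (ρ / 2) ^ 2 := by rw [hδdef]; field_simp; ring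
  set f : E × F → ℝ := fun q => L * √(‖q.2 - y‖ ^ 2 + δ ^ 2) - ⟪xs, q.1 - x⟫ +
    2 * ε * √(‖q.1 - x‖ ^ 2 + δ ^ 2) + ε * (‖q.1 - x‖ ^ 2 + ‖q.2 - y‖ ^ 2) with hf
  have hcont : Continuous f := by fun_prop
  have hmem : (x, y) ∈ A ∩ closedBall (x, y) ρ := ⟨hxy, mem_closedBall_self hρ.le⟩
  obtain ⟨p, ⟨hpA, hpρ⟩, hmin⟩ := ((isCompact_closedBall (x, y) ρ).inter_left hA).exists_isMinOn
    ⟨_, hmem⟩ hcont.continuousOn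
  rw [mem_closedBall, dist_eq_norm] at hpρ
  have hsqrt : ∀ a : ℝ, 0 ≤ a → a ≤ √(a ^ 2 + δ ^ 2) := fun a ha =>
    Real.le_sqrt_of_sq_le (by nlinarith)
  have hquad : ‖p.1 - x‖ ^ 2 + ‖p.2 - y‖ ^ 2 ≤ (ρ / 2) ^ 2 := by
    have h1 : f p ≤ f (x, y) := hmin hmem
    have h2 : f (x, y) = (L + 2 * ε) * δ := by simp [hf, Real.sqrt_sq hδ.le]; ring
    have h3 := hle p hpA hpρ
    have h4 := mul_le_mul_of_nonneg_left (hsqrt _ (norm_nonneg (p.2 - y))) hL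
    have h5 := mul_le_mul_of_nonneg_left (hsqrt _ (norm_nonneg (p.1 - x)))
      (by linarith : 0 ≤ 2 * ε)
    rw [h2, hδeq] at h1
    refine le_of_mul_le_mul_left ?_ hε
    simp only [hf] at h1
    linarith
  have hp1 : ‖p.1 - x‖ ≤ ρ / 2 := abs_le_of_sq_le_sq' (by nlinarith [sq_nonneg ‖p.2 - y‖])
    (by linarith) |>.2
  have hp2 : ‖p.2 - y‖ ≤ ρ / 2 := abs_le_of_sq_le_sq' (by nlinarith [sq_nonneg ‖p.1 - x‖])
    (by linarith) |>.2
  have hlt : dist p (x, y) < ρ := by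
    rw [dist_eq_norm, Prod.norm_def]
    exact (max_le hp1 hp2).trans_lt (by linarith)
  have hloc : IsLocalMinOn f A p := by
    filter_upwards [inter_mem_nhdsWithin A (isOpen_ball.mem_nhds hlt)] with q hq
    exact hmin ⟨hq.1, ball_subset_closedBall hq.2⟩
  set S₁ := √(‖p.1 - x‖ ^ 2 + δ ^ 2) with hS₁
  set S₂ := √(‖p.2 - y‖ ^ 2 + δ ^ 2) with hS₂
  have hS₁pos : 0 < S₁ := Real.sqrt_pos.2 (by positivity)
  have hS₂pos : 0 < S₂ := Real.sqrt_pos.2 (by positivity)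
  have hd1 : HasFDerivAt (fun q : E × F => q.1 - x) (ContinuousLinearMap.fst ℝ E F) p :=
    hasFDerivAt_fst.sub_const x
  have hd2 : HasFDerivAt (fun q : E × F => q.2 - y) (ContinuousLinearMap.snd ℝ E F) p :=
    hasFDerivAt_snd.sub_const y
  have hderiv := ((((hasFDerivAt_sqrt_norm_sq_add hd2 hδ).const_mul L).sub
    ((innerSL ℝ xs).hasFDerivAt.comp p hd1)).add
    ((hasFDerivAt_sqrt_norm_sq_add hd1 hδ).const_mul (2 * ε))).add
    ((hd1.norm_sq.add hd2.norm_sq).const_mul ε)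
  refine ⟨p, hpρ, (xs - (2 * ε * S₁⁻¹ + 2 * ε) • (p.1 - x), -(L * S₂⁻¹ + 2 * ε) • (p.2 - y)),
    ⟨hpA, fun w hw => ?_⟩, ?_, ?_⟩
  · have h0 := hloc.hasFDerivWithinAt_nonneg hderiv.hasFDerivWithinAt
      (tcone_subset_posTangentConeAt A p hw)
    simp [← hS₁, ← hS₂] at h0
    simp only [pr2, inner_sub_left, real_inner_smul_left] at h0 ⊢
    linarith
  · have h1 : S₁⁻¹ * ‖p.1 - x‖ ≤ 1 := by
      rw [inv_mul_le_iff₀ hS₁pos, mul_one]; exact hsqrt _ (norm_nonneg _)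
    rw [sub_sub_cancel_left, norm_neg, norm_smul, Real.norm_of_nonneg (by positivity)]
    nlinarith
  · have h1 : S₂⁻¹ * ‖p.2 - y‖ ≤ 1 := by
      rw [inv_mul_le_iff₀ hS₂pos, mul_one]; exact hsqrt _ (norm_nonneg _)
    rw [norm_smul, norm_neg, Real.norm_of_nonneg (by positivity)]
    nlinarith

/-- The slice of a set with closed graph is closed. -/
theorem isClosed_setOf_mem_of_isClosed_gph {E F : Type*} [TopologicalSpace E]
    [TopologicalSpace F] {M : E → Set F} (hM : IsClosed (gph M)) (y : F) :
    IsClosed {x | y ∈ M x} :=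
  hM.preimage (Continuous.prodMk_left y)

/-- A subregularity estimate at `z` yields, for every `y' ∈ M z`, a nearest point of `M⁻¹(y)`
at distance at most `c * ‖y' - y‖`. -/
theorem exists_nearest_of_infEDist_le {E F : Type*} [NormedAddCommGroup E]
    [ProperSpace E] [NormedAddCommGroup F] {M : E → Set F} (hM : IsClosed (gph M))
    {x z : E} {y y' : F} (hx : y ∈ M x) (hz : y' ∈ M z) {c : ℝ} (hc : 0 ≤ c)
    (h : Metric.infEDist z {x | y ∈ M x} ≤ ENNReal.ofReal c * Metric.infEDist y (M z)) :
    ∃ x', y ∈ M x' ∧ ‖z - x'‖ ≤ ‖z - x‖ ∧ ‖z - x'‖ ≤ c * ‖y' - y‖ := by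
  have hne : {x | y ∈ M x}.Nonempty := ⟨x, hx⟩
  obtain ⟨x', hx', hd⟩ := (isClosed_setOf_mem_of_isClosed_gph hM y).exists_infDist_eq_dist hne z
  rw [dist_eq_norm] at hd
  refine ⟨x', hx', ?_, ?_⟩
  · rw [← hd, ← dist_eq_norm]
    exact infDist_le_dist_of_mem hx
  · rw [← hd, ← dist_eq_norm, dist_comm, infDist]
    refine ENNReal.toReal_le_of_le_ofReal (by positivity) (h.trans ?_)
    rw [ENNReal.ofReal_mul hc, ← edist_dist]
    gcongr
    exact infEDist_le_edist_of_mem hz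

/-- Regular normals to `M⁻¹(y)` are approximated by regular normals to the graph of `M`, under a
subregularity estimate near the point. -/
theorem exists_rnc2_gph_near {E F : Type*} [NormedAddCommGroup E]
    [InnerProductSpace ℝ E] [ProperSpace E] [NormedAddCommGroup F] [InnerProductSpace ℝ F]
    [ProperSpace F] {M : E → Set F} (hM : IsClosed (gph M)) {x xs : E} {y : F}
    (hxs : xs ∈ rnc1 {x | y ∈ M x} x) {c r η : ℝ} (hc : 0 ≤ c) (hr : 0 < r)
    (h : ∀ z, ‖z - x‖ ≤ r →
      Metric.infEDist z {x | y ∈ M x} ≤ ENNReal.ofReal c * Metric.infEDist y (M z))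
    (hη : 0 < η) :
    ∃ p, ‖p - (x, y)‖ ≤ r ∧ ∃ z ∈ rnc2 (gph M) p, ‖z.1 - xs‖ ≤ η ∧ ‖z.2‖ ≤ c * ‖xs‖ + η := by
  obtain ⟨R, hR, hfr⟩ := exists_inner_sub_le_of_mem_rnc1 hxs (ε := η / 4) (by positivity)
  have hx : y ∈ M x := hxs.1
  have hle : ∀ q ∈ gph M, ‖q - (x, y)‖ ≤ min (min r (R / 2)) 1 →
      ⟪xs, q.1 - x⟫ ≤ c * ‖xs‖ * ‖q.2 - y‖ + 2 * (η / 4) * ‖q.1 - x‖ := by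
    intro q hq hqρ
    have hq1 : ‖q.1 - x‖ ≤ min (min r (R / 2)) 1 := (norm_fst_le (q - (x, y))).trans hqρ
    obtain ⟨x', hx', hd1, hd2⟩ := exists_nearest_of_infEDist_le hM hx (show q.2 ∈ M q.1 from hq) hc
      (h q.1 (hq1.trans ((min_le_left _ _).trans (min_le_left _ _))))
    have hq2 : ‖q.1 - x‖ ≤ R / 2 := hq1.trans ((min_le_left _ _).trans (min_le_right _ _))
    have htri : ‖x' - x‖ ≤ 2 * ‖q.1 - x‖ := by
      have := norm_sub_le_norm_sub_add_norm_sub x' q.1 x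
      rw [norm_sub_rev x' q.1] at this
      linarith
    have h1 := hfr x' hx' (by linarith)
    have h2 := real_inner_le_norm xs (q.1 - x')
    have h3 := mul_le_mul_of_nonneg_left hd2 (norm_nonneg xs)
    have h4 := mul_le_mul_of_nonneg_left htri (by positivity : 0 ≤ η / 4)
    have h5 : ⟪xs, q.1 - x⟫ = ⟪xs, q.1 - x'⟫ + ⟪xs, x' - x⟫ := by
      rw [← inner_add_right, sub_add_sub_cancel]
    linarith
  obtain ⟨p, hp, z, hz, hz1, hz2⟩ := exists_rnc2_near_of_inner_le hM (show (x, y) ∈ gph M from hx)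
    (by positivity) (by positivity) (by positivity) (min_le_right _ _) hle
  exact ⟨p, hp.trans ((min_le_left _ _).trans (min_le_left _ _)), z, hz, by linarith,
    by linarith⟩

/-- Sequences in the definition of `dnc2` may be replaced by approximations, with a bounded second
component of the normals. -/
theorem exists_mem_dnc2_of_forall_approx {E F : Type*} [NormedAddCommGroup E]
    [InnerProductSpace ℝ E] [NormedAddCommGroup F] [InnerProductSpace ℝ F]
    [ProperSpace F] {A : Set (E × F)} {z w : E × F} {xs : E} {B : ℝ}
    (h : ∀ ε : ℝ, 0 < ε → ∃ t : ℝ, 0 < t ∧ t ≤ ε ∧ ∃ w', ‖w' - w‖ ≤ ε ∧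
      ∃ zs ∈ rnc2 A (z + t • w'), ‖zs.1 - xs‖ ≤ ε ∧ ‖zs.2‖ ≤ B + ε) :
    ∃ ys : F, ‖ys‖ ≤ B ∧ (xs, ys) ∈ dnc2 A z w := by
  choose t ht htε w' hw zs hzs h1 h2 using fun n : ℕ =>
    h (1 / ((n : ℝ) + 1)) Nat.one_div_pos_of_nat
  have hlim := tendsto_one_div_add_atTop_nhds_zero_nat (𝕜 := ℝ)
  have hbdd : ∀ n, (zs n).2 ∈ closedBall (0 : F) (B + 1) := fun n => by
    rw [mem_closedBall_zero_iff]
    refine (h2 n).trans (add_le_add_right ?_ B)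
    rw [div_le_one (by positivity)]
    linarith [n.cast_nonneg (α := ℝ)]
  obtain ⟨ys, -, φ, hφ, hys⟩ := (isCompact_closedBall (0 : F) (B + 1)).tendsto_subseq hbdd
  have hφt := hφ.tendsto_atTop
  have hB : Tendsto (fun n : ℕ => B + 1 / ((n : ℝ) + 1)) atTop (𝓝 B) := by
    simpa using hlim.const_add B
  refine ⟨ys, le_of_tendsto_of_tendsto' hys.norm (hB.comp hφt) fun n => h2 (φ n), t ∘ φ, w' ∘ φ,
    zs ∘ φ, fun n => ht _, (squeeze_zero (fun n => (ht n).le) htε hlim).comp hφt, ?_, ?_,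
    fun n => hzs _⟩
  · exact (tendsto_iff_norm_sub_tendsto_zero.2
      (squeeze_zero (fun _ => norm_nonneg _) hw hlim)).comp hφt
  · exact ((tendsto_iff_norm_sub_tendsto_zero.2
      (squeeze_zero (fun _ => norm_nonneg _) h1 hlim)).comp hφt).prodMk_nhds hys

/-- Tangents and directional limiting normals to `M⁻¹(yb)` under directional metric
subregularity with modulus `κ` (Proposition `PropDirNormalCone`). -/
theorem stmt15 {s d : ℕ} (M : Es s → Set (Es d)) (xb : Es s) (yb : Es d)
    (hcl : IsClosed (gph M)) (hbar : yb ∈ M xb) (u : Es s) (κ : ℝ) (hκ : 0 ≤ κ)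
    (hsub : ∀ κ' : ℝ, κ < κ' → ∃ δ : ℝ, 0 < δ ∧ ∀ t ∈ Icc (0:ℝ) δ, ∀ u' : Es s,
      ‖u' - u‖ ≤ δ →
      EMetric.infEdist (xb + t • u') {x | yb ∈ M x} ≤
        ENNReal.ofReal κ' * EMetric.infEdist yb (M (xb + t • u'))) :
    (u ∈ tcone {x | yb ∈ M x} xb ↔ (u, (0 : Es d)) ∈ tcone (gph M) (xb, yb)) ∧
    dnc1 {x | yb ∈ M x} xb u ⊆
      {xs | ∃ ys : Es d, ‖ys‖ ≤ κ * ‖xs‖ ∧ (xs, ys) ∈ dnc2 (gph M) (xb, yb) (u, 0)} ∧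
    {xs | ∃ ys : Es d, ‖ys‖ ≤ κ * ‖xs‖ ∧ (xs, ys) ∈ dnc2 (gph M) (xb, yb) (u, 0)} ⊆
      {xs | ∃ ys : Es d, (xs, -ys) ∈ dnc2 (gph M) (xb, yb) (u, 0)} := by
  refine ⟨⟨?_, ?_⟩, ?_, ?_⟩
  · rintro ⟨t, w, ht, ht0, hw, hmem⟩
    refine ⟨t, fun k => (w k, 0), ht, ht0, hw.prodMk_nhds tendsto_const_nhds, fun k => ?_⟩
    simpa [gph] using hmem k
  · rintro ⟨t, w, ht, ht0, hw, hmem⟩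
    obtain ⟨δ, hδ, hδsub⟩ := hsub (κ + 1) (by linarith)
    have hw1 : Tendsto (fun k => (w k).1) atTop (𝓝 u) := hw.fst_nhds
    have hw2 : Tendsto (fun k => (w k).2) atTop (𝓝 0) := hw.snd_nhds
    have hev : ∀ᶠ k in atTop, t k ≤ δ ∧ ‖(w k).1 - u‖ ≤ δ :=
      (ht0.eventually_le_const hδ).and
        ((tendsto_iff_norm_sub_tendsto_zero.1 hw1).eventually_le_const hδ)
    obtain ⟨N, hN⟩ := eventually_atTop.1 hev
    have key : ∀ k, ∃ x', yb ∈ M x' ∧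
        ‖xb + t (k + N) • (w (k + N)).1 - x'‖ ≤ (κ + 1) * (t (k + N) * ‖(w (k + N)).2‖) := by
      intro k
      obtain ⟨h1, h2⟩ := hN (k + N) (by omega)
      obtain ⟨x', hx', -, hd⟩ := exists_nearest_of_infEDist_le hcl hbar (hmem (k + N))
        (by linarith : 0 ≤ κ + 1) (hδsub _ ⟨(ht _).le, h1⟩ _ h2)
      refine ⟨x', hx', hd.trans_eq ?_⟩
      simp [norm_smul, abs_of_pos (ht _)]
    choose x' hx' hd using key
    refine ⟨fun k => t (k + N), fun k => (t (k + N))⁻¹ • (x' k - xb), fun k => ht _,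
      ht0.comp (tendsto_add_atTop_nat N), ?_, fun k => ?_⟩
    · have hlim : Tendsto (fun k => (κ + 1) * ‖(w (k + N)).2‖) atTop (𝓝 0) := by
        simpa using (hw2.norm.comp (tendsto_add_atTop_nat N)).const_mul (κ + 1)
      have hdiff : Tendsto (fun k => (w (k + N)).1 - (t (k + N))⁻¹ • (x' k - xb)) atTop
          (𝓝 0) := by
        refine squeeze_zero_norm (fun k => ?_) hlim
        have hpos := ht (k + N)
        have heq : (w (k + N)).1 - (t (k + N))⁻¹ • (x' k - xb) =
            (t (k + N))⁻¹ • (xb + t (k + N) • (w (k + N)).1 - x' k) := by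
          rw [add_sub_right_comm, smul_add, smul_smul, inv_mul_cancel₀ hpos.ne', one_smul,
            ← neg_sub (x' k) xb, smul_neg]
          abel
        rw [heq, norm_smul, norm_inv, Real.norm_of_nonneg hpos.le, inv_mul_le_iff₀ hpos]
        exact (hd k).trans_eq (by ring)
      simpa using (hw1.comp (tendsto_add_atTop_nat N)).sub hdiff
    · simpa [smul_smul, (ht (k + N)).ne'] using hx' k
  · rintro xs ⟨t, w, xs', ht, ht0, hw, hxs, hmem⟩
    refine exists_mem_dnc2_of_forall_approx fun ε hε => ?_
    set e := min 1 (ε / (κ + ‖xs‖ + 2)) with he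
    have hden : 0 < κ + ‖xs‖ + 2 := by positivity
    have he0 : 0 < e := by positivity
    have he1 : e ≤ 1 := min_le_left _ _
    have heε : e * (κ + ‖xs‖ + 2) ≤ ε := (le_div_iff₀ hden).1 (min_le_right _ _)
    have hee : 2 * e ≤ ε := by nlinarith [norm_nonneg xs]
    obtain ⟨δ, hδ, hδsub⟩ := hsub (κ + e) (by linarith)
    have hev := (((ht0.eventually_le_const hδ).and (ht0.eventually_le_const hε)).and
      ((tendsto_iff_norm_sub_tendsto_zero.1 hw).eventually_le_const
        (by positivity : 0 < min (δ / 2) (ε / 2)))).and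
      ((tendsto_iff_norm_sub_tendsto_zero.1 hxs).eventually_le_const he0)
    obtain ⟨k, ⟨⟨htδ, htε⟩, hwk⟩, hxk⟩ := hev.exists
    have htk := ht k
    obtain ⟨p, hp, z, hz, hz1, hz2⟩ := exists_rnc2_gph_near hcl (hmem k)
      (c := κ + e) (r := t k * min (δ / 2) (ε / 2)) (η := e) (by positivity) (by positivity)
      (fun z hz => by
        have hzeq : z = xb + t k • ((t k)⁻¹ • (z - xb)) := by
          simp [smul_smul, htk.ne']
        have hsplit : (t k)⁻¹ • (z - xb) - u =
            (t k)⁻¹ • (z - (xb + t k • w k)) + (w k - u) := by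
          rw [← sub_sub, smul_sub _ (z - xb), smul_smul, inv_mul_cancel₀ htk.ne', one_smul]
          abel
        have hb : ‖(t k)⁻¹ • (z - (xb + t k • w k))‖ ≤ min (δ / 2) (ε / 2) := by
          rwa [norm_smul, norm_inv, Real.norm_of_nonneg htk.le, inv_mul_le_iff₀ htk]
        have := hδsub (t k) ⟨htk.le, htδ⟩ ((t k)⁻¹ • (z - xb)) (by
          rw [hsplit]
          refine (norm_add_le _ _).trans ?_
          linarith [min_le_left (δ / 2) (ε / 2)])
        rwa [← hzeq] at this) he0
    refine ⟨t k, htk, htε, (t k)⁻¹ • (p - (xb, yb)), ?_, z, ?_,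
      by linarith [norm_sub_le_norm_sub_add_norm_sub z.1 (xs' k) xs], ?_⟩
    · have hsplit : (t k)⁻¹ • (p - (xb, yb)) - (u, 0) =
          (t k)⁻¹ • (p - (xb + t k • w k, yb)) + (w k - u, 0) := by
        ext1
        · simp only [Prod.fst_sub, Prod.fst_add, Prod.smul_fst]
          rw [← sub_sub, smul_sub _ (p.1 - xb), smul_smul, inv_mul_cancel₀ htk.ne', one_smul]
          abel
        · simp
      have hb : ‖(t k)⁻¹ • (p - (xb + t k • w k, yb))‖ ≤ min (δ / 2) (ε / 2) := by
        rwa [norm_smul, norm_inv, Real.norm_of_nonneg htk.le, inv_mul_le_iff₀ htk]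
      have hw0 : ‖((w k - u, 0) : Es s × Es d)‖ = ‖w k - u‖ := by simp [Prod.norm_def]
      rw [hsplit]
      refine (norm_add_le _ _).trans ?_
      rw [hw0]
      linarith [min_le_right (δ / 2) (ε / 2)]
    · simpa [smul_smul, htk.ne'] using hz
    · have hn : ‖xs' k‖ ≤ ‖xs‖ + e := by
        have := norm_le_norm_add_norm_sub xs (xs' k)
        rw [norm_sub_rev] at this
        linarith
      have := mul_le_mul_of_nonneg_left hn (by positivity : 0 ≤ κ + e)
      nlinarith
  · rintro xs ⟨ys, -, h⟩
    exact ⟨-ys, by simpa using h⟩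
end
end
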